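/- Suppose 0≤r<u≤T and v∈C^{1,2}([r,u]×ℝ^d). Then the following are equivalent: (a) for each S∈𝒮_a there exists a basic admissible integrand ξ^S on [r,u] — i.e., ξ^S(t)=∇_x f(A(t),S(t)) for some m∈ℕ, some continuous A:[r,u]→ℝ^m whose components are of bounded variation, some open set O⊆ℝ^m×ℝ^d with (A(t),S(t))∈O for all t, and some continuously differentiable f:O→ℝ such that x↦f(a,x) is twice continuously differentiable for each fixed first argument — such that for all t∈[r,u] the Föllmer integral ∫_r^t ξ^S(s)·dS(s) exists and v(t,S(t)) = v(r,S(r)) + ∫_r^t ξ^S(s)·dS(s); (b) v satisfies the parabolic equation ∂v/∂t + ℒv = 0 on [r,u]×ℝ^d. Moreover, if these equivalent conditions hold, then necessarily ξ^S(t)=∇_x v(t,S(t)). The same equivalence and identification hold with 𝒮_a replaced by 𝒮_a^+, ℝ^d replaced by ℝ_+^d, and ℒ replaced by ℒ^+. -/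

import Mathlib

open Finset Filter Topology Set

noncomputable section

/-- The successor `s'` of `s` in the partition `P` of `[0,T]` (equal to `T` if there is none). -/
def succOf (T : ℝ) (P : Finset ℝ) (s : ℝ) : ℝ :=
  if h : (P.filter (fun u => s < u)).Nonempty then (P.filter (fun u => s < u)).min' h else T

/-- A refining sequence of partitions of `[0,T]` whose meshes tend to zero. -/
structure PartitionSeq (T : ℝ) where
  part : ℕ → Finset ℝ
  subset_Icc : ∀ n, ↑(part n) ⊆ Set.Icc (0 : ℝ) T
  zero_mem : ∀ n, (0 : ℝ) ∈ part n
  top_mem : ∀ n, T ∈ part n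
  refining : ∀ n, part n ⊆ part (n + 1)
  mesh_to_zero : ∀ ε > 0, ∃ N, ∀ n ≥ N, ∀ s ∈ part n, succOf T (part n) s - s < ε
/-- Approximating sums for the covariation `⟨S_i,S_j⟩(t)` along the `n`-th partition. -/
def covSum (T : ℝ) (𝕋 : PartitionSeq T) {d : ℕ} (S : ℝ → Fin d → ℝ) (i j : Fin d)
    (t : ℝ) (n : ℕ) : ℝ :=
  ∑ s ∈ (𝕋.part n).filter (fun s => s ≤ t),
    (S (succOf T (𝕋.part n) s) i - S s i) * (S (succOf T (𝕋.part n) s) j - S s j)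

/-- The Föllmer integral `∫_r^t ξ(s)·dS(s)` exists along `(𝕋_n)` with value `I`. -/
def HasFollmerIntegral (T : ℝ) (𝕋 : PartitionSeq T) {d : ℕ} (ξ S : ℝ → Fin d → ℝ)
    (r t I : ℝ) : Prop :=
  Tendsto (fun n => ∑ s ∈ (𝕋.part n).filter (fun s => r ≤ s ∧ s ≤ t),
    ∑ k, ξ s k * (S (succOf T (𝕋.part n) s) k - S s k)) atTop (𝓝 I)

/-- The open positive orthant `ℝ_+^d`. -/
def posOrth (d : ℕ) : Set (Fin d → ℝ) := {x | ∀ i, 0 < x i}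

/-- The class `𝒮_a`: continuous trajectories whose covariations are `∫_0^t a_ij(s,S(s)) ds`. -/
def SclassA (T : ℝ) (𝕋 : PartitionSeq T) {d : ℕ}
    (a : ℝ → (Fin d → ℝ) → Fin d → Fin d → ℝ) : Set (ℝ → Fin d → ℝ) :=
  {S | ContinuousOn S (Set.Icc 0 T) ∧
    ∀ i j : Fin d, ∀ t ∈ Set.Icc (0 : ℝ) T,
      Tendsto (fun n => covSum T 𝕋 S i j t n) atTop (𝓝 (∫ s in (0 : ℝ)..t, a s (S s) i j))}

/-- The class `𝒮_a^+`: positive continuous trajectories whose covariations are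
`∫_0^t a_ij(s,S(s)) S_i(s) S_j(s) ds`. -/
def SclassAPos (T : ℝ) (𝕋 : PartitionSeq T) {d : ℕ}
    (a : ℝ → (Fin d → ℝ) → Fin d → Fin d → ℝ) : Set (ℝ → Fin d → ℝ) :=
  {S | ContinuousOn S (Set.Icc 0 T) ∧ (∀ t ∈ Set.Icc (0 : ℝ) T, ∀ i, 0 < S t i) ∧
    ∀ i j : Fin d, ∀ t ∈ Set.Icc (0 : ℝ) T,
      Tendsto (fun n => covSum T 𝕋 S i j t n) atTop
        (𝓝 (∫ s in (0 : ℝ)..t, a s (S s) i j * S s i * S s j))}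

/-- First partial derivative in the `i`-th space direction. -/
def pd1 {d : ℕ} (f : (Fin d → ℝ) → ℝ) (i : Fin d) (x : Fin d → ℝ) : ℝ :=
  fderiv ℝ f x (Pi.single i 1)

/-- Second partial derivative in the space directions `i, j`. -/
def pd2 {d : ℕ} (f : (Fin d → ℝ) → ℝ) (i j : Fin d) (x : Fin d → ℝ) : ℝ :=
  fderiv ℝ (fun y => pd1 f j y) x (Pi.single i 1)

/-- Time derivative (within the time interval `I`). -/
def tderiv {d : ℕ} (I : Set ℝ) (v : ℝ → (Fin d → ℝ) → ℝ) (t : ℝ) (x : Fin d → ℝ) : ℝ :=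
  derivWithin (fun τ => v τ x) I t

/-- `v` is of class `C^{1,2}(I × D)`: continuous on `I × D`, continuously differentiable in
`(t,x)` and twice continuously differentiable in `x` on `(int I) × D`, with all derivatives
admitting continuous extensions to `I × D`. -/
structure IsC12 {d : ℕ} (I : Set ℝ) (D : Set (Fin d → ℝ)) (v : ℝ → (Fin d → ℝ) → ℝ) : Prop where
  cont : ContinuousOn (fun p : ℝ × (Fin d → ℝ) => v p.1 p.2) (I ×ˢ D)
  diff : ∀ t ∈ interior I, ∀ x ∈ D,
    DifferentiableAt ℝ (fun p : ℝ × (Fin d → ℝ) => v p.1 p.2) (t, x)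
  diff2 : ∀ t ∈ interior I, ∀ x ∈ D, ∀ j : Fin d, DifferentiableAt ℝ (pd1 (v t) j) x
  derivs_extend : ∃ (gt : ℝ × (Fin d → ℝ) → ℝ) (gx : Fin d → ℝ × (Fin d → ℝ) → ℝ)
      (gxx : Fin d → Fin d → ℝ × (Fin d → ℝ) → ℝ),
    ContinuousOn gt (I ×ˢ D) ∧ (∀ i, ContinuousOn (gx i) (I ×ˢ D)) ∧
    (∀ i j, ContinuousOn (gxx i j) (I ×ˢ D)) ∧
    ∀ t ∈ interior I, ∀ x ∈ D,
      gt (t, x) = deriv (fun τ => v τ x) t ∧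
      (∀ i, gx i (t, x) = pd1 (v t) i x) ∧
      ∀ i j, gxx i j (t, x) = pd2 (v t) i j x

/-- Basic admissible integrands: `ξ(t) = ∇ₓ f(A(t), S(t))` for a continuous bounded-variation
path `A`, an open set `O` containing `(A(t),S(t))`, and `f ∈ C¹(O)` which is `C²` in `x`. -/
def IsBasicAdmissible (d : ℕ) (r u : ℝ) (S ξ : ℝ → Fin d → ℝ) : Prop :=
  ∃ (m : ℕ) (A : ℝ → Fin m → ℝ) (O : Set ((Fin m → ℝ) × (Fin d → ℝ)))
    (f : (Fin m → ℝ) × (Fin d → ℝ) → ℝ),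
    ContinuousOn A (Set.Icc r u) ∧
    (∀ i : Fin m, BoundedVariationOn (fun t => A t i) (Set.Icc r u)) ∧
    IsOpen O ∧ (∀ t ∈ Set.Icc r u, (A t, S t) ∈ O) ∧
    ContDiffOn ℝ 1 f O ∧
    (∀ b : Fin m → ℝ, ContDiffOn ℝ 2 (fun x => f (b, x)) {x | (b, x) ∈ O}) ∧
    ∀ t ∈ Set.Icc r u, ∀ k : Fin d,
      ξ t k = fderiv ℝ (fun x => f (A t, x)) (S t) (Pi.single k 1)

section Partition

variable {T : ℝ} {P : Finset ℝ}

lemma succOf_eq_min' {s : ℝ} (h : (P.filter (fun u => s < u)).Nonempty) :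
    succOf T P s = (P.filter (fun u => s < u)).min' h := by
  simp [succOf, h]

lemma succOf_mem (hT : T ∈ P) (s : ℝ) : succOf T P s ∈ P := by
  by_cases h : (P.filter (fun u => s < u)).Nonempty
  · rw [succOf_eq_min' h]
    exact (Finset.mem_filter.1 (Finset.min'_mem _ h)).1
  · simpa [succOf, h] using hT

lemma lt_succOf {s : ℝ} (hT : T ∈ P) (hs : s < T) : s < succOf T P s := by
  have h : (P.filter (fun u => s < u)).Nonempty := ⟨T, by simp [hT, hs]⟩
  rw [succOf_eq_min' h]
  exact (Finset.mem_filter.1 (Finset.min'_mem _ h)).2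

lemma succOf_le {s x : ℝ} (hx : x ∈ P) (hs : s < x) : succOf T P s ≤ x := by
  have h : (P.filter (fun u => s < u)).Nonempty := ⟨x, by simp [hx, hs]⟩
  rw [succOf_eq_min' h]
  exact Finset.min'_le _ _ (by simp [hx, hs])

lemma succOf_eq_of_forall_le {s : ℝ} (h : ∀ x ∈ P, x ≤ s) : succOf T P s = T := by
  have h' : ¬ (P.filter (fun u => s < u)).Nonempty := by
    rintro ⟨x, hx⟩
    rw [Finset.mem_filter] at hx
    exact absurd (h x hx.1) (not_le.2 hx.2)
  simp [succOf, h']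

lemma le_succOf {s : ℝ} (hT : T ∈ P) (hs : s ≤ T) : s ≤ succOf T P s := by
  rcases hs.lt_or_eq with h | h
  · exact (lt_succOf hT h).le
  · by_cases h' : (P.filter (fun u => s < u)).Nonempty
    · rw [succOf_eq_min' h']
      exact (Finset.mem_filter.1 (Finset.min'_mem _ h')).2.le
    · rw [succOf, dif_neg h']
      exact hs

/-- The predecessor of `x` in `P` (equal to `0` if there is none). -/
def predOf (P : Finset ℝ) (x : ℝ) : ℝ :=
  if h : (P.filter (fun u => u < x)).Nonempty then (P.filter (fun u => u < x)).max' h else 0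

lemma predOf_eq_max' {x : ℝ} (h : (P.filter (fun u => u < x)).Nonempty) :
    predOf P x = (P.filter (fun u => u < x)).max' h := by
  simp [predOf, h]

lemma predOf_mem (h0 : (0 : ℝ) ∈ P) (x : ℝ) : predOf P x ∈ P := by
  by_cases h : (P.filter (fun u => u < x)).Nonempty
  · rw [predOf_eq_max' h]
    exact (Finset.mem_filter.1 (Finset.max'_mem _ h)).1
  · simpa [predOf, h] using h0

lemma predOf_lt {x : ℝ} (h0 : (0 : ℝ) ∈ P) (hx : 0 < x) : predOf P x < x := by
  have h : (P.filter (fun u => u < x)).Nonempty := ⟨0, by simp [h0, hx]⟩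
  rw [predOf_eq_max' h]
  exact (Finset.mem_filter.1 (Finset.max'_mem _ h)).2

lemma le_predOf {x y : ℝ} (hy : y ∈ P) (hyx : y < x) : y ≤ predOf P x := by
  have h : (P.filter (fun u => u < x)).Nonempty := ⟨y, by simp [hy, hyx]⟩
  rw [predOf_eq_max' h]
  exact Finset.le_max' _ _ (by simp [hy, hyx])

lemma succOf_predOf {x : ℝ} (h0 : (0 : ℝ) ∈ P) (hT : T ∈ P) (hP : ∀ y ∈ P, y ≤ T)
    (hx : x ∈ P) (hx0 : 0 < x) : succOf T P (predOf P x) = x := by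
  have h1 := predOf_lt h0 hx0
  refine le_antisymm (succOf_le hx h1) ?_
  by_contra! h
  have h2 := le_predOf (succOf_mem hT (predOf P x)) h
  exact absurd (lt_succOf hT (h1.trans_le (hP x hx))) (not_lt.2 h2)

lemma predOf_succOf {s : ℝ} (h0 : (0 : ℝ) ∈ P) (hP0 : ∀ y ∈ P, 0 ≤ y) (hT : T ∈ P)
    (hs : s ∈ P) (hsT : s < T) : predOf P (succOf T P s) = s := by
  have h1 := lt_succOf (P := P) hT hsT
  refine le_antisymm ?_ (le_predOf hs h1)
  by_contra! h
  have h2 : succOf T P s ≤ _ := succOf_le (predOf_mem h0 (succOf T P s)) h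
  exact absurd (predOf_lt h0 ((hP0 s hs).trans_lt h1)) (not_lt.2 h2)

/-- Telescoping along the points of a partition. -/
lemma sum_succOf_telescope (h0 : (0 : ℝ) ∈ P) (hP0 : ∀ y ∈ P, 0 ≤ y) (hT : T ∈ P)
    (hP : ∀ y ∈ P, y ≤ T) (F : ℝ → ℝ) {x y : ℝ} (hx : x ∈ P) (hy : y ∈ P) (hxy : x ≤ y) :
    ∑ s ∈ P.filter (fun s => x ≤ s ∧ s < y), (F (succOf T P s) - F s) = F y - F x := by
  induction hk : (P.filter (fun s => x ≤ s ∧ s < y)).card using Nat.strong_induction_on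
    generalizing y with
  | _ k ih =>
    rcases hxy.eq_or_lt with rfl | hlt
    · rw [Finset.filter_false_of_mem]
      · simp
      · rintro z - ⟨h1, h2⟩; linarith
    · have hy0 : 0 < y := (hP0 x hx).trans_lt hlt
      set c := predOf P y with hc
      have hcP : c ∈ P := predOf_mem h0 y
      have hcy : c < y := predOf_lt h0 hy0
      have hxc : x ≤ c := le_predOf hx hlt
      have hset : P.filter (fun s => x ≤ s ∧ s < y)
          = insert c (P.filter (fun s => x ≤ s ∧ s < c)) := by
        ext z
        simp only [Finset.mem_filter, Finset.mem_insert]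
        constructor
        · rintro ⟨hz, h1, h2⟩
          rcases (le_predOf hz h2).eq_or_lt with h | h
          · exact Or.inl h
          · exact Or.inr ⟨hz, h1, h⟩
        · rintro (rfl | ⟨hz, h1, h2⟩)
          · exact ⟨hcP, hxc, hcy⟩
          · exact ⟨hz, h1, h2.trans hcy⟩
      have hnm : c ∉ P.filter (fun s => x ≤ s ∧ s < c) := by simp
      have hcard : (P.filter (fun s => x ≤ s ∧ s < c)).card < k := by
        rw [← hk, hset, Finset.card_insert_of_notMem hnm]; omega
      rw [hset, Finset.sum_insert hnm, ih _ hcard hcP hxc rfl,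
        succOf_predOf h0 hT hP hy hy0]
      ring

/-- Reindexing a sum over intervals by their right instead of their left endpoints. -/
lemma sum_succOf_eq_sum_predOf (h0 : (0 : ℝ) ∈ P) (hP0 : ∀ y ∈ P, 0 ≤ y) (hT : T ∈ P)
    (hP : ∀ y ∈ P, y ≤ T) (G : ℝ → ℝ → ℝ) {x y : ℝ} (hx : 0 ≤ x) (hy : y ≤ T)
    (hxP : x ∈ P) (hyP : y ∈ P) :
    ∑ s ∈ P.filter (fun s => x ≤ s ∧ s < y), G s (succOf T P s)
      = ∑ z ∈ P.filter (fun z => x < z ∧ z ≤ y), G (predOf P z) z := by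
  refine Finset.sum_bij' (fun s _ => succOf T P s) (fun z _ => predOf P z) ?_ ?_ ?_ ?_ ?_
  · intro s hs
    rw [Finset.mem_filter] at hs ⊢
    exact ⟨succOf_mem hT s, hs.2.1.trans_lt (lt_succOf hT (hs.2.2.trans_le hy)),
      succOf_le hyP hs.2.2⟩
  · intro z hz
    rw [Finset.mem_filter] at hz ⊢
    exact ⟨predOf_mem h0 z, le_predOf hxP hz.2.1,
      (predOf_lt h0 (hx.trans_lt hz.2.1)).trans_le hz.2.2⟩
  · intro s hs
    rw [Finset.mem_filter] at hs
    exact predOf_succOf h0 hP0 hT hs.1 (hs.2.2.trans_le hy)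
  · intro z hz
    rw [Finset.mem_filter] at hz
    exact succOf_predOf h0 hT hP hz.1 (hx.trans_lt hz.2.1)
  · intro s hs
    rw [Finset.mem_filter] at hs
    simp only [predOf_succOf h0 hP0 hT hs.1 (hs.2.2.trans_le hy)]

lemma sum_predOf_telescope (h0 : (0 : ℝ) ∈ P) (hP0 : ∀ y ∈ P, 0 ≤ y) (hT : T ∈ P)
    (hP : ∀ y ∈ P, y ≤ T) (F : ℝ → ℝ) {x y : ℝ} (hx : x ∈ P) (hy : y ∈ P) (hxy : x ≤ y) :
    ∑ z ∈ P.filter (fun z => x < z ∧ z ≤ y), (F z - F (predOf P z)) = F y - F x := by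
  rw [← sum_succOf_telescope h0 hP0 hT hP F hx hy hxy]
  exact (sum_succOf_eq_sum_predOf h0 hP0 hT hP (fun s s' => F s' - F s) (hP0 x hx) (hP y hy)
    hx hy).symm

/-- Adding the interval of a partition that contains `t` changes a sum by at most one term. -/
lemma abs_sum_filter_le_sub_le (hT : T ∈ P) (hP : ∀ y ∈ P, y ≤ T) {r t ε : ℝ}
    (G : ℝ → ℝ) (hε : 0 ≤ ε) (hG : ∀ s ∈ P, |G s| ≤ ε) :
    |∑ s ∈ P.filter (fun s => r ≤ s ∧ s ≤ t), G s
      - ∑ s ∈ P.filter (fun s => r ≤ s ∧ succOf T P s ≤ t), G s| ≤ ε := by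
  have hsub : P.filter (fun s => r ≤ s ∧ succOf T P s ≤ t)
      ⊆ P.filter (fun s => r ≤ s ∧ s ≤ t) := by
    intro s hs
    rw [Finset.mem_filter] at hs ⊢
    exact ⟨hs.1, hs.2.1, (le_succOf hT (hP s hs.1)).trans hs.2.2⟩
  rw [← Finset.sum_sdiff hsub, add_sub_cancel_right]
  have hcard : (P.filter (fun s => r ≤ s ∧ s ≤ t)
      \ P.filter (fun s => r ≤ s ∧ succOf T P s ≤ t)).card ≤ 1 := by
    rw [Finset.card_le_one]
    have key : ∀ a ∈ (P.filter (fun s => r ≤ s ∧ s ≤ t)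
      \ P.filter (fun s => r ≤ s ∧ succOf T P s ≤ t)), a ∈ P ∧ a ≤ t ∧ t < succOf T P a := by
      intro a ha
      simp only [Finset.mem_sdiff, Finset.mem_filter, not_and, not_le] at ha
      exact ⟨ha.1.1, ha.1.2.2, ha.2 ha.1.1 ha.1.2.1⟩
    intro a ha b hb
    obtain ⟨ha1, ha2, ha3⟩ := key a ha
    obtain ⟨hb1, hb2, hb3⟩ := key b hb
    rcases lt_trichotomy a b with h | h | h
    · have := succOf_le (T := T) hb1 h; linarith
    · exact h
    · have := succOf_le (T := T) ha1 h; linarith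
  calc _ ≤ ∑ s ∈ _, |G s| := Finset.abs_sum_le_sum_abs _ _
    _ ≤ ∑ s ∈ (P.filter (fun s => r ≤ s ∧ s ≤ t)
      \ P.filter (fun s => r ≤ s ∧ succOf T P s ≤ t)), ε := by
        refine Finset.sum_le_sum fun s hs => hG s ?_
        exact (Finset.mem_filter.1 (Finset.mem_sdiff.1 hs).1).1
    _ ≤ ε := by
        rw [Finset.sum_const, nsmul_eq_mul]
        have : ((P.filter (fun s => r ≤ s ∧ s ≤ t)
          \ P.filter (fun s => r ≤ s ∧ succOf T P s ≤ t)).card : ℝ) ≤ 1 := by exact_mod_cast hcard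
        nlinarith

end Partition

namespace PartitionSeq

variable {T : ℝ} (𝕋 : PartitionSeq T)

lemma nonneg_of_mem {n : ℕ} : ∀ s ∈ 𝕋.part n, 0 ≤ s := fun _ hs => (𝕋.subset_Icc n hs).1

lemma le_of_mem {n : ℕ} : ∀ s ∈ 𝕋.part n, s ≤ T := fun _ hs => (𝕋.subset_Icc n hs).2

lemma part_mono {m n : ℕ} (h : m ≤ n) : 𝕋.part m ⊆ 𝕋.part n :=
  monotone_nat_of_le_succ 𝕋.refining h

lemma eventually_mesh {ε : ℝ} (hε : 0 < ε) :
    ∀ᶠ n in atTop, ∀ s ∈ 𝕋.part n, succOf T (𝕋.part n) s - s < ε := by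
  obtain ⟨N, hN⟩ := 𝕋.mesh_to_zero ε hε
  exact eventually_atTop.2 ⟨N, hN⟩

lemma telescope_succ {n : ℕ} (F : ℝ → ℝ) {x y : ℝ} (hx : x ∈ 𝕋.part n) (hy : y ∈ 𝕋.part n)
    (hxy : x ≤ y) :
    ∑ s ∈ (𝕋.part n).filter (fun s => x ≤ s ∧ s < y), (F (succOf T (𝕋.part n) s) - F s)
      = F y - F x :=
  sum_succOf_telescope (𝕋.zero_mem n) 𝕋.nonneg_of_mem (𝕋.top_mem n) 𝕋.le_of_mem F hx hy hxy

lemma telescope_pred {n : ℕ} (F : ℝ → ℝ) {x y : ℝ} (hx : x ∈ 𝕋.part n) (hy : y ∈ 𝕋.part n)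
    (hxy : x ≤ y) :
    ∑ z ∈ (𝕋.part n).filter (fun z => x < z ∧ z ≤ y), (F z - F (predOf (𝕋.part n) z))
      = F y - F x :=
  sum_predOf_telescope (𝕋.zero_mem n) 𝕋.nonneg_of_mem (𝕋.top_mem n) 𝕋.le_of_mem F hx hy hxy

lemma sub_predOf_lt_of_mesh {n : ℕ} {ε : ℝ}
    (h : ∀ s ∈ 𝕋.part n, succOf T (𝕋.part n) s - s < ε) {x : ℝ} (hx : x ∈ 𝕋.part n)
    (hx0 : 0 < x) : x - predOf (𝕋.part n) x < ε := by
  have h1 := h _ (predOf_mem (𝕋.zero_mem n) x)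
  rwa [succOf_predOf (𝕋.zero_mem n) (𝕋.top_mem n) 𝕋.le_of_mem hx hx0] at h1

/-- Sums over the partition intervals contained in `[r,t]` run between two partition points
close to `r` and `t`. -/
lemma exists_filter_eq {n : ℕ} {ε r t : ℝ}
    (h : ∀ s ∈ 𝕋.part n, succOf T (𝕋.part n) s - s < ε) (hr : 0 ≤ r) (ht : t ≤ T)
    (hrt : r + ε ≤ t) :
    ∃ x ∈ 𝕋.part n, ∃ y ∈ 𝕋.part n, r ≤ x ∧ x ≤ y ∧ y ≤ t ∧ x < r + ε ∧ t - ε < y ∧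
      ∀ G : ℝ → ℝ, (∀ s, succOf T (𝕋.part n) s = s → G s = 0) →
        ∑ s ∈ (𝕋.part n).filter (fun s => r ≤ s ∧ succOf T (𝕋.part n) s ≤ t), G s
          = ∑ s ∈ (𝕋.part n).filter (fun s => x ≤ s ∧ s < y), G s := by
  set P := 𝕋.part n with hP
  have hT : T ∈ P := 𝕋.top_mem n
  have h0 : (0 : ℝ) ∈ P := 𝕋.zero_mem n
  have hle : ∀ y ∈ P, y ≤ T := 𝕋.le_of_mem
  have hε : 0 < ε := by
    have := h T hT
    rw [succOf_eq_of_forall_le hle] at this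
    linarith
  have hA : (P.filter (fun s => r ≤ s)).Nonempty := ⟨T, by simp [hT]; linarith⟩
  have hB : (P.filter (fun s => s ≤ t)).Nonempty := ⟨0, by simp [h0]; linarith⟩
  set x := (P.filter (fun s => r ≤ s)).min' hA with hx
  set y := (P.filter (fun s => s ≤ t)).max' hB with hy
  have hxm := Finset.mem_filter.1 (Finset.min'_mem _ hA)
  have hym := Finset.mem_filter.1 (Finset.max'_mem _ hB)
  rw [← hx] at hxm
  rw [← hy] at hym
  have hxmin : ∀ s ∈ P, r ≤ s → x ≤ s := fun s hs hrs =>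
    Finset.min'_le _ _ (by simp [hs, hrs])
  have hymax : ∀ s ∈ P, s ≤ t → s ≤ y := fun s hs hst =>
    Finset.le_max' _ _ (by simp [hs, hst])
  have hxr : x < r + ε := by
    rcases (𝕋.nonneg_of_mem x hxm.1).eq_or_lt with h' | h'
    · linarith
    · have h1 := 𝕋.sub_predOf_lt_of_mesh h hxm.1 h'
      have h2 : predOf P x < r := by
        by_contra! h3
        have := hxmin _ (predOf_mem h0 x) h3
        exact absurd (predOf_lt h0 h') (not_lt.2 this)
      rw [← hP] at h1
      linarith
  have hyt : t - ε < y := by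
    rcases (hle y hym.1).eq_or_lt with h' | h'
    · linarith
    · have h1 := h y hym.1
      have h2 : t < succOf T P y := by
        by_contra! h3
        have := hymax _ (succOf_mem hT y) h3
        exact absurd (lt_succOf hT h') (not_lt.2 this)
      linarith
  have hxy : x ≤ y := hymax x hxm.1 (by linarith)
  refine ⟨x, hxm.1, y, hym.1, hxm.2, hxy, hym.2, hxr, hyt, ?_⟩
  intro G hG
  symm
  refine Finset.sum_subset ?_ ?_
  · intro s hs
    rw [Finset.mem_filter] at hs ⊢
    exact ⟨hs.1, hxm.2.trans hs.2.1, (succOf_le hym.1 hs.2.2).trans hym.2⟩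
  · intro s hs hs'
    rw [Finset.mem_filter] at hs hs'
    apply hG
    have h1 : x ≤ s := hxmin s hs.1 hs.2.1
    have h2 : y ≤ s := by
      by_contra! h3
      exact hs' ⟨hs.1, h1, h3⟩
    have h3 := hymax _ (succOf_mem hT s) hs.2.2
    exact le_antisymm (h3.trans h2) (le_succOf hT (hle s hs.1))

end PartitionSeq

section StepPaths

variable {d : ℕ}

/-- `S` is a right-continuous step path whose jumps lie in `P`. -/
def IsStepOn (P : Finset ℝ) (S : ℝ → Fin d → ℝ) : Prop :=
  ∀ s t, s ≤ t → (∀ x ∈ P, ¬ (s < x ∧ x ≤ t)) → S s = S t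

/-- The covariation sum of `S` along `P` over partition intervals contained in `[b,t]`,
indexed by right endpoints. -/
def stepCov (P : Finset ℝ) (S : ℝ → Fin d → ℝ) (i j : Fin d) (b t : ℝ) : ℝ :=
  ∑ x ∈ P.filter (fun x => b < x ∧ x ≤ t),
    (S x i - S (predOf P x) i) * (S x j - S (predOf P x) j)

lemma IsStepOn.mono {P P' : Finset ℝ} {S : ℝ → Fin d → ℝ} (h : IsStepOn P S) (hP : P ⊆ P') :
    IsStepOn P' S :=
  fun s t hst hx => h s t hst fun x hxP => hx x (hP hxP)

lemma IsStepOn.eq_predOf {P P' : Finset ℝ} {S : ℝ → Fin d → ℝ} (h : IsStepOn P S)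
    (h0 : (0 : ℝ) ∈ P) (hPP : P ⊆ P') {x : ℝ} (hx0 : 0 < x) :
    S (predOf P' x) = S (predOf P x) := by
  refine (h _ _ (le_predOf (hPP (predOf_mem h0 x)) (predOf_lt h0 hx0)) ?_).symm
  rintro y hy ⟨h1, h2⟩
  exact absurd (le_predOf hy (h2.trans_lt (predOf_lt (hPP h0) hx0))) (not_le.2 h1)

lemma IsStepOn.eq_predOf_of_notMem {P P' : Finset ℝ} {S : ℝ → Fin d → ℝ} (h : IsStepOn P S)
    (h0 : (0 : ℝ) ∈ P) (hPP : P ⊆ P') {x : ℝ} (hx : x ∉ P) (hx0 : 0 < x) :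
    S (predOf P' x) = S x := by
  refine h _ _ (predOf_lt (hPP h0) hx0).le ?_
  rintro y hy ⟨h1, h2⟩
  have h3 : y < x := lt_of_le_of_ne h2 fun h => hx (h ▸ hy)
  exact absurd (le_predOf (hPP hy) h3) (not_le.2 h1)

/-- Refining the partition does not change the covariation sums of a step path. -/
lemma IsStepOn.stepCov_eq {P P' : Finset ℝ} {S : ℝ → Fin d → ℝ} (h : IsStepOn P S)
    (h0 : (0 : ℝ) ∈ P) (hPP : P ⊆ P') (i j : Fin d) {b : ℝ} (hb : 0 ≤ b) (t : ℝ) :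
    stepCov P' S i j b t = stepCov P S i j b t := by
  unfold stepCov
  symm
  rw [← Finset.sum_subset (Finset.filter_subset_filter _ hPP)]
  · refine Finset.sum_congr rfl fun x hx => ?_
    rw [Finset.mem_filter] at hx
    rw [h.eq_predOf h0 hPP (hb.trans_lt hx.2.1)]
  · intro x hx hx'
    rw [Finset.mem_filter] at hx hx'
    have hxP : x ∉ P := fun hxP => hx' ⟨hxP, hx.2⟩
    rw [h.eq_predOf_of_notMem h0 hPP hxP (hb.trans_lt hx.2.1)]
    simp

lemma stepCov_congr {P : Finset ℝ} {S S' : ℝ → Fin d → ℝ} (h0 : (0 : ℝ) ∈ P)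
    (i j : Fin d) {b t : ℝ} (h : ∀ x ∈ P, b ≤ x → x ≤ t → S x = S' x) (hb : 0 ≤ b)
    (hbP : b ∈ P) : stepCov P S i j b t = stepCov P S' i j b t := by
  refine Finset.sum_congr rfl fun x hx => ?_
  rw [Finset.mem_filter] at hx
  rw [h x hx.1 hx.2.1.le hx.2.2, h _ (predOf_mem h0 x) (le_predOf hbP hx.2.1)
    ((predOf_lt h0 (hb.trans_lt hx.2.1)).le.trans hx.2.2)]

lemma stepCov_add {P : Finset ℝ} {S : ℝ → Fin d → ℝ} (i j : Fin d) {b c t : ℝ}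
    (hbc : b ≤ c) (hct : c ≤ t) :
    stepCov P S i j b c + stepCov P S i j c t = stepCov P S i j b t := by
  unfold stepCov
  rw [← Finset.sum_union]
  · congr 1
    ext x
    simp only [Finset.mem_union, Finset.mem_filter]
    constructor
    · rintro (⟨h1, h2, h3⟩ | ⟨h1, h2, h3⟩)
      · exact ⟨h1, h2, h3.trans hct⟩
      · exact ⟨h1, hbc.trans_lt h2, h3⟩
    · rintro ⟨h1, h2, h3⟩
      rcases le_or_gt x c with h | h
      · exact Or.inl ⟨h1, h2, h⟩
      · exact Or.inr ⟨h1, h, h3⟩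
  · rw [Finset.disjoint_left]
    intro x hx hx'
    rw [Finset.mem_filter] at hx hx'
    linarith [hx.2.2, hx'.2.1]

lemma stepCov_of_le {P : Finset ℝ} {S : ℝ → Fin d → ℝ} (i j : Fin d) {b t : ℝ}
    (h : t ≤ b) : stepCov P S i j b t = 0 := by
  unfold stepCov
  rw [Finset.filter_false_of_mem]
  · simp
  · rintro x - ⟨h1, h2⟩
    linarith

lemma abs_stepCov_le {P : Finset ℝ} {S : ℝ → Fin d → ℝ} (i j : Fin d) {b c t : ℝ}
    (htc : t ≤ c) {M : ℝ} (hM : ∀ i, stepCov P S i i b c ≤ M) :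
    |stepCov P S i j b t| ≤ M := by
  have hmono : ∀ i, stepCov P S i i b t ≤ M := by
    intro i
    refine le_trans ?_ (hM i)
    refine Finset.sum_le_sum_of_subset_of_nonneg ?_ fun x _ _ => mul_self_nonneg _
    intro x hx
    rw [Finset.mem_filter] at hx ⊢
    exact ⟨hx.1, hx.2.1, hx.2.2.trans htc⟩
  calc |stepCov P S i j b t|
      ≤ ∑ x ∈ P.filter (fun x => b < x ∧ x ≤ t),
        |(S x i - S (predOf P x) i) * (S x j - S (predOf P x) j)| :=
        Finset.abs_sum_le_sum_abs _ _
    _ ≤ ∑ x ∈ P.filter (fun x => b < x ∧ x ≤ t),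
        ((1 / 2) * ((S x i - S (predOf P x) i) * (S x i - S (predOf P x) i))
        + (1 / 2) * ((S x j - S (predOf P x) j) * (S x j - S (predOf P x) j))) := by
        refine Finset.sum_le_sum fun x _ => ?_
        rw [abs_le]
        constructor <;>
        nlinarith [sq_nonneg ((S x i - S (predOf P x) i) - (S x j - S (predOf P x) j)),
          sq_nonneg ((S x i - S (predOf P x) i) + (S x j - S (predOf P x) j))]
    _ = (1 / 2) * stepCov P S i i b t + (1 / 2) * stepCov P S j j b t := by
        rw [Finset.sum_add_distrib, ← Finset.mul_sum, ← Finset.mul_sum]; rfl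
    _ ≤ M := by linarith [hmono i, hmono j]

end StepPaths

section Counting

/-- The number of points of `P` in `(b,t]`. -/
def countPts (P : Finset ℝ) (b t : ℝ) : ℕ := (P.filter (fun y => b < y ∧ y ≤ t)).card

variable {P : Finset ℝ} {b : ℝ}

lemma countPts_self : countPts P b b = 0 := by
  unfold countPts
  rw [Finset.card_eq_zero, Finset.filter_false_of_mem]
  rintro x - ⟨h1, h2⟩
  linarith

lemma countPts_mono {s t : ℝ} (h : s ≤ t) : countPts P b s ≤ countPts P b t := by
  refine Finset.card_le_card fun x hx => ?_
  rw [Finset.mem_filter] at hx ⊢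
  exact ⟨hx.1, hx.2.1, hx.2.2.trans h⟩

lemma countPts_lt {s t : ℝ} (h : s < t) (ht : t ∈ P) (hb : b < t) :
    countPts P b s < countPts P b t := by
  refine Finset.card_lt_card ⟨fun x hx => ?_, fun hsub => ?_⟩
  · rw [Finset.mem_filter] at hx ⊢
    exact ⟨hx.1, hx.2.1, hx.2.2.trans h.le⟩
  · have := hsub (Finset.mem_filter.2 ⟨ht, hb, le_rfl⟩)
    rw [Finset.mem_filter] at this
    linarith [this.2.2]

lemma countPts_eq_of_forall {s t : ℝ} (hst : s ≤ t) (h : ∀ x ∈ P, ¬ (s < x ∧ x ≤ t)) :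
    countPts P b s = countPts P b t := by
  unfold countPts
  congr 1
  ext x
  simp only [Finset.mem_filter]
  constructor
  · rintro ⟨h1, h2, h3⟩
    exact ⟨h1, h2, h3.trans hst⟩
  · rintro ⟨h1, h2, h3⟩
    exact ⟨h1, h2, not_lt.1 fun h4 => h x h1 ⟨h4, h3⟩⟩

lemma countPts_predOf (h0 : (0 : ℝ) ∈ P) (hb : 0 ≤ b) {x : ℝ} (hx : x ∈ P)
    (hbx : b < x) : countPts P b x = countPts P b (predOf P x) + 1 := by
  have hlt := predOf_lt h0 (hb.trans_lt hbx)
  unfold countPts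
  have : P.filter (fun y => b < y ∧ y ≤ x)
      = insert x (P.filter (fun y => b < y ∧ y ≤ predOf P x)) := by
    ext y
    simp only [Finset.mem_filter, Finset.mem_insert]
    constructor
    · rintro ⟨h1, h2, h3⟩
      rcases h3.eq_or_lt with h | h
      · exact Or.inl h
      · exact Or.inr ⟨h1, h2, le_predOf h1 h⟩
    · rintro (rfl | ⟨h1, h2, h3⟩)
      · exact ⟨hx, hbx, le_rfl⟩
      · exact ⟨h1, h2, h3.trans hlt.le⟩
  rw [this, Finset.card_insert_of_notMem]
  rw [Finset.mem_filter]
  rintro ⟨-, -, h⟩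
  linarith

lemma countPts_injOn (a : ℝ) :
    Set.InjOn (countPts P b) (P.filter (fun x => b < x ∧ x ≤ a)) := by
  intro x hx y hy hxy
  rw [Finset.mem_coe, Finset.mem_filter] at hx hy
  rcases lt_trichotomy x y with h | h | h
  · exact absurd hxy (countPts_lt h hy.1 hy.2.1).ne
  · exact h
  · exact absurd hxy (countPts_lt h hx.1 hx.2.1).ne'

lemma image_countPts (a : ℝ) :
    (P.filter (fun x => b < x ∧ x ≤ a)).image (countPts P b)
      = Finset.Icc 1 (countPts P b a) := by
  refine Finset.eq_of_subset_of_card_le ?_ ?_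
  · intro l hl
    rw [Finset.mem_image] at hl
    obtain ⟨x, hx, rfl⟩ := hl
    rw [Finset.mem_filter] at hx
    rw [Finset.mem_Icc]
    refine ⟨?_, countPts_mono hx.2.2⟩
    exact Finset.card_pos.2 ⟨x, Finset.mem_filter.2 ⟨hx.1, hx.2.1, le_rfl⟩⟩
  · rw [Finset.card_image_of_injOn (countPts_injOn a), Nat.card_Icc, Nat.add_sub_cancel]
    rfl

lemma sum_countPts (a : ℝ) (g : ℕ → ℝ) :
    ∑ x ∈ P.filter (fun x => b < x ∧ x ≤ a), g (countPts P b x)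
      = ∑ l ∈ Finset.range (countPts P b a), g (l + 1) := by
  rw [← Finset.sum_image (f := g) (countPts_injOn a), image_countPts,
    Finset.range_eq_Ico, Finset.sum_Ico_add' g 0 _ 1]
  rfl

lemma PartitionSeq.exists_le_countPts {T : ℝ} (𝕋 : PartitionSeq T) {N : ℕ} {a b : ℝ}
    (hb : b ∈ 𝕋.part N) (ha : a ∈ 𝕋.part N) (hba : b < a) (L N₀ : ℕ) :
    ∃ N' ≥ N₀, N ≤ N' ∧ L ≤ countPts (𝕋.part N') b a := by
  have hε : 0 < (a - b) / (L + 1) := by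
    have : 0 < a - b := by linarith
    positivity
  obtain ⟨M, hM⟩ := eventually_atTop.1 (𝕋.eventually_mesh hε)
  refine ⟨max M (max N N₀), by simp, by simp, ?_⟩
  set n := max M (max N N₀) with hn
  have hmesh := hM n (le_max_left _ _)
  have hNn : N ≤ n := by simp [hn]
  have htel := 𝕋.telescope_pred (n := n) (fun x => x) (𝕋.part_mono hNn hb)
    (𝕋.part_mono hNn ha) hba.le
  have hle : a - b ≤ countPts (𝕋.part n) b a * ((a - b) / (L + 1)) := by
    rw [← htel, countPts, ← nsmul_eq_mul, ← Finset.sum_const]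
    refine Finset.sum_le_sum fun x hx => ?_
    rw [Finset.mem_filter] at hx
    rw [htel]
    exact (𝕋.sub_predOf_lt_of_mesh hmesh hx.1
      ((𝕋.nonneg_of_mem b (𝕋.part_mono hNn hb)).trans_lt hx.2.1)).le
  have hL : (0 : ℝ) < L + 1 := by positivity
  rw [mul_div_assoc', le_div_iff₀ hL, mul_comm] at hle
  have h3 : (L : ℝ) + 1 ≤ countPts (𝕋.part n) b a :=
    le_of_mul_le_mul_right hle (by linarith)
  have h4 : L + 1 ≤ countPts (𝕋.part n) b a := by exact_mod_cast h3
  omega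

end Counting

section Zigzag

/-- The path `0, w 0, 0, w 1, 0, w 2, …`. -/
def zigzag (w : ℕ → ℝ) (l : ℕ) : ℝ := if l % 2 = 1 then w (l / 2) else 0

lemma zigzag_even (w : ℕ → ℝ) (n : ℕ) : zigzag w (2 * n) = 0 := by simp [zigzag]

lemma zigzag_odd (w : ℕ → ℝ) (n : ℕ) : zigzag w (2 * n + 1) = w n := by
  have h1 : (2 * n + 1) % 2 = 1 := by omega
  have h2 : (2 * n + 1) / 2 = n := by omega
  simp [zigzag, h1, h2]

lemma zigzag_eq_zero {w : ℕ → ℝ} {K l : ℕ} (hw : ∀ k ≥ K, w k = 0) (hl : 2 * K ≤ l) :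
    zigzag w l = 0 := by
  unfold zigzag
  split_ifs
  · exact hw _ (by omega)
  · rfl

lemma abs_zigzag_le {w : ℕ → ℝ} {ε : ℝ} (hε : 0 ≤ ε) (hw : ∀ k, |w k| ≤ ε) (l : ℕ) :
    |zigzag w l| ≤ ε := by
  unfold zigzag
  split_ifs
  · exact hw _
  · simpa using hε

lemma sum_range_eq_of_le {w : ℕ → ℝ} {K n : ℕ} (hw : ∀ k ≥ K, w k = 0) (h : K ≤ n) :
    ∑ k ∈ Finset.range n, w k = ∑ k ∈ Finset.range K, w k := by
  refine (Finset.sum_subset (Finset.range_subset_range.2 h) fun k _ hk => hw k ?_).symm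
  simpa using hk

lemma sum_zigzag_sub_mul {w w' : ℕ → ℝ} {K L : ℕ} (hw : ∀ k ≥ K, w k = 0)
    (hL : 2 * K ≤ L) :
    ∑ l ∈ Finset.range L, (zigzag w (l + 1) - zigzag w l) * (zigzag w' (l + 1) - zigzag w' l)
      = 2 * ∑ k ∈ Finset.range K, w k * w' k := by
  have hzero : ∀ l ≥ 2 * K, (zigzag w (l + 1) - zigzag w l) *
      (zigzag w' (l + 1) - zigzag w' l) = 0 := by
    intro l hl
    rw [zigzag_eq_zero hw hl, zigzag_eq_zero hw (by omega)]
    simp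
  rw [sum_range_eq_of_le hzero hL]
  clear hL hzero hw
  induction K with
  | zero => simp
  | succ n ih =>
    rw [show 2 * (n + 1) = 2 * n + 1 + 1 by ring, Finset.sum_range_succ, Finset.sum_range_succ, ih,
      Finset.sum_range_succ, show 2 * n + 1 + 1 = 2 * (n + 1) by ring]
    simp only [zigzag_even, zigzag_odd]
    ring

lemma sum_zigzag_sq_le {w : ℕ → ℝ} {K : ℕ} (hw : ∀ k ≥ K, w k = 0) (A : Finset ℕ) :
    ∑ l ∈ A, zigzag w l ^ 2 ≤ ∑ k ∈ Finset.range K, w k ^ 2 := by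
  have h1 : ∑ l ∈ Finset.range (2 * K), zigzag w l ^ 2 = ∑ k ∈ Finset.range K, w k ^ 2 := by
    clear hw
    induction K with
    | zero => simp
    | succ n ih =>
      rw [show 2 * (n + 1) = 2 * n + 1 + 1 by ring, Finset.sum_range_succ, Finset.sum_range_succ,
        ih, Finset.sum_range_succ]
      simp only [zigzag_even, zigzag_odd]
      ring
  rw [← h1]
  rw [← Finset.sum_filter_of_ne (s := A) (p := fun l => l < 2 * K)]
  · refine Finset.sum_le_sum_of_subset_of_nonneg (fun l hl => ?_) fun l _ _ => sq_nonneg _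
    exact Finset.mem_range.2 (Finset.mem_filter.1 hl).2
  · intro l _ hl
    by_contra! h
    exact hl (by simp [zigzag_eq_zero hw h])

end Zigzag

section Splice

variable {d : ℕ}

/-- Replace `S` on `[b,a]` by a path that moves along `Y` at the points of `P`. -/
def splice (P : Finset ℝ) (b a : ℝ) (S : ℝ → Fin d → ℝ) (Y : ℕ → Fin d → ℝ) (t : ℝ) :
    Fin d → ℝ :=
  if b ≤ t ∧ t ≤ a then S b + Y (countPts P b t) else S t

variable {P : Finset ℝ} {b a : ℝ} {S : ℝ → Fin d → ℝ} {Y : ℕ → Fin d → ℝ}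

lemma splice_of_mem {t : ℝ} (hb : b ≤ t) (ha : t ≤ a) :
    splice P b a S Y t = S b + Y (countPts P b t) := by
  simp [splice, hb, ha]

lemma splice_of_notMem (hY0 : Y 0 = 0) (hYa : S b + Y (countPts P b a) = S a) {t : ℝ}
    (ht : ¬ (b < t ∧ t < a)) : splice P b a S Y t = S t := by
  unfold splice
  split_ifs with h
  · rcases h.1.eq_or_lt with rfl | h1
    · simp [countPts_self, hY0]
    · have : t = a := le_antisymm h.2 (not_lt.1 fun h2 => ht ⟨h1, h2⟩)
      rw [this, hYa]
  · rfl

lemma isStepOn_splice (hS : IsStepOn P S) (hb : b ∈ P) (ha : a ∈ P)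
    (hYa : S b + Y (countPts P b a) = S a) : IsStepOn P (splice P b a S Y) := by
  intro s t hst hno
  rcases lt_or_ge s b with h1 | h1
  · have h2 : t < b := by
      by_contra! h
      exact hno b hb ⟨h1, h⟩
    rw [splice, splice, if_neg (by rintro ⟨h, -⟩; linarith), if_neg (by rintro ⟨h, -⟩; linarith)]
    exact hS s t hst hno
  rcases lt_or_ge a s with h2 | h2
  · rw [splice, splice, if_neg (by rintro ⟨-, h⟩; linarith), if_neg (by rintro ⟨-, h⟩; linarith)]
    exact hS s t hst hno
  rcases le_or_gt t a with h3 | h3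
  · rw [splice_of_mem h1 h2, splice_of_mem (h1.trans hst) h3, countPts_eq_of_forall hst hno]
  · have h4 : s = a := by
      refine le_antisymm h2 ?_
      by_contra! h
      exact hno a ha ⟨h, h3.le⟩
    rw [splice_of_mem h1 h2, splice, if_neg (by rintro ⟨-, h⟩; linarith), h4, hYa, ← h4]
    exact hS s t hst hno

lemma splice_sub_predOf (h0 : (0 : ℝ) ∈ P) (hb0 : 0 ≤ b) (hb : b ∈ P) {x : ℝ} (hx : x ∈ P)
    (hbx : b < x) (hxa : x ≤ a) (i : Fin d) :
    splice P b a S Y x i - splice P b a S Y (predOf P x) i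
      = Y (countPts P b x) i - Y (countPts P b x - 1) i := by
  have hlt := predOf_lt h0 (hb0.trans_lt hbx)
  rw [splice_of_mem hbx.le hxa, splice_of_mem (le_predOf hb hbx) (hlt.le.trans hxa),
    countPts_predOf h0 hb0 hx hbx]
  simp

lemma stepCov_splice (h0 : (0 : ℝ) ∈ P) (hb0 : 0 ≤ b) (hb : b ∈ P) (i j : Fin d) :
    stepCov P (splice P b a S Y) i j b a
      = ∑ l ∈ Finset.range (countPts P b a),
        (Y (l + 1) i - Y l i) * (Y (l + 1) j - Y l j) := by
  have := sum_countPts (P := P) (b := b) a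
    (fun l => (Y l i - Y (l - 1) i) * (Y l j - Y (l - 1) j))
  simp only [Nat.add_sub_cancel] at this
  rw [← this]
  refine Finset.sum_congr rfl fun x hx => ?_
  rw [Finset.mem_filter] at hx
  rw [splice_sub_predOf h0 hb0 hb hx.1 hx.2.1 hx.2.2,
    splice_sub_predOf h0 hb0 hb hx.1 hx.2.1 hx.2.2]

end Splice

section CellRefinement

variable {T : ℝ} (𝕋 : PartitionSeq T) {d : ℕ}

/-- A bound for the covariation sums along coarser partitions of a path that moves linearly
and performs additional zigzags. -/
lemma stepCov_splice_le {n N : ℕ} (hnN : n ≤ N) {b a : ℝ} {S : ℝ → Fin d → ℝ}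
    (hb : b ∈ 𝕋.part n) (ha : a ∈ 𝕋.part n) (hba : b < a) {Y : ℕ → Fin d → ℝ} (i : Fin d)
    {D : ℝ} {w : ℕ → ℝ} {K : ℕ} (hw : ∀ k ≥ K, w k = 0)
    (hY : ∀ l, Y l i = l / (countPts (𝕋.part N) b a : ℝ) * D + zigzag w l) :
    stepCov (𝕋.part n) (splice (𝕋.part N) b a S Y) i i b a
      ≤ 2 * D ^ 2 + 8 * ∑ k ∈ Finset.range K, w k ^ 2 := by
  set P := 𝕋.part N with hP
  set κ := countPts P b with hκ
  have hsub : 𝕋.part n ⊆ P := 𝕋.part_mono hnN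
  have hb0 : 0 ≤ b := 𝕋.nonneg_of_mem b hb
  have h0n : (0 : ℝ) ∈ 𝕋.part n := 𝕋.zero_mem n
  set L : ℝ := (κ a : ℝ) with hL
  have hLpos : 0 < L := by
    have : 0 < κ a := lt_of_le_of_lt (Nat.zero_le _) (countPts_lt hba (hsub ha) hba)
    rw [hL]
    exact_mod_cast this
  set F := (𝕋.part n).filter (fun x => b < x ∧ x ≤ a) with hF
  have hFmem : ∀ x ∈ F, x ∈ 𝕋.part n ∧ b < x ∧ x ≤ a := fun x hx => Finset.mem_filter.1 hx
  have hpred : ∀ x ∈ F, predOf (𝕋.part n) x ∈ 𝕋.part n ∧ b ≤ predOf (𝕋.part n) x ∧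
      predOf (𝕋.part n) x < x := fun x hx =>
    ⟨predOf_mem h0n x, le_predOf hb (hFmem x hx).2.1,
      predOf_lt h0n (hb0.trans_lt (hFmem x hx).2.1)⟩
  have hterm : ∀ x ∈ F, (splice P b a S Y x i - splice P b a S Y (predOf (𝕋.part n) x) i)
      * (splice P b a S Y x i - splice P b a S Y (predOf (𝕋.part n) x) i)
      ≤ 2 * D ^ 2 * (((κ x : ℝ) - κ (predOf (𝕋.part n) x)) / L)
        + 4 * zigzag w (κ x) ^ 2 + 4 * zigzag w (κ (predOf (𝕋.part n) x)) ^ 2 := by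
    intro x hx
    obtain ⟨hx1, hx2, hx3⟩ := hFmem x hx
    obtain ⟨hp1, hp2, hp3⟩ := hpred x hx
    rw [splice_of_mem hx2.le hx3, splice_of_mem hp2 (hp3.le.trans hx3)]
    simp only [Pi.add_apply, hY]
    set z := zigzag w (κ x)
    set z' := zigzag w (κ (predOf (𝕋.part n) x))
    set q := ((κ x : ℝ) - κ (predOf (𝕋.part n) x)) / L with hq
    have hq0 : 0 ≤ q := by
      have : (κ (predOf (𝕋.part n) x) : ℝ) ≤ κ x := by exact_mod_cast countPts_mono hp3.le
      exact div_nonneg (by linarith) hLpos.le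
    have hq1 : q ≤ 1 := by
      rw [hq, div_le_one hLpos]
      have h1 : (κ x : ℝ) ≤ L := by
        rw [hL]
        exact_mod_cast countPts_mono hx3
      have h2 : (0 : ℝ) ≤ κ (predOf (𝕋.part n) x) := by positivity
      linarith
    have heq : S b i + ((κ x : ℝ) / L * D + z)
        - (S b i + ((κ (predOf (𝕋.part n) x) : ℝ) / L * D + z')) = q * D + (z - z') := by
      rw [hq]; ring
    rw [heq]
    have h3 : q ^ 2 * D ^ 2 ≤ q * D ^ 2 := by
      refine mul_le_mul_of_nonneg_right ?_ (sq_nonneg D)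
      nlinarith
    nlinarith [sq_nonneg (q * D - (z - z')), sq_nonneg (z + z')]
  have htel : ∑ x ∈ F, (((κ x : ℝ) - κ (predOf (𝕋.part n) x)) / L) = 1 := by
    rw [← Finset.sum_div, 𝕋.telescope_pred (fun x => (κ x : ℝ)) hb ha hba.le,
      show κ b = 0 from countPts_self]
    simp [hLpos.ne', ← hL]
  have hinj : Set.InjOn κ F := by
    refine (countPts_injOn (P := P) (b := b) a).mono ?_
    intro x hx
    rw [Finset.mem_coe] at hx ⊢
    exact Finset.mem_filter.2 ⟨hsub (hFmem x hx).1, (hFmem x hx).2⟩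
  have hinj' : Set.InjOn (fun x => κ (predOf (𝕋.part n) x)) F := by
    have key : ∀ x ∈ F, ∀ y ∈ F, x < y →
        κ (predOf (𝕋.part n) x) < κ (predOf (𝕋.part n) y) := by
      intro x hx y hy hxy
      have h1 : x ≤ predOf (𝕋.part n) y := le_predOf (hFmem x hx).1 hxy
      exact (countPts_lt (hpred x hx).2.2 (hsub (hFmem x hx).1) (hFmem x hx).2.1).trans_le
        (countPts_mono h1)
    intro x hx y hy hxy
    rcases lt_trichotomy x y with h | h | h
    · exact absurd hxy (key x hx y hy h).ne
    · exact h
    · exact absurd hxy (key y hy x hx h).ne'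
  have hz1 : ∑ x ∈ F, zigzag w (κ x) ^ 2 ≤ ∑ k ∈ Finset.range K, w k ^ 2 := by
    rw [← Finset.sum_image (f := fun l => zigzag w l ^ 2) hinj]
    exact sum_zigzag_sq_le hw _
  have hz2 : ∑ x ∈ F, zigzag w (κ (predOf (𝕋.part n) x)) ^ 2
      ≤ ∑ k ∈ Finset.range K, w k ^ 2 := by
    rw [← Finset.sum_image (f := fun l => zigzag w l ^ 2)
      (g := fun x => κ (predOf (𝕋.part n) x)) hinj']
    exact sum_zigzag_sq_le hw _
  calc _ ≤ ∑ x ∈ F, (2 * D ^ 2 * (((κ x : ℝ) - κ (predOf (𝕋.part n) x)) / L)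
        + 4 * zigzag w (κ x) ^ 2 + 4 * zigzag w (κ (predOf (𝕋.part n) x)) ^ 2) :=
        Finset.sum_le_sum hterm
    _ = 2 * D ^ 2 + 4 * ∑ x ∈ F, zigzag w (κ x) ^ 2
        + 4 * ∑ x ∈ F, zigzag w (κ (predOf (𝕋.part n) x)) ^ 2 := by
        rw [Finset.sum_add_distrib, Finset.sum_add_distrib, ← Finset.mul_sum, htel,
          ← Finset.mul_sum, ← Finset.mul_sum]
        ring
    _ ≤ _ := by linarith

/-- Refinement of a step path inside a single partition interval `[b,a]`: the jump at `a` is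
spread over many small jumps whose outer products sum approximately to `Q`. -/
theorem exists_cell_refinement {N : ℕ} {S : ℝ → Fin d → ℝ} (hS : IsStepOn (𝕋.part N) S)
    {b a : ℝ} (hb : b ∈ 𝕋.part N) (ha : a ∈ 𝕋.part N) (hba : b < a)
    {W : ℕ → Fin d → ℝ} {K : ℕ} (hW : ∀ k ≥ K, ∀ i, W k i = 0) {Q : Fin d → Fin d → ℝ}
    (hQ : ∀ i j, 2 * ∑ k ∈ Finset.range K, W k i * W k j = Q i j) {δ : ℝ} (hδ : 0 < δ)
    (hWδ : ∀ k i, |W k i| ≤ δ / 4) (N₀ : ℕ) :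
    ∃ N' ≥ N₀, N ≤ N' ∧ ∃ S' : ℝ → Fin d → ℝ, IsStepOn (𝕋.part N') S' ∧
      (∀ t, ¬ (b < t ∧ t < a) → S' t = S t) ∧
      (∀ t i, b ≤ t → t ≤ a → |S' t i - S b i| ≤ |S a i - S b i| + δ) ∧
      (∀ x ∈ 𝕋.part N', b < x → x ≤ a → ∀ i, |S' x i - S' (predOf (𝕋.part N') x) i| ≤ δ) ∧
      (∀ i j, |stepCov (𝕋.part N') S' i j b a - Q i j| ≤ δ) ∧
      ∀ n, N ≤ n → n ≤ N' → ∀ i,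
        stepCov (𝕋.part n) S' i i b a ≤ 2 * (S a i - S b i) ^ 2 + 4 * Q i i := by
  set D : Fin d → ℝ := S a - S b with hD
  set C : ℝ := ∑ i, |D i| with hC
  have hCD : ∀ i, |D i| ≤ C := fun i =>
    Finset.single_le_sum (f := fun i => |D i|) (fun i _ => abs_nonneg _) (Finset.mem_univ i)
  have hC0 : 0 ≤ C := Finset.sum_nonneg fun i _ => abs_nonneg _
  obtain ⟨M, hM⟩ := exists_nat_ge ((2 * C + C ^ 2) / δ + 1)
  obtain ⟨N', hN'₀, hNN', hcount⟩ := 𝕋.exists_le_countPts hb ha hba (max (2 * K) M) N₀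
  refine ⟨N', hN'₀, hNN', ?_⟩
  have hsub := 𝕋.part_mono hNN'
  have h0 := 𝕋.zero_mem N'
  have hb0 := 𝕋.nonneg_of_mem b hb
  set P := 𝕋.part N' with hP
  set L := countPts P b a with hL
  have hKL : 2 * K ≤ L := (le_max_left _ _).trans hcount
  have hML : (M : ℝ) ≤ L := by exact_mod_cast (le_max_right _ _).trans hcount
  have hM0 : (2 * C + C ^ 2) / δ + 1 ≤ (L : ℝ) := hM.trans hML
  have hLpos : (0 : ℝ) < L := by
    have : 0 ≤ (2 * C + C ^ 2) / δ := by positivity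
    linarith
  have hLbig : 2 * C + C ^ 2 ≤ L * δ := by
    have : (2 * C + C ^ 2) / δ ≤ L := by linarith
    rwa [div_le_iff₀ hδ] at this
  set Y : ℕ → Fin d → ℝ := fun l i => l / (L : ℝ) * D i + zigzag (fun k => W k i) l with hY
  have hY0 : Y 0 = 0 := by
    ext i
    simp [hY, zigzag]
  have hYa : S b + Y (countPts P b a) = S a := by
    ext i
    have h1 : zigzag (fun k => W k i) L = 0 := zigzag_eq_zero (fun k hk => hW k hk i) hKL
    simp only [Pi.add_apply, hY, ← hL, h1, div_self hLpos.ne', hD, Pi.sub_apply]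
    ring
  have hstepY : ∀ l i, Y (l + 1) i - Y l i = D i / L
      + (zigzag (fun k => W k i) (l + 1) - zigzag (fun k => W k i) l) := by
    intro l i
    simp only [hY]
    push_cast
    ring
  have hzig : ∀ i l, |zigzag (fun k => W k i) l| ≤ δ / 4 := fun i l =>
    abs_zigzag_le (by linarith) (fun k => hWδ k i) l
  refine ⟨splice P b a S Y, isStepOn_splice (hS.mono hsub) (hsub hb) (hsub ha) hYa,
    fun t ht => splice_of_notMem hY0 hYa ht, ?_, ?_, ?_, ?_⟩
  · intro t i hbt hta
    rw [splice_of_mem hbt hta]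
    simp only [Pi.add_apply, add_sub_cancel_left, hY]
    have h1 : (countPts P b t : ℝ) ≤ L := by
      rw [hL]
      exact_mod_cast countPts_mono hta
    have h2 : |(countPts P b t : ℝ) / L * D i| ≤ |D i| := by
      rw [abs_mul, abs_of_nonneg (by positivity)]
      exact mul_le_of_le_one_left (abs_nonneg _) ((div_le_one hLpos).2 h1)
    have h3 := hzig i (countPts P b t)
    have h4 : D i = S a i - S b i := rfl
    rw [← h4]
    refine (abs_add_le _ _).trans ?_
    linarith
  · intro x hx hbx hxa i
    have h1 : 1 ≤ countPts P b x := by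
      rw [countPts_predOf h0 hb0 hx hbx]
      omega
    rw [splice_sub_predOf h0 hb0 (hsub hb) hx hbx hxa]
    obtain ⟨l, hl⟩ := Nat.exists_eq_add_of_le' h1
    rw [hl, Nat.add_sub_cancel, hstepY]
    have h2 : |D i / L| ≤ δ / 2 := by
      rw [abs_div, abs_of_pos hLpos, div_le_iff₀ hLpos]
      nlinarith [hCD i, sq_nonneg C]
    have h3 := hzig i (l + 1)
    have h4 := hzig i l
    rw [abs_le] at *
    constructor <;> linarith
  · intro i j
    rw [stepCov_splice h0 hb0 (hsub hb)]
    have hexp : ∑ l ∈ Finset.range L, (Y (l + 1) i - Y l i) * (Y (l + 1) j - Y l j)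
        = D i * D j / L + Q i j := by
      set f := zigzag (fun k => W k i) with hf
      set g := zigzag (fun k => W k j) with hg
      have h1 : ∀ l, (Y (l + 1) i - Y l i) * (Y (l + 1) j - Y l j)
          = D i / L * (D j / L) + D i / L * (g (l + 1) - g l) + D j / L * (f (l + 1) - f l)
            + (f (l + 1) - f l) * (g (l + 1) - g l) := by
        intro l
        rw [hstepY, hstepY]
        ring
      have hfL : f L = 0 := zigzag_eq_zero (fun k hk => hW k hk i) hKL
      have hgL : g L = 0 := zigzag_eq_zero (fun k hk => hW k hk j) hKL
      have hf0 : f 0 = 0 := zigzag_even _ 0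
      have hg0 : g 0 = 0 := zigzag_even _ 0
      simp only [h1]
      rw [Finset.sum_add_distrib, Finset.sum_add_distrib, Finset.sum_add_distrib,
        Finset.sum_const, Finset.card_range, nsmul_eq_mul, ← Finset.mul_sum,
        ← Finset.mul_sum, Finset.sum_range_sub, Finset.sum_range_sub,
        sum_zigzag_sub_mul (fun k hk => hW k hk i) hKL, hQ, hfL, hgL, hf0, hg0]
      field_simp
      ring
    rw [← hL, hexp, add_sub_cancel_right, abs_div, abs_of_pos hLpos, div_le_iff₀ hLpos, abs_mul]
    have : |D i| * |D j| ≤ C * C :=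
      mul_le_mul (hCD i) (hCD j) (abs_nonneg _) hC0
    nlinarith
  · intro n hNn hnN' i
    have := stepCov_splice_le 𝕋 hnN' (S := S) (𝕋.part_mono hNn hb) (𝕋.part_mono hNn ha) hba i
      (Y := Y) (D := D i) (w := fun k => W k i) (fun k hk => hW k hk i) (fun l => rfl)
    refine this.trans ?_
    rw [← hQ i i]
    have h5 : D i = S a i - S b i := rfl
    rw [h5]
    refine le_of_eq ?_
    simp only [sq]
    ring

end CellRefinement

section Rounds

variable {T : ℝ} {𝕋 : PartitionSeq T} {d : ℕ}

/-- `Q` is twice a finite sum of outer products of arbitrarily small vectors. -/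
def HasSmallDecomposition (Q : Fin d → Fin d → ℝ) : Prop :=
  ∀ δ > 0, ∃ (W : ℕ → Fin d → ℝ) (K : ℕ), (∀ k ≥ K, ∀ i, W k i = 0) ∧
    (∀ i j, 2 * ∑ k ∈ Finset.range K, W k i * W k j = Q i j) ∧ ∀ k i, |W k i| ≤ δ

/-- `S'` arises from the step path `S` on the `N`-th partition by refining the cells ending at
the points of `F`, so that their covariations become approximately `Q`. -/
structure RefinesOn (𝕋 : PartitionSeq T) (N : ℕ) (S : ℝ → Fin d → ℝ)
    (Q : ℝ → Fin d → Fin d → ℝ) (ε δ : ℝ) (F : Finset ℝ) (N' : ℕ)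
    (S' : ℝ → Fin d → ℝ) : Prop where
  le : N ≤ N'
  step : IsStepOn (𝕋.part N') S'
  eq_off : ∀ t, (∀ a ∈ F, ¬ (predOf (𝕋.part N) a < t ∧ t < a)) → S' t = S t
  close : ∀ a ∈ F, ∀ t, predOf (𝕋.part N) a ≤ t → t ≤ a → ∀ i,
    |S' t i - S (predOf (𝕋.part N) a) i| ≤ ε + δ
  jump : ∀ a ∈ F, ∀ x ∈ 𝕋.part N', predOf (𝕋.part N) a < x → x ≤ a → ∀ i,
    |S' x i - S' (predOf (𝕋.part N') x) i| ≤ δ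
  cov : ∀ a ∈ F, ∀ i j, |stepCov (𝕋.part N') S' i j (predOf (𝕋.part N) a) a - Q a i j| ≤ δ
  cov_mid : ∀ n, N ≤ n → n ≤ N' → ∃ c, (c ∈ F ∨ c = 0) ∧
    (∀ a ∈ F, a < c → ∀ i j,
      |stepCov (𝕋.part n) S' i j (predOf (𝕋.part N) a) a - Q a i j| ≤ δ) ∧
    (c ∈ F → ∀ i, stepCov (𝕋.part n) S' i i (predOf (𝕋.part N) c) c ≤ 2 * ε ^ 2 + 4 * Q c i i) ∧
    ∀ a ∈ 𝕋.part N, 0 < a → (a ∉ F ∨ c < a) →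
      ∀ x ∈ 𝕋.part n, predOf (𝕋.part N) a < x → x < a → S' x = S x

lemma RefinesOn.empty {N : ℕ} {S : ℝ → Fin d → ℝ} {Q : ℝ → Fin d → Fin d → ℝ} {ε δ : ℝ}
    (hS : IsStepOn (𝕋.part N) S) {N' : ℕ} (hN' : N ≤ N') : RefinesOn 𝕋 N S Q ε δ ∅ N' S where
  le := hN'
  step := hS.mono (𝕋.part_mono hN')
  eq_off := fun _ _ => rfl
  close := by simp
  jump := by simp
  cov := by simp
  cov_mid := fun n _ _ => ⟨0, Or.inr rfl, by simp, by simp, fun _ _ _ _ _ _ _ _ => rfl⟩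

/-- Two points of a partition have disjoint cells. -/
lemma le_predOf_of_lt_of_lt {P : Finset ℝ} {a a' t : ℝ} (ha : a ∈ P) (ha' : a' ∈ P)
    (h1 : predOf P a' < t) (h2 : t < a') (h3 : predOf P a < t) (h4 : t < a) : a = a' := by
  rcases lt_trichotomy a a' with h | h | h
  · linarith [le_predOf ha h]
  · exact h
  · linarith [le_predOf ha' h]

lemma RefinesOn.insert {N : ℕ} {S : ℝ → Fin d → ℝ} {Q : ℝ → Fin d → Fin d → ℝ} {ε δ : ℝ}
    {F : Finset ℝ} {N' : ℕ} {S' : ℝ → Fin d → ℝ} (h : RefinesOn 𝕋 N S Q ε δ F N' S')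
    (hS : IsStepOn (𝕋.part N) S) (hF : ∀ x ∈ F, x ∈ 𝕋.part N ∧ 0 < x)
    {a : ℝ} (ha : a ∈ 𝕋.part N) (ha0 : 0 < a) (hFa : ∀ x ∈ F, x < a)
    (hε : ∀ i, |S a i - S (predOf (𝕋.part N) a) i| ≤ ε) (hδ : 0 < δ)
    (hQ : HasSmallDecomposition (Q a)) (N₀ : ℕ) :
    ∃ N'' ≥ N₀, ∃ S'', RefinesOn 𝕋 N S Q ε δ (insert a F) N'' S'' := by
  obtain ⟨W, K, hW, hWQ, hWδ⟩ := hQ (δ / 4) (by positivity)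
  set P := 𝕋.part N with hP
  have h0 : (0 : ℝ) ∈ P := 𝕋.zero_mem N
  have h0' : (0 : ℝ) ∈ 𝕋.part N' := 𝕋.zero_mem N'
  have hPP' : P ⊆ 𝕋.part N' := 𝕋.part_mono h.le
  set b₀ := predOf P a with hb₀
  have hb₀P : b₀ ∈ P := predOf_mem h0 a
  have hb₀0 : 0 ≤ b₀ := 𝕋.nonneg_of_mem _ hb₀P
  have hb₀a : b₀ < a := predOf_lt h0 ha0
  set b := predOf (𝕋.part N') a with hb
  have hbP : b ∈ 𝕋.part N' := predOf_mem h0' a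
  have hba : b < a := predOf_lt h0' ha0
  have hb₀b : b₀ ≤ b := le_predOf (hPP' hb₀P) hb₀a
  have haF : a ∉ F := fun hx => lt_irrefl _ (hFa a hx)
  -- `S'` is still constant on the cell
  have hconst : ∀ t, b₀ ≤ t → t < a → S' t = S b₀ := by
    intro t h1 h2
    rw [h.eq_off t]
    · refine (hS _ _ h1 ?_).symm
      rintro x hx ⟨h3, h4⟩
      linarith [le_predOf hx (h4.trans_lt h2)]
    · rintro a' ha' ⟨h3, h4⟩
      have := le_predOf (hF a' ha').1 (hFa a' ha')
      linarith
  have hSa : S' a = S a := by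
    refine h.eq_off a ?_
    rintro a' ha' ⟨h3, h4⟩
    linarith [hFa a' ha']
  have hSb : S' b = S b₀ := hconst b hb₀b hba
  obtain ⟨N'', hN''₀, hN'N'', S'', hstep, heq, hclose, hjump, hcov, hmid⟩ :=
    exists_cell_refinement 𝕋 h.step hbP (hPP' ha) hba hW hWQ hδ hWδ N₀
  have h0'' : (0 : ℝ) ∈ 𝕋.part N'' := 𝕋.zero_mem N''
  have hP'P'' : 𝕋.part N' ⊆ 𝕋.part N'' := 𝕋.part_mono hN'N''
  have hleft : ∀ t, b₀ ≤ t → t ≤ b → S'' t = S b₀ := fun t h1 h2 => by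
    rw [heq t fun h3 => absurd h3.1 (not_lt.2 h2), hconst t h1 (h2.trans_lt hba)]
  have hcell : ∀ n, N' ≤ n → ∀ i j, stepCov (𝕋.part n) S'' i j b₀ a
      = stepCov (𝕋.part n) S'' i j b a := by
    intro n hn i j
    rw [← stepCov_add i j hb₀b hba.le, add_eq_right]
    refine Finset.sum_eq_zero fun x hx => ?_
    rw [Finset.mem_filter] at hx
    have h1 : b₀ ≤ predOf (𝕋.part n) x := le_predOf (𝕋.part_mono hn (hPP' hb₀P)) hx.2.1
    have h2 := predOf_lt (𝕋.zero_mem n) (hb₀0.trans_lt hx.2.1)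
    rw [hleft x hx.2.1.le hx.2.2, hleft _ h1 (h2.le.trans hx.2.2)]
    simp
  -- the cells of `F` are unchanged
  have hold : ∀ a' ∈ F, ∀ t, t ≤ a' → S'' t = S' t := fun a' ha' t ht =>
    heq t fun h3 => by linarith [le_predOf (hF a' ha').1 (hFa a' ha'), h3.1]
  have holdcov : ∀ n, N ≤ n → ∀ a' ∈ F, ∀ i j, stepCov (𝕋.part n) S'' i j (predOf P a') a'
      = stepCov (𝕋.part n) S' i j (predOf P a') a' := by
    intro n hn a' ha' i j
    exact stepCov_congr (𝕋.zero_mem n) i j (fun x _ _ hx => hold a' ha' x hx)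
      (𝕋.nonneg_of_mem _ (predOf_mem h0 a')) (𝕋.part_mono hn (predOf_mem h0 a'))
  have holdcov' : ∀ n, N' ≤ n → ∀ a' ∈ F, ∀ i j,
      |stepCov (𝕋.part n) S'' i j (predOf P a') a' - Q a' i j| ≤ δ := by
    intro n hn a' ha' i j
    rw [holdcov n (h.le.trans hn) a' ha', h.step.stepCov_eq h0' (𝕋.part_mono hn) i j
      (𝕋.nonneg_of_mem _ (predOf_mem h0 a'))]
    exact h.cov a' ha' i j
  refine ⟨N'', hN''₀, S'', h.le.trans hN'N'', hstep, ?_, ?_, ?_, ?_, ?_⟩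
  · intro t ht
    rw [heq t, h.eq_off t fun a' ha' => ht a' (Finset.mem_insert_of_mem ha')]
    rintro ⟨h1, h2⟩
    exact ht a (Finset.mem_insert_self _ _) ⟨hb₀b.trans_lt h1, h2⟩
  · intro a' ha' t h1 h2 i
    rcases Finset.mem_insert.1 ha' with rfl | ha'
    · rcases le_total t b with h3 | h3
      · rw [hleft t h1 h3, sub_self, abs_zero]
        linarith [(abs_nonneg _).trans (hε i)]
      · have := hclose t i h3 h2
        rw [hSb, hSa] at this
        linarith [hε i]
    · rw [hold a' ha' t h2]
      exact h.close a' ha' t h1 h2 i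
  · intro a' ha' x hx h1 h2 i
    rcases Finset.mem_insert.1 ha' with rfl | ha'
    · rcases le_or_gt x b with h3 | h3
      · have h4 := le_predOf (hP'P'' (hPP' hb₀P)) h1
        have h5 := predOf_lt h0'' (hb₀0.trans_lt h1)
        rw [hleft x h1.le h3, hleft _ h4 (h5.le.trans h3), sub_self, abs_zero]
        exact hδ.le
      · exact hjump x hx h3 h2 i
    · have hx0 : 0 < x := (𝕋.nonneg_of_mem _ (predOf_mem h0 a')).trans_lt h1
      rw [hold a' ha' x h2, hold a' ha' _ ((predOf_lt h0'' hx0).le.trans h2)]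
      by_cases hxP : x ∈ 𝕋.part N'
      · rw [h.step.eq_predOf h0' hP'P'' hx0]
        exact h.jump a' ha' x hxP h1 h2 i
      · rw [h.step.eq_predOf_of_notMem h0' hP'P'' hxP hx0, sub_self, abs_zero]
        exact hδ.le
  · intro a' ha' i j
    rcases Finset.mem_insert.1 ha' with rfl | ha'
    · rw [hcell N'' hN'N'']
      exact hcov i j
    · exact holdcov' N'' hN'N'' a' ha' i j
  · intro n hNn hnN''
    rcases le_or_gt n N' with hn | hn
    · obtain ⟨c, hc, hc1, hc2, hc3⟩ := h.cov_mid n hNn hn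
      have hca : c < a := by
        rcases hc with hc | rfl
        · exact hFa c hc
        · exact ha0
      refine ⟨c, hc.imp_left fun h => Finset.mem_insert_of_mem h, ?_, ?_, ?_⟩
      · intro a' ha' h1 i j
        rcases Finset.mem_insert.1 ha' with rfl | ha'
        · exact absurd h1 hca.not_gt
        · rw [holdcov n hNn a' ha']
          exact hc1 a' ha' h1 i j
      · intro hcF i
        have hcF' : c ∈ F := (Finset.mem_insert.1 hcF).resolve_left hca.ne
        rw [holdcov n hNn c hcF']
        exact hc2 hcF' i
      · intro a' ha' ha'0 ha'F x hx h1 h2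
        have h3 : a' ∉ F ∨ c < a' :=
          ha'F.imp_left fun h3 h4 => h3 (Finset.mem_insert_of_mem h4)
        rw [heq x, hc3 a' ha' ha'0 h3 x hx h1 h2]
        rintro ⟨h4, h5⟩
        exact absurd (le_predOf (𝕋.part_mono hn hx) h5) (not_le.2 h4)
    · refine ⟨a, Or.inl (Finset.mem_insert_self _ _), ?_, ?_, ?_⟩
      · intro a' ha' h1 i j
        exact holdcov' n hn.le a' ((Finset.mem_insert.1 ha').resolve_left h1.ne) i j
      · intro _ i
        rw [hcell n hn.le]
        refine (hmid n hn.le hnN'' i).trans ?_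
        rw [hSa, hSb]
        have := sq_le_sq' (abs_le.1 (hε i)).1 (abs_le.1 (hε i)).2
        linarith
      · intro a' ha' ha'0 ha'F x hx h1 h2
        have ha'F' : a' ≠ a ∧ a' ∉ F := by
          rcases ha'F with h3 | h3
          · exact ⟨fun h4 => h3 (h4 ▸ Finset.mem_insert_self _ _),
              fun h4 => h3 (Finset.mem_insert_of_mem h4)⟩
          · exact ⟨h3.ne', fun h4 => absurd (hFa a' h4) h3.not_gt⟩
        rw [heq x, h.eq_off x]
        · rintro a'' ha'' ⟨h3, h4⟩
          exact ha'F'.2 (le_predOf_of_lt_of_lt (hF a'' ha'').1 ha' h1 h2 h3 h4 ▸ ha'')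
        · rintro ⟨h3, h4⟩
          exact ha'F'.1 (le_predOf_of_lt_of_lt ha ha' h1 h2 (hb₀b.trans_lt h3) h4).symm

lemma exists_refinesOn {N : ℕ} {S : ℝ → Fin d → ℝ} {Q : ℝ → Fin d → Fin d → ℝ} {ε δ : ℝ}
    (hS : IsStepOn (𝕋.part N) S)
    (hε : ∀ a ∈ 𝕋.part N, 0 < a → ∀ i, |S a i - S (predOf (𝕋.part N) a) i| ≤ ε) (hδ : 0 < δ)
    (hQ : ∀ a ∈ 𝕋.part N, 0 < a → HasSmallDecomposition (Q a)) (N₀ : ℕ) :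
    ∃ N' ≥ N₀, ∃ S', RefinesOn 𝕋 N S Q ε δ ((𝕋.part N).filter (fun x => 0 < x)) N' S' := by
  suffices H : ∀ F : Finset ℝ, (∀ x ∈ F, x ∈ 𝕋.part N ∧ 0 < x) →
      ∃ N' ≥ N₀, ∃ S', RefinesOn 𝕋 N S Q ε δ F N' S' from
    H _ fun x hx => Finset.mem_filter.1 hx
  intro F
  induction F using Finset.induction_on_max with
  | empty => exact fun _ => ⟨max N N₀, le_max_right _ _, S, .empty hS (le_max_left _ _)⟩
  | insert a F hFa ih =>
    intro hF
    obtain ⟨N', -, S', h⟩ := ih fun x hx => hF x (Finset.mem_insert_of_mem hx)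
    have ha := hF a (Finset.mem_insert_self _ _)
    exact h.insert hS (fun x hx => hF x (Finset.mem_insert_of_mem hx)) ha.1 ha.2 hFa
      (hε a ha.1 ha.2) hδ (hQ a ha.1 ha.2) N₀

/-- Covariation sums compared cell by cell. -/
lemma abs_stepCov_sub_sum_le {N n : ℕ} {S' : ℝ → Fin d → ℝ} {i j : Fin d}
    {G e : ℝ → ℝ} {B : ℝ} (he : ∀ a ∈ 𝕋.part N, 0 < a → 0 ≤ e a) (hB : 0 ≤ B)
    (hG : ∀ a ∈ 𝕋.part N, 0 < a →
      |stepCov (𝕋.part n) S' i j (predOf (𝕋.part N) a) a - G a| ≤ e a)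
    (hcell : ∀ a ∈ 𝕋.part N, 0 < a → ∀ i,
      stepCov (𝕋.part n) S' i i (predOf (𝕋.part N) a) a ≤ B) {t : ℝ} (ht : t ∈ Icc 0 T) :
    |stepCov (𝕋.part n) S' i j 0 t - ∑ a ∈ (𝕋.part N).filter (fun a => 0 < a ∧ a ≤ t), G a|
      ≤ ∑ a ∈ (𝕋.part N).filter (fun a => 0 < a), e a + B := by
  set P := 𝕋.part N with hP
  have h0 : (0 : ℝ) ∈ P := 𝕋.zero_mem N
  have hne : (P.filter (fun x => x ≤ t)).Nonempty := ⟨0, by simp [h0, ht.1]⟩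
  set q := (P.filter (fun x => x ≤ t)).max' hne with hq
  have hqm := Finset.mem_filter.1 (Finset.max'_mem _ hne)
  rw [← hq] at hqm
  have hqmax : ∀ x ∈ P, x ≤ t → x ≤ q := fun x hx hxt =>
    Finset.le_max' _ _ (Finset.mem_filter.2 ⟨hx, hxt⟩)
  have hq0 : 0 ≤ q := 𝕋.nonneg_of_mem _ hqm.1
  have hfil : P.filter (fun a => 0 < a ∧ a ≤ t) = P.filter (fun a => 0 < a ∧ a ≤ q) := by
    refine Finset.filter_congr fun x hx => and_congr_right fun _ => ?_
    exact ⟨hqmax x hx, fun h => h.trans hqm.2⟩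
  have hlast : |stepCov (𝕋.part n) S' i j q t| ≤ B := by
    rcases hqm.2.eq_or_lt with h | h
    · rw [stepCov_of_le i j h.ge, abs_zero]
      exact hB
    · have hqT : q < T := h.trans_le ht.2
      have h1 : q < succOf T P q := lt_succOf (𝕋.top_mem N) hqT
      have h2 : succOf T P q ∈ P := succOf_mem (𝕋.top_mem N) q
      have h3 := predOf_succOf h0 𝕋.nonneg_of_mem (𝕋.top_mem N) hqm.1 hqT
      have h4 := hcell _ h2 (hq0.trans_lt h1)
      rw [h3] at h4
      refine abs_stepCov_le i j (le_of_lt ?_) h4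
      by_contra! h5
      exact absurd (hqmax _ h2 h5) (not_le.2 h1)
  have hsum : stepCov (𝕋.part n) S' i j 0 q = ∑ a ∈ P.filter (fun a => 0 < a ∧ a ≤ q),
      stepCov (𝕋.part n) S' i j (predOf P a) a := by
    have := 𝕋.telescope_pred (fun t => stepCov (𝕋.part n) S' i j 0 t) h0 hqm.1 hq0
    rw [stepCov_of_le i j le_rfl, sub_zero] at this
    rw [← this]
    refine Finset.sum_congr rfl fun a ha => ?_
    rw [Finset.mem_filter] at ha
    rw [← stepCov_add i j (𝕋.nonneg_of_mem _ (predOf_mem h0 a)) (predOf_lt h0 ha.2.1).le,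
      add_sub_cancel_left]
  rw [← stepCov_add i j hq0 hqm.2, hfil, hsum, add_sub_right_comm, ← Finset.sum_sub_distrib]
  refine (abs_add_le _ _).trans (add_le_add ?_ hlast)
  refine (Finset.abs_sum_le_sum_abs _ _).trans ?_
  calc _ ≤ ∑ a ∈ P.filter (fun a => 0 < a ∧ a ≤ q), e a := by
        refine Finset.sum_le_sum fun a ha => ?_
        rw [Finset.mem_filter] at ha
        exact hG a ha.1 ha.2.1
    _ ≤ _ := by
        refine Finset.sum_le_sum_of_subset_of_nonneg ?_ ?_
        · intro a ha
          rw [Finset.mem_filter] at ha ⊢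
          exact ⟨ha.1, ha.2.1⟩
        · intro a ha _
          rw [Finset.mem_filter] at ha
          exact he a ha.1 ha.2

lemma stepCov_cell {P : Finset ℝ} {S : ℝ → Fin d → ℝ} (i j : Fin d) {a : ℝ}
    (h0 : (0 : ℝ) ∈ P) (ha : a ∈ P) (ha0 : 0 < a) : stepCov P S i j (predOf P a) a
      = (S a i - S (predOf P a) i) * (S a j - S (predOf P a) j) := by
  unfold stepCov
  rw [show P.filter (fun x => predOf P a < x ∧ x ≤ a) = {a} from ?_, Finset.sum_singleton]
  ext x
  rw [Finset.mem_filter, Finset.mem_singleton]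
  constructor
  · rintro ⟨h1, h2, h3⟩
    refine h3.antisymm (not_lt.1 fun h4 => ?_)
    linarith [le_predOf h1 h4]
  · rintro rfl
    exact ⟨ha, predOf_lt h0 ha0, le_rfl⟩

section Bounds

variable {N N' : ℕ} {S S' : ℝ → Fin d → ℝ} {Q : ℝ → Fin d → Fin d → ℝ} {ε δ q : ℝ}

lemma RefinesOn.abs_sub_le
    (h : RefinesOn 𝕋 N S Q ε δ ((𝕋.part N).filter (fun x => 0 < x)) N' S')
    (hS : IsStepOn (𝕋.part N) S) (hε0 : 0 ≤ ε) (hδ : 0 ≤ δ) (t : ℝ) (i : Fin d) :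
    |S' t i - S t i| ≤ ε + δ := by
  by_cases ht : ∀ a ∈ (𝕋.part N).filter (fun x => 0 < x), ¬ (predOf (𝕋.part N) a < t ∧ t < a)
  · rw [h.eq_off t ht, sub_self, abs_zero]
    positivity
  · push Not at ht
    obtain ⟨a, ha, h1, h2⟩ := ht
    have h3 := h.close a ha t h1.le h2.le i
    rwa [hS _ _ h1.le] at h3
    rintro x hx ⟨h4, h5⟩
    linarith [le_predOf hx (h5.trans_lt h2)]

lemma RefinesOn.eq_of_mem
    (h : RefinesOn 𝕋 N S Q ε δ ((𝕋.part N).filter (fun x => 0 < x)) N' S') {t : ℝ}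
    (ht : t ∈ 𝕋.part N) : S' t = S t := by
  refine h.eq_off t ?_
  rintro a - ⟨h1, h2⟩
  linarith [le_predOf ht h2]

lemma RefinesOn.jump_le
    (h : RefinesOn 𝕋 N S Q ε δ ((𝕋.part N).filter (fun x => 0 < x)) N' S')
    {x : ℝ} (hx : x ∈ 𝕋.part N') (hx0 : 0 < x) (i : Fin d) :
    |S' x i - S' (predOf (𝕋.part N') x) i| ≤ δ := by
  have h0 := 𝕋.zero_mem N
  have hT := 𝕋.top_mem N
  set b := succOf T (𝕋.part N) (predOf (𝕋.part N) x) with hb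
  have h1 : predOf (𝕋.part N) x < x := predOf_lt h0 hx0
  have h1T := h1.trans_le (𝕋.le_of_mem x hx)
  have h2 : b ∈ 𝕋.part N := succOf_mem hT _
  have h3 : predOf (𝕋.part N) x < b := lt_succOf hT h1T
  have h4 : predOf (𝕋.part N) b = predOf (𝕋.part N) x :=
    predOf_succOf h0 𝕋.nonneg_of_mem hT (predOf_mem h0 x) h1T
  have h5 : 0 < b := (𝕋.nonneg_of_mem _ (predOf_mem h0 x)).trans_lt h3
  refine h.jump b (Finset.mem_filter.2 ⟨h2, h5⟩) x hx (h4 ▸ h1) ?_ i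
  by_contra! h6
  exact absurd (le_predOf h2 h6) (not_le.2 h3)

lemma RefinesOn.abs_stepCov_sub_le
    (h : RefinesOn 𝕋 N S Q ε δ ((𝕋.part N).filter (fun x => 0 < x)) N' S') (hδ : 0 ≤ δ)
    (hQ : ∀ a ∈ 𝕋.part N, 0 < a → ∀ i j, |Q a i j| ≤ q) (hq : 0 ≤ q) (i j : Fin d) {t : ℝ}
    (ht : t ∈ Icc 0 T) :
    |stepCov (𝕋.part N') S' i j 0 t
      - ∑ a ∈ (𝕋.part N).filter (fun a => 0 < a ∧ a ≤ t), Q a i j|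
      ≤ (𝕋.part N).card * δ + (q + δ) := by
  refine (abs_stepCov_sub_sum_le (e := fun _ => δ) (B := q + δ) (fun _ _ _ => hδ)
    (by positivity) (fun a ha ha0 => h.cov a (Finset.mem_filter.2 ⟨ha, ha0⟩) i j)
    (fun a ha ha0 i => ?_) ht).trans ?_
  · have h1 := (abs_le.1 (h.cov a (Finset.mem_filter.2 ⟨ha, ha0⟩) i i)).2
    have h2 := (abs_le.1 (hQ a ha ha0 i i)).2
    linarith
  · rw [Finset.sum_const, nsmul_eq_mul]
    have : ((((𝕋.part N).filter (fun a => 0 < a)).card : ℕ) : ℝ) ≤ (𝕋.part N).card := by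
      exact_mod_cast Finset.card_filter_le _ _
    have := mul_le_mul_of_nonneg_right this hδ
    linarith

lemma RefinesOn.exists_abs_stepCov_sub_le
    (h : RefinesOn 𝕋 N S Q ε δ ((𝕋.part N).filter (fun x => 0 < x)) N' S')
    (hS : IsStepOn (𝕋.part N) S)
    (hε : ∀ a ∈ 𝕋.part N, 0 < a → ∀ i, |S a i - S (predOf (𝕋.part N) a) i| ≤ ε)
    (hδ : 0 ≤ δ) (hQ : ∀ a ∈ 𝕋.part N, 0 < a → ∀ i j, |Q a i j| ≤ q) (hq : 0 ≤ q)
    {n : ℕ} (hn : N ≤ n) (hn' : n ≤ N') :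
    ∃ c ∈ Icc 0 T, ∀ i j, ∀ t ∈ Icc 0 T, |stepCov (𝕋.part n) S' i j 0 t
      - (∑ a ∈ (𝕋.part N).filter (fun a => 0 < a ∧ a ≤ min t c), Q a i j
          + stepCov (𝕋.part N) S i j c t)|
      ≤ (𝕋.part N).card * δ + 2 * (2 * ε ^ 2 + 4 * q + δ) + q := by
  obtain ⟨c, hc, hc1, hc2, hc3⟩ := h.cov_mid n hn hn'
  have h0 := 𝕋.zero_mem N
  have hcP : c ∈ 𝕋.part N := by
    rcases hc with hc | rfl
    · exact (Finset.mem_filter.1 hc).1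
    · exact h0
  have hc0 := 𝕋.nonneg_of_mem c hcP
  set B := 2 * ε ^ 2 + 4 * q + δ with hB
  have hB0 : 0 ≤ B := by positivity
  have hafter : ∀ a ∈ 𝕋.part N, 0 < a → c < a → ∀ i j,
      stepCov (𝕋.part n) S' i j (predOf (𝕋.part N) a) a
        = (S a i - S (predOf (𝕋.part N) a) i) * (S a j - S (predOf (𝕋.part N) a) j) := by
    intro a ha ha0 hca i j
    have hp0 := 𝕋.nonneg_of_mem _ (predOf_mem h0 a)
    rw [← stepCov_cell i j h0 ha ha0, ← hS.stepCov_eq h0 (𝕋.part_mono hn) i j hp0]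
    refine stepCov_congr (𝕋.zero_mem n) i j ?_ hp0 (𝕋.part_mono hn (predOf_mem h0 a))
    intro x hx h1 h2
    rcases h1.eq_or_lt with rfl | h1
    · exact h.eq_of_mem (predOf_mem h0 a)
    rcases h2.eq_or_lt with rfl | h2
    · exact h.eq_of_mem ha
    exact hc3 a ha ha0 (Or.inr hca) x hx h1 h2
  have hcell : ∀ a ∈ 𝕋.part N, 0 < a → ∀ i,
      stepCov (𝕋.part n) S' i i (predOf (𝕋.part N) a) a ≤ B := by
    intro a ha ha0 i
    have haF : a ∈ (𝕋.part N).filter (fun x => 0 < x) := Finset.mem_filter.2 ⟨ha, ha0⟩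
    have hqa := (abs_le.1 (hQ a ha ha0 i i)).2
    rcases lt_trichotomy a c with h1 | h1 | h1
    · have := (abs_le.1 (hc1 a haF h1 i i)).2
      nlinarith [sq_nonneg ε]
    · subst h1
      have := hc2 haF i
      linarith
    · rw [hafter a ha ha0 h1, ← sq]
      have := sq_le_sq' (abs_le.1 (hε a ha ha0 i)).1 (abs_le.1 (hε a ha ha0 i)).2
      nlinarith [sq_nonneg ε]
  refine ⟨c, ⟨hc0, 𝕋.le_of_mem c hcP⟩, fun i j t ht => ?_⟩
  have key := abs_stepCov_sub_sum_le (n := n) (S' := S') (i := i) (j := j) (B := B)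
    (G := fun a => if a ≤ c then Q a i j else
      (S a i - S (predOf (𝕋.part N) a) i) * (S a j - S (predOf (𝕋.part N) a) j))
    (e := fun a => δ + if a = c then B + q else 0)
    (fun a _ _ => by split_ifs <;> positivity) hB0 ?_ hcell ht
  · rw [Finset.sum_ite, Finset.filter_filter, Finset.filter_filter,
      Finset.sum_add_distrib, Finset.sum_const, nsmul_eq_mul, Finset.sum_ite_eq'] at key
    have e1 : (𝕋.part N).filter (fun a => (0 < a ∧ a ≤ t) ∧ a ≤ c)
        = (𝕋.part N).filter (fun a => 0 < a ∧ a ≤ min t c) :=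
      Finset.filter_congr fun x _ => by rw [le_min_iff, and_assoc]
    have e2 : (𝕋.part N).filter (fun a => (0 < a ∧ a ≤ t) ∧ ¬ a ≤ c)
        = (𝕋.part N).filter (fun a => c < a ∧ a ≤ t) :=
      Finset.filter_congr fun x _ => by
        constructor
        · rintro ⟨⟨h1, h2⟩, h3⟩
          exact ⟨not_le.1 h3, h2⟩
        · rintro ⟨h1, h2⟩
          exact ⟨⟨hc0.trans_lt h1, h2⟩, not_le.2 h1⟩
    rw [e1, e2] at key
    refine key.trans ?_
    have h1 : ((((𝕋.part N).filter (fun a => 0 < a)).card : ℕ) : ℝ) ≤ (𝕋.part N).card := by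
      exact_mod_cast Finset.card_filter_le _ _
    have h2 := mul_le_mul_of_nonneg_right h1 hδ
    split_ifs <;> linarith
  · intro a ha ha0
    have haF : a ∈ (𝕋.part N).filter (fun x => 0 < x) := Finset.mem_filter.2 ⟨ha, ha0⟩
    rcases lt_trichotomy a c with h1 | h1 | h1
    · rw [if_pos h1.le, if_neg h1.ne, add_zero]
      exact hc1 a haF h1 i j
    · rw [if_pos h1.le, if_pos h1]
      have h2 := abs_stepCov_le i j le_rfl (hcell a ha ha0)
      have h3 := hQ a ha ha0 i j
      have := abs_sub (stepCov (𝕋.part n) S' i j (predOf (𝕋.part N) a) a) (Q a i j)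
      linarith
    · rw [if_neg h1.not_ge, if_neg h1.ne', hafter a ha ha0 h1, sub_self, abs_zero, add_zero]
      exact hδ

end Bounds

end Rounds

section Decomposition

lemma sum_range_mul_mod (f : ℕ → ℝ) (d m : ℕ) :
    ∑ k ∈ Finset.range (m * d), f (k % d) = m * ∑ k ∈ Finset.range d, f k := by
  induction m with
  | zero => simp
  | succ m ih =>
    have h : ∑ x ∈ Finset.range d, f ((m * d + x) % d) = ∑ x ∈ Finset.range d, f x :=
      Finset.sum_congr rfl fun x hx => by
        rw [Nat.mul_add_mod', Nat.mod_eq_of_lt (Finset.mem_range.1 hx)]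
    rw [Nat.succ_mul, Finset.sum_range_add, ih, h]
    push_cast
    ring

open scoped MatrixOrder Matrix.Norms.L2Operator in
lemma hasSmallDecomposition_of_posSemidef {d : ℕ} {Q : Fin d → Fin d → ℝ}
    (hsymm : ∀ i j, Q i j = Q j i) (hpos : ∀ y : Fin d → ℝ, 0 ≤ ∑ i, ∑ j, Q i j * y i * y j) :
    HasSmallDecomposition Q := by
  obtain ⟨B, hB⟩ : ∃ B : Matrix (Fin d) (Fin d) ℝ, ∀ i j, Q i j = ∑ c, B c i * B c j := by
    have hM : (Matrix.of Q).PosSemidef := by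
      refine Matrix.PosSemidef.of_dotProduct_mulVec_nonneg ?_ fun y => ?_
      · ext i j
        simp [hsymm i j]
      · have := hpos y
        simp only [dotProduct, Matrix.mulVec, Matrix.of_apply, Pi.star_apply, star_trivial,
          Finset.mul_sum]
        refine this.trans_eq (Finset.sum_congr rfl fun i _ => Finset.sum_congr rfl fun j _ => ?_)
        ring
    obtain ⟨B, hB⟩ := CStarAlgebra.nonneg_iff_eq_star_mul_self.1 hM.nonneg
    refine ⟨B, fun i j => ?_⟩
    have := congrFun (congrFun hB i) j
    simpa [Matrix.mul_apply, Matrix.star_eq_conjTranspose] using this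
  intro δ hδ
  set b : ℕ → Fin d → ℝ := fun k i => if h : k < d then B ⟨k, h⟩ i else 0 with hb
  set C : ℝ := ∑ c, ∑ i, |B c i| with hC
  have hbC : ∀ k i, |b k i| ≤ C := by
    intro k i
    simp only [hb]
    split_ifs with h
    · refine (Finset.single_le_sum (f := fun i => |B ⟨k, h⟩ i|) (fun _ _ => abs_nonneg _)
        (Finset.mem_univ i)).trans ?_
      exact Finset.single_le_sum (f := fun c => ∑ i, |B c i|)
        (fun _ _ => Finset.sum_nonneg fun _ _ => abs_nonneg _) (Finset.mem_univ _)
    · rw [abs_zero]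
      positivity
  have hC0 : 0 ≤ C := by positivity
  obtain ⟨m, hm⟩ := exists_nat_ge ((C / δ) ^ 2 + 1)
  have hm0 : (0 : ℝ) < m := lt_of_lt_of_le (by positivity) hm
  set σ := √(1 / (2 * (m : ℝ))) with hσ
  have hσ2 : σ * σ = 1 / (2 * m) := Real.mul_self_sqrt (by positivity)
  have hσC : σ * C ≤ δ := by
    refine abs_le_of_sq_le_sq' ?_ hδ.le |>.2
    have h1 : C ^ 2 ≤ m * δ ^ 2 := by
      have : (C / δ) ^ 2 ≤ m := by linarith
      rwa [div_pow, div_le_iff₀ (by positivity)] at this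
    rw [mul_pow, sq σ, hσ2, div_mul_eq_mul_div, div_le_iff₀ (by positivity)]
    nlinarith [sq_nonneg C]
  refine ⟨fun k i => if k < m * d then σ * b (k % d) i else 0, m * d, ?_, ?_, ?_⟩
  · intro k hk i
    simp [not_lt.2 hk]
  · intro i j
    have h1 : ∑ k ∈ Finset.range (m * d), ((if k < m * d then σ * b (k % d) i else 0)
        * (if k < m * d then σ * b (k % d) j else 0))
        = ∑ k ∈ Finset.range (m * d), σ * σ * (b (k % d) i * b (k % d) j) := by
      refine Finset.sum_congr rfl fun k hk => ?_
      rw [if_pos (Finset.mem_range.1 hk), if_pos (Finset.mem_range.1 hk)]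
      ring
    rw [h1, ← Finset.mul_sum, sum_range_mul_mod (fun k => b k i * b k j), hσ2, Finset.sum_range,
      hB i j]
    have h2 : ∑ c : Fin d, b c i * b c j = ∑ c, B c i * B c j :=
      Finset.sum_congr rfl fun c _ => by simp [hb]
    rw [h2]
    field_simp
  · intro k i
    dsimp only
    split_ifs
    · rw [abs_mul, abs_of_nonneg (Real.sqrt_nonneg _)]
      exact (mul_le_mul_of_nonneg_left (hbC _ _) (Real.sqrt_nonneg _)).trans hσC
    · simpa using hδ.le

end Decomposition

section Riemann

variable {T : ℝ} {𝕋 : PartitionSeq T}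

/-- The last partition point before `t`. -/
lemma PartitionSeq.exists_last (n : ℕ) {t : ℝ} (ht : t ∈ Icc 0 T) :
    ∃ q ∈ 𝕋.part n, q ≤ t ∧ (∀ x ∈ 𝕋.part n, x ≤ t → x ≤ q) ∧ t ≤ succOf T (𝕋.part n) q := by
  have hne : ((𝕋.part n).filter (fun x => x ≤ t)).Nonempty :=
    ⟨0, by simp [𝕋.zero_mem n, ht.1]⟩
  have hqm := Finset.mem_filter.1 (Finset.max'_mem _ hne)
  have hqmax : ∀ x ∈ 𝕋.part n, x ≤ t → x ≤ ((𝕋.part n).filter (fun x => x ≤ t)).max' hne :=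
    fun x hx hxt => Finset.le_max' _ _ (Finset.mem_filter.2 ⟨hx, hxt⟩)
  refine ⟨_, hqm.1, hqm.2, hqmax, ?_⟩
  rcases hqm.2.eq_or_lt with h | h
  · exact h.ge.trans (le_succOf (𝕋.top_mem n) (𝕋.le_of_mem _ hqm.1))
  · by_contra! h5
    exact absurd (hqmax _ (succOf_mem (𝕋.top_mem n) _) h5.le)
      (not_le.2 (lt_succOf (𝕋.top_mem n) (h.trans_le ht.2)))

/-- Riemann sums converge to the integral, uniformly in the upper limit. -/
lemma PartitionSeq.exists_riemann {g : ℝ → ℝ} (hg : ContinuousOn g (Icc 0 T)) {ε : ℝ}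
    (hε : 0 < ε) : ∃ η > 0, ∀ n, (∀ s ∈ 𝕋.part n, succOf T (𝕋.part n) s - s < η) →
      ∀ t ∈ Icc 0 T, |∑ a ∈ (𝕋.part n).filter (fun a => 0 < a ∧ a ≤ t),
        (a - predOf (𝕋.part n) a) * g (predOf (𝕋.part n) a) - ∫ s in (0 : ℝ)..t, g s| ≤ ε := by
  have hT : 0 ≤ T := 𝕋.nonneg_of_mem T (𝕋.top_mem 0)
  obtain ⟨C, hC⟩ := isCompact_Icc.exists_bound_of_continuousOn hg
  have hC0 : 0 ≤ C := (norm_nonneg _).trans (hC 0 ⟨le_rfl, hT⟩)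
  have hu := isCompact_Icc.uniformContinuousOn_of_continuous hg
  rw [Metric.uniformContinuousOn_iff_le] at hu
  obtain ⟨η, hη, hω⟩ := hu (ε / (2 * (T + 1))) (by positivity)
  have hint : ∀ x ∈ Icc 0 T, ∀ y ∈ Icc 0 T, IntervalIntegrable g MeasureTheory.volume x y :=
    fun x hx y hy => (hg.mono (Set.uIcc_subset_Icc hx hy)).intervalIntegrable
  refine ⟨min η (ε / (2 * (C + 1))), lt_min hη (by positivity), fun n hn t ht => ?_⟩
  obtain ⟨q, hq, hqt, hqmax, htq⟩ := 𝕋.exists_last n ht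
  have h0 := 𝕋.zero_mem n
  have hq0 := 𝕋.nonneg_of_mem q hq
  have hqI : q ∈ Icc 0 T := ⟨hq0, 𝕋.le_of_mem q hq⟩
  have h0I : (0 : ℝ) ∈ Icc 0 T := ⟨le_rfl, hT⟩
  have hfil : (𝕋.part n).filter (fun a => 0 < a ∧ a ≤ t)
      = (𝕋.part n).filter (fun a => 0 < a ∧ a ≤ q) := by
    refine Finset.filter_congr fun x hx => and_congr_right fun _ => ?_
    exact ⟨hqmax x hx, fun h => h.trans hqt⟩
  have hlast : |∫ s in q..t, g s| ≤ ε / 2 := by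
    have h1 := intervalIntegral.norm_integral_le_of_norm_le_const (a := q) (b := t) (f := g)
      (C := C) fun x hx => by
        rw [Set.uIoc_of_le hqt] at hx
        exact hC x ⟨hq0.trans hx.1.le, hx.2.trans ht.2⟩
    have h2 : t - q ≤ ε / (2 * (C + 1)) := by
      linarith [hn q hq, min_le_right η (ε / (2 * (C + 1)))]
    rw [Real.norm_eq_abs, abs_of_nonneg (sub_nonneg.2 hqt)] at h1
    refine h1.trans ?_
    refine (mul_le_mul_of_nonneg_left h2 hC0).trans ?_
    rw [mul_div_assoc', div_le_div_iff₀ (by positivity) (by positivity)]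
    nlinarith
  have hsum : ∫ s in (0 : ℝ)..q, g s = ∑ a ∈ (𝕋.part n).filter (fun a => 0 < a ∧ a ≤ q),
      ∫ s in (predOf (𝕋.part n) a)..a, g s := by
    have := 𝕋.telescope_pred (fun t => ∫ s in (0 : ℝ)..t, g s) h0 hq hq0
    rw [intervalIntegral.integral_same, sub_zero] at this
    rw [← this]
    refine Finset.sum_congr rfl fun a ha => ?_
    rw [Finset.mem_filter] at ha
    exact intervalIntegral.integral_interval_sub_left
      (hint _ h0I _ (𝕋.subset_Icc n ha.1)) (hint _ h0I _ (𝕋.subset_Icc n (predOf_mem h0 a)))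
  have hfirst : |∑ a ∈ (𝕋.part n).filter (fun a => 0 < a ∧ a ≤ q),
      ((a - predOf (𝕋.part n) a) * g (predOf (𝕋.part n) a)
        - ∫ s in (predOf (𝕋.part n) a)..a, g s)| ≤ ε / 2 := by
    refine (Finset.abs_sum_le_sum_abs _ _).trans ?_
    calc _ ≤ ∑ a ∈ (𝕋.part n).filter (fun a => 0 < a ∧ a ≤ q),
          ε / (2 * (T + 1)) * (a - predOf (𝕋.part n) a) := by
          refine Finset.sum_le_sum fun a ha => ?_
          rw [Finset.mem_filter] at ha
          have hp := 𝕋.subset_Icc n (predOf_mem h0 a)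
          have hpa := predOf_lt h0 ha.2.1
          have hmesh := 𝕋.sub_predOf_lt_of_mesh hn ha.1 ha.2.1
          have h1 : (a - predOf (𝕋.part n) a) * g (predOf (𝕋.part n) a)
              = ∫ s in (predOf (𝕋.part n) a)..a, g (predOf (𝕋.part n) a) := by
            rw [intervalIntegral.integral_const, smul_eq_mul]
          rw [h1, ← intervalIntegral.integral_sub intervalIntegrable_const
            (hint _ hp _ (𝕋.subset_Icc n ha.1)), ← abs_of_pos (sub_pos.2 hpa)]
          refine intervalIntegral.norm_integral_le_of_norm_le_const (E := ℝ) fun x hx => ?_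
          rw [Set.uIoc_of_le hpa.le] at hx
          refine hω _ hp _ ⟨hp.1.trans hx.1.le, hx.2.trans (𝕋.le_of_mem a ha.1)⟩ ?_
          rw [Real.dist_eq, abs_sub_comm, abs_of_nonneg (by linarith [hx.1])]
          linarith [hx.2, min_le_left η (ε / (2 * (C + 1)))]
      _ = ε / (2 * (T + 1)) * (q - 0) := by
          rw [← Finset.mul_sum, 𝕋.telescope_pred (fun x => x) h0 hq hq0]
      _ ≤ _ := by
          rw [sub_zero, div_mul_eq_mul_div, div_le_div_iff₀ (by positivity) (by positivity)]
          nlinarith [hqI.2]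
  rw [Finset.sum_sub_distrib, ← hsum] at hfirst
  rw [hfil, ← intervalIntegral.integral_add_adjacent_intervals (hint _ h0I _ hqI)
    (hint _ hqI _ ht)]
  rw [abs_le] at *
  constructor <;> linarith

end Riemann

section PathConstruction

variable {T : ℝ} {𝕋 : PartitionSeq T} {d : ℕ}

/-- Boundary term in the comparison of the two types of covariation sums. -/
lemma abs_covSum_sub_stepCov_le {S : ℝ → Fin d → ℝ} {n : ℕ} {ε : ℝ} (hε : 0 ≤ ε)
    (hS : ∀ s ∈ 𝕋.part n, ∀ i, |S (succOf T (𝕋.part n) s) i - S s i| ≤ ε) (i j : Fin d)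
    {t : ℝ} (ht : t ∈ Icc 0 T) :
    |covSum T 𝕋 S i j t n - stepCov (𝕋.part n) S i j 0 t| ≤ ε * ε := by
  obtain ⟨q, hq, hqt, hqmax, htq⟩ := 𝕋.exists_last n ht
  have h0 := 𝕋.zero_mem n
  have hq0 := 𝕋.nonneg_of_mem q hq
  have e1 : (𝕋.part n).filter (fun a => 0 < a ∧ a ≤ t)
      = (𝕋.part n).filter (fun a => 0 < a ∧ a ≤ q) := by
    refine Finset.filter_congr fun x hx => and_congr_right fun _ => ?_
    exact ⟨hqmax x hx, fun h => h.trans hqt⟩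
  have e2 : (𝕋.part n).filter (fun s => s ≤ t)
      = insert q ((𝕋.part n).filter (fun s => 0 ≤ s ∧ s < q)) := by
    ext x
    rw [Finset.mem_insert, Finset.mem_filter, Finset.mem_filter]
    constructor
    · rintro ⟨h1, h2⟩
      exact (hqmax x h1 h2).eq_or_lt.imp_right fun h => ⟨h1, 𝕋.nonneg_of_mem x h1, h⟩
    · rintro (rfl | ⟨h1, h2, h3⟩)
      · exact ⟨hq, hqt⟩
      · exact ⟨h1, h3.le.trans hqt⟩
  have e3 := sum_succOf_eq_sum_predOf h0 𝕋.nonneg_of_mem (𝕋.top_mem n) 𝕋.le_of_mem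
    (fun x y => (S y i - S x i) * (S y j - S x j)) le_rfl (𝕋.le_of_mem q hq) h0 hq
  unfold covSum stepCov
  rw [e1, ← e3, e2, Finset.sum_insert (by simp), add_sub_cancel_right, abs_mul]
  exact mul_le_mul (hS q hq i) (hS q hq j) (abs_nonneg _) hε

/-- The target covariations of the next refinement step. -/
def cellTarget (𝕋 : PartitionSeq T) (α : ℝ → (Fin d → ℝ) → Fin d → Fin d → ℝ) (N : ℕ)
    (S : ℝ → Fin d → ℝ) (a : ℝ) (i j : Fin d) : ℝ :=
  (a - predOf (𝕋.part N) a) * α (predOf (𝕋.part N) a) (S (predOf (𝕋.part N) a)) i j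

/-- The properties of the `k`-th step path in the construction. -/
structure IsApprox (𝕋 : PartitionSeq T) (x₀ : Fin d → ℝ) (ρ : ℝ) (k : ℕ) (N : ℕ)
    (S : ℝ → Fin d → ℝ) : Prop where
  le : k ≤ N
  mesh : ∀ s ∈ 𝕋.part N, succOf T (𝕋.part N) s - s < (1 / 2) ^ k
  step : IsStepOn (𝕋.part N) S
  jump : ∀ a ∈ 𝕋.part N, 0 < a → ∀ i,
    |S a i - S (predOf (𝕋.part N) a) i| ≤ ρ / 4 * (1 / 2) ^ k
  near : ∀ t i, |S t i - x₀ i| ≤ ρ * (1 - (1 / 2) ^ k)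

/-- The tolerance of the `k`-th refinement step. -/
def tol (𝕋 : PartitionSeq T) (ρ : ℝ) (k N : ℕ) : ℝ :=
  min (ρ / 4 * (1 / 2) ^ (k + 1)) ((1 / 2) ^ k / (𝕋.part N).card)

lemma card_part_pos (𝕋 : PartitionSeq T) (N : ℕ) : (0 : ℝ) < (𝕋.part N).card := by
  exact_mod_cast Finset.card_pos.2 ⟨0, 𝕋.zero_mem N⟩

lemma tol_pos {ρ : ℝ} (hρ : 0 < ρ) (k N : ℕ) : 0 < tol 𝕋 ρ k N :=
  lt_min (by positivity) (div_pos (by positivity) (card_part_pos 𝕋 N))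

lemma card_mul_tol_le (ρ : ℝ) (k N : ℕ) : (𝕋.part N).card * tol 𝕋 ρ k N ≤ (1 / 2) ^ k := by
  have := min_le_right (ρ / 4 * (1 / 2) ^ (k + 1)) ((1 / 2) ^ k / ((𝕋.part N).card : ℝ))
  rw [le_div_iff₀ (card_part_pos 𝕋 N)] at this
  rw [mul_comm]
  exact this

variable {α : ℝ → (Fin d → ℝ) → Fin d → Fin d → ℝ} {x₀ : Fin d → ℝ} {ρ : ℝ}

lemma IsApprox.mem_closedBall {k N : ℕ} {S : ℝ → Fin d → ℝ} (h : IsApprox 𝕋 x₀ ρ k N S)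
    (hρ : 0 < ρ) (t : ℝ) : S t ∈ Metric.closedBall x₀ ρ := by
  rw [Metric.mem_closedBall, dist_pi_le_iff hρ.le]
  intro i
  refine (h.near t i).trans ?_
  have : (0 : ℝ) ≤ (1 / 2) ^ k := by positivity
  nlinarith

lemma IsApprox.exists_next {k N : ℕ} {S : ℝ → Fin d → ℝ} (h : IsApprox 𝕋 x₀ ρ k N S)
    (hρ : 0 < ρ)
    (hsymm : ∀ t ∈ Icc 0 T, ∀ x ∈ Metric.closedBall x₀ ρ, ∀ i j, α t x i j = α t x j i)
    (hpos : ∀ t ∈ Icc 0 T, ∀ x ∈ Metric.closedBall x₀ ρ, ∀ y : Fin d → ℝ,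
      0 ≤ ∑ i, ∑ j, α t x i j * y i * y j) :
    ∃ N' S', IsApprox 𝕋 x₀ ρ (k + 1) N' S' ∧
      RefinesOn 𝕋 N S (cellTarget 𝕋 α N S) (ρ / 4 * (1 / 2) ^ k) (tol 𝕋 ρ k N)
        ((𝕋.part N).filter (fun x => 0 < x)) N' S' := by
  obtain ⟨M, hM⟩ := 𝕋.mesh_to_zero ((1 / 2) ^ (k + 1)) (by positivity)
  have hδ := tol_pos (𝕋 := 𝕋) hρ k N
  have hQ : ∀ a ∈ 𝕋.part N, 0 < a → HasSmallDecomposition (cellTarget 𝕋 α N S a) := by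
    intro a ha ha0
    have h0 := 𝕋.zero_mem N
    have hp := 𝕋.subset_Icc N (predOf_mem h0 a)
    have hlt := predOf_lt h0 ha0
    refine hasSmallDecomposition_of_posSemidef (fun i j => ?_) fun y => ?_
    · unfold cellTarget
      rw [hsymm _ hp _ (h.mem_closedBall hρ _)]
    · have := mul_nonneg (sub_pos.2 hlt).le
        (hpos _ hp _ (h.mem_closedBall hρ (predOf (𝕋.part N) a)) y)
      refine this.trans_eq ?_
      simp only [Finset.mul_sum, cellTarget, mul_assoc]
  obtain ⟨N', hN', S', hR⟩ := exists_refinesOn h.step h.jump hδ hQ (max M (k + 1))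
  refine ⟨N', S', ⟨(le_max_right _ _).trans hN', hM N' ((le_max_left _ _).trans hN'), hR.step,
    fun a ha ha0 i => (hR.jump_le ha ha0 i).trans (min_le_left _ _), fun t i => ?_⟩, hR⟩
  have h1 := hR.abs_sub_le h.step (by positivity) hδ.le t i
  have h2 := h.near t i
  have h3 : tol 𝕋 ρ k N ≤ _ := min_le_left (ρ / 4 * (1 / 2) ^ (k + 1)) _
  have h4 : (0 : ℝ) ≤ ρ * (1 / 2) ^ k := by positivity
  have h5 : |S' t i - x₀ i| ≤ |S' t i - S t i| + |S t i - x₀ i| := abs_sub_le _ _ _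
  rw [pow_succ] at h3 ⊢
  linarith

lemma exists_approx_seq (hρ : 0 < ρ)
    (hsymm : ∀ t ∈ Icc 0 T, ∀ x ∈ Metric.closedBall x₀ ρ, ∀ i j, α t x i j = α t x j i)
    (hpos : ∀ t ∈ Icc 0 T, ∀ x ∈ Metric.closedBall x₀ ρ, ∀ y : Fin d → ℝ,
      0 ≤ ∑ i, ∑ j, α t x i j * y i * y j) :
    ∃ (N : ℕ → ℕ) (S : ℕ → ℝ → Fin d → ℝ), ∀ k, IsApprox 𝕋 x₀ ρ k (N k) (S k) ∧
      RefinesOn 𝕋 (N k) (S k) (cellTarget 𝕋 α (N k) (S k)) (ρ / 4 * (1 / 2) ^ k)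
        (tol 𝕋 ρ k (N k)) ((𝕋.part (N k)).filter (fun x => 0 < x)) (N (k + 1)) (S (k + 1)) := by
  obtain ⟨M, hM⟩ := 𝕋.mesh_to_zero ((1 / 2) ^ 0) (by positivity)
  have init : IsApprox 𝕋 x₀ ρ 0 M (fun _ => x₀) :=
    ⟨Nat.zero_le _, hM M le_rfl, fun _ _ _ _ => rfl, fun _ _ _ _ => by simp; positivity,
      fun _ _ => by simp⟩
  have step : ∀ k (p : {p : ℕ × (ℝ → Fin d → ℝ) // IsApprox 𝕋 x₀ ρ k p.1 p.2}),
      ∃ p' : {p : ℕ × (ℝ → Fin d → ℝ) // IsApprox 𝕋 x₀ ρ (k + 1) p.1 p.2},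
        RefinesOn 𝕋 p.1.1 p.1.2 (cellTarget 𝕋 α p.1.1 p.1.2) (ρ / 4 * (1 / 2) ^ k)
          (tol 𝕋 ρ k p.1.1) ((𝕋.part p.1.1).filter (fun x => 0 < x)) p'.1.1 p'.1.2 := by
    intro k p
    obtain ⟨N', S', h1, h2⟩ := p.2.exists_next hρ hsymm hpos
    exact ⟨⟨(N', S'), h1⟩, h2⟩
  choose g hg using step
  let f : (k : ℕ) → {p : ℕ × (ℝ → Fin d → ℝ) // IsApprox 𝕋 x₀ ρ k p.1 p.2} :=
    fun k => Nat.rec ⟨(M, fun _ => x₀), init⟩ (fun k p => g k p) k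
  exact ⟨fun k => (f k).1.1, fun k => (f k).1.2, fun k => ⟨(f k).2, hg k (f k)⟩⟩

/-- Step paths with small jumps are nearly continuous. -/
lemma IsStepOn.eventually_abs_sub_le {N : ℕ} {S : ℝ → Fin d → ℝ} (hS : IsStepOn (𝕋.part N) S)
    {ε : ℝ} (hε : 0 ≤ ε)
    (hjump : ∀ a ∈ 𝕋.part N, 0 < a → ∀ i, |S a i - S (predOf (𝕋.part N) a) i| ≤ ε)
    {t : ℝ} (ht : t ∈ Icc 0 T) : ∀ᶠ s in 𝓝[Icc 0 T] t, ∀ i, |S s i - S t i| ≤ ε := by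
  have h0 := 𝕋.zero_mem N
  have hT := 𝕋.top_mem N
  have h1 : ∀ᶠ s in 𝓝[Icc 0 T] t, t < s → s < succOf T (𝕋.part N) t := by
    rcases ht.2.eq_or_lt with rfl | h
    · filter_upwards [self_mem_nhdsWithin] with s hs h
      exact absurd h (not_lt.2 hs.2)
    · filter_upwards [nhdsWithin_le_nhds (Iio_mem_nhds (lt_succOf hT h))] with s hs _ using hs
  have h2 : ∀ᶠ s in 𝓝[Icc 0 T] t, s < t → predOf (𝕋.part N) t < s := by
    rcases ht.1.eq_or_lt with rfl | h
    · filter_upwards [self_mem_nhdsWithin] with s hs h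
      exact absurd h (not_lt.2 hs.1)
    · filter_upwards [nhdsWithin_le_nhds (Ioi_mem_nhds (predOf_lt h0 h))] with s hs _ using hs
  filter_upwards [h1, h2, self_mem_nhdsWithin] with s hs1 hs2 hsI i
  rcases lt_trichotomy s t with h | rfl | h
  · have ht0 : 0 < t := hsI.1.trans_lt h
    have e1 : S (predOf (𝕋.part N) t) = S s := by
      refine hS _ _ (hs2 h).le ?_
      rintro x hx ⟨h3, h4⟩
      linarith [le_predOf hx (h4.trans_lt h)]
    rw [← e1]
    by_cases htP : t ∈ 𝕋.part N
    · rw [abs_sub_comm]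
      exact hjump t htP ht0 i
    · rw [hS.eq_predOf_of_notMem h0 subset_rfl htP ht0, sub_self, abs_zero]
      exact hε
  · rw [sub_self, abs_zero]
    exact hε
  · have e1 : S t = S s := by
      refine hS _ _ h.le ?_
      rintro x hx ⟨h3, h4⟩
      linarith [succOf_le (T := T) hx h3, hs1 h]
    rw [e1, sub_self, abs_zero]
    exact hε

end PathConstruction

section PathLimit

variable {T : ℝ} {𝕋 : PartitionSeq T} {d : ℕ}
variable {α : ℝ → (Fin d → ℝ) → Fin d → Fin d → ℝ} {x₀ : Fin d → ℝ} {ρ : ℝ}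

/-- The limit of the step paths. -/
lemma exists_limit_path (hρ : 0 < ρ)
    (hsymm : ∀ t ∈ Icc 0 T, ∀ x ∈ Metric.closedBall x₀ ρ, ∀ i j, α t x i j = α t x j i)
    (hpos : ∀ t ∈ Icc 0 T, ∀ x ∈ Metric.closedBall x₀ ρ, ∀ y : Fin d → ℝ,
      0 ≤ ∑ i, ∑ j, α t x i j * y i * y j) :
    ∃ (N : ℕ → ℕ) (S : ℕ → ℝ → Fin d → ℝ) (S' : ℝ → Fin d → ℝ), (∀ k,
      IsApprox 𝕋 x₀ ρ k (N k) (S k) ∧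
      RefinesOn 𝕋 (N k) (S k) (cellTarget 𝕋 α (N k) (S k)) (ρ / 4 * (1 / 2) ^ k)
        (tol 𝕋 ρ k (N k)) ((𝕋.part (N k)).filter (fun x => 0 < x)) (N (k + 1)) (S (k + 1))) ∧
      ContinuousOn S' (Icc 0 T) ∧ (∀ t, S' t ∈ Metric.closedBall x₀ ρ) ∧
      ∀ k, ∀ t ∈ 𝕋.part (N k), S' t = S k t := by
  obtain ⟨N, S, hS⟩ := exists_approx_seq (𝕋 := 𝕋) hρ hsymm hpos
  have hdist : ∀ t k, dist (S k t) (S (k + 1) t) ≤ ρ / 2 * (1 / 2) ^ k := by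
    intro t k
    rw [dist_comm, dist_pi_le_iff (by positivity)]
    intro i
    have h1 := (hS k).2.abs_sub_le (hS k).1.step (by positivity) (tol_pos hρ k (N k)).le t i
    have h2 : tol 𝕋 ρ k (N k) ≤ _ := min_le_left (ρ / 4 * (1 / 2) ^ (k + 1)) _
    have h3 : (0 : ℝ) ≤ ρ * (1 / 2) ^ k := by positivity
    rw [Real.dist_eq]
    rw [pow_succ] at h2
    linarith
  have hlim : ∀ t, ∃ y, Tendsto (fun k => S k t) atTop (𝓝 y) := fun t =>
    cauchySeq_tendsto_of_complete (cauchySeq_of_le_geometric (1 / 2) (ρ / 2) (by norm_num)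
      (hdist t))
  choose S' hS' using hlim
  have hclose : ∀ k t, dist (S k t) (S' t) ≤ ρ * (1 / 2) ^ k := by
    intro k t
    have := dist_le_of_le_geometric_of_tendsto (1 / 2) (ρ / 2) (by norm_num) (hdist t) (hS' t) k
    refine this.trans_eq ?_
    ring
  refine ⟨N, S, S', hS, ?_, fun t => ?_, ?_⟩
  · intro t ht
    rw [ContinuousWithinAt, Metric.tendsto_nhds]
    intro ε hε
    obtain ⟨k, hk⟩ := exists_pow_lt_of_lt_one (show 0 < ε / (4 * ρ) by positivity)
      (show (1 / 2 : ℝ) < 1 by norm_num)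
    rw [lt_div_iff₀ (by positivity)] at hk
    have h1 := (hS k).1.step.eventually_abs_sub_le (by positivity) (hS k).1.jump ht
    filter_upwards [h1] with s hs
    have h2 : dist (S k s) (S k t) ≤ ρ / 4 * (1 / 2) ^ k :=
      (dist_pi_le_iff (by positivity)).2 hs
    have h3 := hclose k s
    have h4 := hclose k t
    have h5 := dist_triangle4 (S' s) (S k s) (S k t) (S' t)
    rw [dist_comm (S' s) (S k s)] at h5
    have h6 : (0 : ℝ) < ρ * (1 / 2) ^ k := by positivity
    linarith
  · exact Metric.isClosed_closedBall.mem_of_tendsto (hS' t)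
      (Eventually.of_forall fun k => (hS k).1.mem_closedBall hρ t)
  · intro k t ht
    have hN : ∀ m ≥ k, N k ≤ N m := fun m hm =>
      Nat.le_induction le_rfl (fun m _ ih => ih.trans (hS m).2.le) m hm
    have hconst : ∀ m ≥ k, S m t = S k t := fun m hm =>
      Nat.le_induction rfl (fun m hm ih => by
        rw [(hS m).2.eq_of_mem (𝕋.part_mono (hN m hm) ht), ih]) m hm
    exact tendsto_nhds_unique (hS' t)
      (tendsto_atTop_of_eventually_const (i₀ := k) hconst)

/-- Existence of paths with prescribed local covariance that stay near a given point. -/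
theorem exists_path (hρ : 0 < ρ)
    (hcont : ∀ i j, ContinuousOn (fun p : ℝ × (Fin d → ℝ) => α p.1 p.2 i j)
      (Icc 0 T ×ˢ Metric.closedBall x₀ ρ))
    (hsymm : ∀ t ∈ Icc 0 T, ∀ x ∈ Metric.closedBall x₀ ρ, ∀ i j, α t x i j = α t x j i)
    (hpos : ∀ t ∈ Icc 0 T, ∀ x ∈ Metric.closedBall x₀ ρ, ∀ y : Fin d → ℝ,
      0 ≤ ∑ i, ∑ j, α t x i j * y i * y j) :
    ∃ S : ℝ → Fin d → ℝ, ContinuousOn S (Icc 0 T) ∧ (∀ t, S t ∈ Metric.closedBall x₀ ρ) ∧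
      ∀ i j, ∀ t ∈ Icc 0 T, Tendsto (fun n => covSum T 𝕋 S i j t n) atTop
        (𝓝 (∫ s in (0 : ℝ)..t, α s (S s) i j)) := by
  obtain ⟨N, S, S', hS, hS'c, hS'b, hS'eq⟩ := exists_limit_path (𝕋 := 𝕋) hρ hsymm hpos
  refine ⟨S', hS'c, hS'b, ?_⟩
  have hT : 0 ≤ T := 𝕋.nonneg_of_mem T (𝕋.top_mem 0)
  have hgc : ∀ i j, ContinuousOn (fun s => α s (S' s) i j) (Icc 0 T) := fun i j =>
    (hcont i j).comp (continuousOn_id.prodMk hS'c) fun s hs => ⟨hs, hS'b s⟩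
  obtain ⟨C, hC0, hC⟩ : ∃ C : ℝ, 0 ≤ C ∧ ∀ i j, ∀ s ∈ Icc 0 T, |α s (S' s) i j| ≤ C := by
    have h1 : ∀ i j, ∃ C : ℝ, ∀ s ∈ Icc 0 T, |α s (S' s) i j| ≤ C := fun i j =>
      isCompact_Icc.exists_bound_of_continuousOn (hgc i j)
    choose c hc using h1
    have h2 : ∀ i j, 0 ≤ c i j := fun i j => (abs_nonneg _).trans (hc i j 0 ⟨le_rfl, hT⟩)
    refine ⟨∑ i, ∑ j, c i j, Finset.sum_nonneg fun i _ => Finset.sum_nonneg fun j _ => h2 i j,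
      fun i j s hs => (hc i j s hs).trans ?_⟩
    refine (Finset.single_le_sum (f := fun j => c i j) (fun j _ => h2 i j)
      (Finset.mem_univ j)).trans ?_
    exact Finset.single_le_sum (f := fun i => ∑ j, c i j)
      (fun i _ => Finset.sum_nonneg fun j _ => h2 i j) (Finset.mem_univ i)
  have hNk : ∀ k, k ≤ N k := fun k => (hS k).1.le
  -- the targets are bounded
  have hq : ∀ k, ∀ a ∈ 𝕋.part (N k), 0 < a → ∀ i j,
      |cellTarget 𝕋 α (N k) (S k) a i j| ≤ C * (1 / 2) ^ k := by
    intro k a ha ha0 i j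
    have hp := predOf_mem (𝕋.zero_mem (N k)) a
    have h1 := hC i j _ (𝕋.subset_Icc _ hp)
    have h2 := predOf_lt (𝕋.zero_mem (N k)) ha0
    have h3 := 𝕋.sub_predOf_lt_of_mesh (hS k).1.mesh ha ha0
    rw [cellTarget, ← hS'eq k _ hp, abs_mul, abs_of_pos (sub_pos.2 h2), mul_comm]
    exact mul_le_mul h1 h3.le (sub_pos.2 h2).le hC0
  intro i j t ht
  -- Riemann sums
  have hR : ∀ ε > 0, ∀ᶠ k in atTop, ∀ t ∈ Icc 0 T,
      |∑ a ∈ (𝕋.part (N k)).filter (fun a => 0 < a ∧ a ≤ t), cellTarget 𝕋 α (N k) (S k) a i j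
        - ∫ s in (0 : ℝ)..t, α s (S' s) i j| ≤ ε := by
    intro ε hε
    obtain ⟨η, hη, h⟩ := 𝕋.exists_riemann (hgc i j) hε
    filter_upwards [(tendsto_order.1 (tendsto_pow_atTop_nhds_zero_of_lt_one
      (show (0 : ℝ) ≤ 1 / 2 by norm_num) (by norm_num))).2 η hη] with k hk t ht
    rw [Finset.sum_congr rfl fun a _ => ?_]
    · exact h (N k) (fun s hs => ((hS k).1.mesh s hs).trans hk) t ht
    · rw [cellTarget, ← hS'eq k _ (predOf_mem (𝕋.zero_mem (N k)) a)]
  set V : ℝ → ℝ := fun t => ∫ s in (0 : ℝ)..t, α s (S' s) i j with hV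
  have hgeo : ∀ c : ℝ, ∀ ε > 0, ∀ᶠ k in atTop, c * (1 / 2) ^ k < ε := by
    intro c ε hε
    have : Tendsto (fun k : ℕ => c * (1 / 2 : ℝ) ^ k) atTop (𝓝 (c * 0)) :=
      (tendsto_pow_atTop_nhds_zero_of_lt_one (by norm_num) (by norm_num)).const_mul c
    rw [mul_zero] at this
    exact (tendsto_order.1 this).2 ε hε
  have htol : ∀ k, tol 𝕋 ρ k (N k) ≤ (1 / 2) ^ k := by
    intro k
    have h1 := card_mul_tol_le (𝕋 := 𝕋) ρ k (N k)
    have h2 : (1 : ℝ) ≤ (𝕋.part (N k)).card := by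
      exact_mod_cast Finset.card_pos.2 ⟨0, 𝕋.zero_mem (N k)⟩
    exact (le_mul_of_one_le_left (tol_pos hρ k (N k)).le h2).trans h1
  -- covariations of the step paths along their own partition
  have hA : ∀ ε > 0, ∀ᶠ k in atTop, ∀ t ∈ Icc 0 T,
      |stepCov (𝕋.part (N k)) (S k) i j 0 t - V t| ≤ ε := by
    intro ε hε
    rw [← map_add_atTop_eq_nat 1, eventually_map]
    filter_upwards [hR (ε / 2) (by positivity), hgeo (2 + C) (ε / 2) (by positivity)]
      with k h1 h2 t ht
    have h3 := (hS k).2.abs_stepCov_sub_le (tol_pos hρ k (N k)).le (hq k)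
      (by positivity) i j ht
    have h4 := card_mul_tol_le (𝕋 := 𝕋) ρ k (N k)
    have h5 := htol k
    have h6 := h1 t ht
    have h7 := abs_sub_le (stepCov (𝕋.part (N (k + 1))) (S (k + 1)) i j 0 t) _ _ |>.trans
      (add_le_add h3 h6)
    linarith
  -- covariations of the limit along the partitions
  have hB : ∀ ε > 0, ∀ᶠ k in atTop, ∀ n, N k ≤ n → n ≤ N (k + 1) →
      |stepCov (𝕋.part n) S' i j 0 t - V t| ≤ ε := by
    intro ε hε
    filter_upwards [hR (ε / 8) (by positivity), hA (ε / 8) (by positivity),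
      hgeo (3 + 9 * C) (ε / 8) (by positivity), hgeo (4 * (ρ / 4) ^ 2) (ε / 8) (by positivity)]
      with k h1 h2 h3 h4 n hn hn'
    obtain ⟨c, hc, hcov⟩ := (hS k).2.exists_abs_stepCov_sub_le (hS k).1.step (hS k).1.jump
      (tol_pos hρ k (N k)).le (hq k) (by positivity) hn hn'
    have h5 := hcov i j t ht
    have h6 := card_mul_tol_le (𝕋 := 𝕋) ρ k (N k)
    have h7 := htol k
    have h8 : ((1 / 2 : ℝ) ^ k) ^ 2 ≤ (1 / 2) ^ k := by
      rw [sq]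
      exact mul_le_of_le_one_left (by positivity) (pow_le_one₀ (by norm_num) (by norm_num))
    have h9 : stepCov (𝕋.part n) (S (k + 1)) i j 0 t = stepCov (𝕋.part n) S' i j 0 t :=
      stepCov_congr (𝕋.zero_mem n) i j
        (fun x hx _ _ => (hS'eq (k + 1) x (𝕋.part_mono hn' hx)).symm) le_rfl (𝕋.zero_mem n)
    have hmin : min t c ∈ Icc 0 T := ⟨le_min ht.1 hc.1, (min_le_left _ _).trans ht.2⟩
    have h10 := h1 (min t c) hmin
    have h11 : |stepCov (𝕋.part (N k)) (S k) i j c t - (V t - V (min t c))| ≤ ε / 4 := by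
      rcases le_total c t with hct | hct
      · rw [min_eq_right hct]
        have e1 := h2 t ht
        have e2 := h2 c hc
        rw [← stepCov_add i j hc.1 hct] at e1
        rw [abs_le] at *
        constructor <;> linarith
      · rw [min_eq_left hct, stepCov_of_le i j hct, sub_self, sub_self, abs_zero]
        positivity
    rw [h9] at h5
    have h12 : 2 * (2 * (ρ / 4 * (1 / 2) ^ k) ^ 2) ≤ 4 * (ρ / 4) ^ 2 * (1 / 2) ^ k := by
      have := mul_le_mul_of_nonneg_left h8 (show 0 ≤ 4 * (ρ / 4) ^ 2 by positivity)
      refine le_trans (le_of_eq ?_) this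
      ring
    rw [abs_le] at h5 h10 h11 ⊢
    constructor <;> linarith
  have hosc : ∀ ε > 0, ∀ᶠ n in atTop, |covSum T 𝕋 S' i j t n - stepCov (𝕋.part n) S' i j 0 t|
      ≤ ε := by
    intro ε hε
    have hu := isCompact_Icc.uniformContinuousOn_of_continuous hS'c
    rw [Metric.uniformContinuousOn_iff_le] at hu
    obtain ⟨η, hη, hω⟩ := hu (√ε) (Real.sqrt_pos.2 hε)
    filter_upwards [𝕋.eventually_mesh hη] with n hn
    rw [← Real.mul_self_sqrt hε.le]
    refine abs_covSum_sub_stepCov_le (Real.sqrt_nonneg _) (fun s hs i => ?_) i j ht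
    have h1 := le_succOf (𝕋.top_mem n) (𝕋.le_of_mem s hs)
    refine (dist_le_pi_dist _ _ i).trans (hω _ (𝕋.subset_Icc n (succOf_mem (𝕋.top_mem n) s)) _
      (𝕋.subset_Icc n hs) ?_)
    rw [Real.dist_eq, abs_of_nonneg (sub_nonneg.2 h1)]
    exact (hn s hs).le
  rw [Metric.tendsto_atTop]
  intro ε hε
  obtain ⟨k₀, hk₀⟩ := eventually_atTop.1 (hB (ε / 3) (by positivity))
  obtain ⟨n₀, hn₀⟩ := eventually_atTop.1 (hosc (ε / 3) (by positivity))
  refine ⟨max n₀ (N k₀), fun n hn => ?_⟩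
  have hnk : N k₀ ≤ n := (le_max_right _ _).trans hn
  set k := Nat.findGreatest (fun k => N k ≤ n) n with hk
  have h1 : N k ≤ n := Nat.findGreatest_spec (P := fun k => N k ≤ n) ((hNk k₀).trans hnk) hnk
  have h2 : k₀ ≤ k := Nat.le_findGreatest ((hNk k₀).trans hnk) hnk
  have h3 : n ≤ N (k + 1) := by
    by_contra! h
    have := Nat.le_findGreatest (P := fun k => N k ≤ n) ((hNk (k + 1)).trans h.le) h.le
    omega
  have h4 := hk₀ k h2 n h1 h3
  have h5 := hn₀ n ((le_max_left _ _).trans hn)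
  rw [Real.dist_eq]
  have h6 := abs_sub_le (covSum T 𝕋 S' i j t n) (stepCov (𝕋.part n) S' i j 0 t) (V t)
  linarith

end PathLimit

section PartitionLimits

variable {T : ℝ} {𝕋 : PartitionSeq T} {r u : ℝ}

namespace PartitionSeq

/-- The increment of `F` over the interval of the `n`-th partition starting at `s`. -/
def incr (𝕋 : PartitionSeq T) (F : ℝ → ℝ) (n : ℕ) (s : ℝ) : ℝ :=
  F (succOf T (𝕋.part n) s) - F s

/-- The terms `m n s`, `s ∈ [r,u]`, become uniformly small. -/
def NullTerms (𝕋 : PartitionSeq T) (r u : ℝ) (m : ℕ → ℝ → ℝ) : Prop :=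
  ∀ ε > 0, ∀ᶠ n in atTop, ∀ s ∈ 𝕋.part n, r ≤ s → s ≤ u → |m n s| ≤ ε

lemma eventually_abs_incr_le {F : ℝ → ℝ} (hF : ContinuousOn F (Icc 0 T)) {ε : ℝ} (hε : 0 < ε) :
    ∀ᶠ n in atTop, ∀ s ∈ 𝕋.part n, |𝕋.incr F n s| ≤ ε := by
  obtain ⟨δ, hδ, h⟩ := Metric.uniformContinuousOn_iff_le.1
    (isCompact_Icc.uniformContinuousOn_of_continuous hF) ε hε
  filter_upwards [𝕋.eventually_mesh hδ] with n hn s hs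
  have h1 := le_succOf (𝕋.top_mem n) (𝕋.le_of_mem s hs)
  refine h _ (𝕋.subset_Icc n (succOf_mem (𝕋.top_mem n) s)) _ (𝕋.subset_Icc n hs) ?_
  rw [Real.dist_eq, abs_of_nonneg (by linarith)]
  exact (hn s hs).le

lemma nullTerms_incr {F : ℝ → ℝ} (hF : ContinuousOn F (Icc 0 T)) :
    𝕋.NullTerms r u (𝕋.incr F) := fun _ hε => by
  filter_upwards [eventually_abs_incr_le hF hε] with n hn s hs _ _ using hn s hs

lemma NullTerms.mul {m m' : ℕ → ℝ → ℝ} (h : 𝕋.NullTerms r u m) (h' : 𝕋.NullTerms r u m') :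
    𝕋.NullTerms r u (fun n s => m n s * m' n s) := fun ε hε => by
  filter_upwards [h ε hε, h' 1 one_pos] with n h1 h2 s hs hr hu
  rw [abs_mul]
  have := h1 s hs hr hu
  have := h2 s hs hr hu
  nlinarith [abs_nonneg (m n s), abs_nonneg (m' n s)]

lemma NullTerms.mul_left {m : ℕ → ℝ → ℝ} (h : 𝕋.NullTerms r u m) {g : ℝ → ℝ}
    (hg : ContinuousOn g (Icc r u)) : 𝕋.NullTerms r u (fun n s => g s * m n s) := fun ε hε => by
  obtain ⟨C, hC⟩ := isCompact_Icc.exists_bound_of_continuousOn hg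
  filter_upwards [h (ε / (|C| + 1)) (by positivity)] with n h1 s hs hr hu
  rw [abs_mul]
  have h2 := h1 s hs hr hu
  rw [le_div_iff₀ (by positivity)] at h2
  have h3 : |g s| ≤ C := hC s ⟨hr, hu⟩
  have := le_abs_self C
  nlinarith [abs_nonneg (m n s), abs_nonneg (g s)]

lemma NullTerms.sum {ι : Type*} (A : Finset ι) {m : ι → ℕ → ℝ → ℝ}
    (h : ∀ i ∈ A, 𝕋.NullTerms r u (m i)) :
    𝕋.NullTerms r u (fun n s => ∑ i ∈ A, m i n s) := fun ε hε => by
  have h1 := (eventually_all_finset A).2 fun i hi => h i hi (ε / (A.card + 1)) (by positivity)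
  filter_upwards [h1] with n hn s hs hr hu
  refine (abs_sum_le_sum_abs _ _).trans
    ((Finset.sum_le_sum fun i hi => hn i hi s hs hr hu).trans ?_)
  rw [Finset.sum_const, nsmul_eq_mul, mul_div_assoc', div_le_iff₀ (by positivity)]
  nlinarith

lemma NullTerms.mono {m : ℕ → ℝ → ℝ} (h : 𝕋.NullTerms r u m) {p q : ℝ} (hp : r ≤ p) (hq : q ≤ u) :
    𝕋.NullTerms p q m := fun ε hε => by
  filter_upwards [h ε hε] with n hn s hs h1 h2 using hn s hs (hp.trans h1) (h2.trans hq)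

/-- Sums of increments up to time `t` converge to the total increment. -/
lemma tendsto_sum_incr {F : ℝ → ℝ} (hF : ContinuousOn F (Icc 0 T)) {t : ℝ} (ht : t ∈ Icc 0 T) :
    Tendsto (fun n => ∑ s ∈ (𝕋.part n).filter (fun s => s ≤ t), 𝕋.incr F n s) atTop
      (𝓝 (F t - F 0)) := by
  rw [Metric.tendsto_atTop']
  intro ε hε
  obtain ⟨δ, hδ, h⟩ := Metric.uniformContinuousOn_iff.1
    (isCompact_Icc.uniformContinuousOn_of_continuous hF) ε hε
  obtain ⟨N, hN⟩ := eventually_atTop.1 (𝕋.eventually_mesh hδ)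
  refine ⟨N, fun n hn => ?_⟩
  obtain ⟨q, hq, hqt, hlast, htq⟩ := 𝕋.exists_last n ht
  have hmem := succOf_mem (𝕋.top_mem n) q
  have hsum : ∑ s ∈ (𝕋.part n).filter (fun s => s ≤ t), 𝕋.incr F n s
      = F (succOf T (𝕋.part n) q) - F 0 := by
    rw [← 𝕋.telescope_succ F (𝕋.zero_mem n) hmem (𝕋.nonneg_of_mem _ hmem)]
    symm
    refine Finset.sum_subset_zero_on_sdiff ?_ ?_ (fun _ _ => rfl)
    · intro s hs
      rw [Finset.mem_filter] at hs ⊢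
      refine ⟨hs.1, ?_⟩
      by_contra hst
      push Not at hst
      exact absurd (succOf_le (T := T) hs.1 (hqt.trans_lt hst)) (not_le.2 hs.2.2)
    · intro s hs
      simp only [Finset.mem_sdiff, Finset.mem_filter, not_and, not_lt] at hs
      have h1 := hs.2 hs.1.1 (𝕋.nonneg_of_mem s hs.1.1)
      have h2 := hlast s hs.1.1 hs.1.2
      have h3 := le_succOf (𝕋.top_mem n) (𝕋.le_of_mem q hq)
      have h4 : s = q := le_antisymm h2 (h3.trans h1)
      subst h4
      have h5 : succOf T (𝕋.part n) s = s := le_antisymm h1 h3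
      simp [incr, h5]
  rw [hsum, Real.dist_eq, sub_sub_sub_cancel_right]
  refine h _ (𝕋.subset_Icc n hmem) _ ht ?_
  rw [Real.dist_eq, abs_of_nonneg (by linarith)]
  linarith [hN n hn.le q hq]

lemma sum_Ioc_eq {n : ℕ} (f : ℝ → ℝ) {a b c : ℝ} (hab : a ≤ b) (hbc : b ≤ c) :
    ∑ s ∈ (𝕋.part n).filter (fun s => a < s ∧ s ≤ c), f s
      = ∑ s ∈ (𝕋.part n).filter (fun s => a < s ∧ s ≤ b), f s
        + ∑ s ∈ (𝕋.part n).filter (fun s => b < s ∧ s ≤ c), f s := by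
  rw [← Finset.sum_union]
  · congr 1
    ext s
    simp only [Finset.mem_filter, Finset.mem_union]
    constructor
    · rintro ⟨h1, h2, h3⟩
      rcases le_or_gt s b with h | h
      · exact Or.inl ⟨h1, h2, h⟩
      · exact Or.inr ⟨h1, h, h3⟩
    · rintro (⟨h1, h2, h3⟩ | ⟨h1, h2, h3⟩)
      · exact ⟨h1, h2, h3.trans hbc⟩
      · exact ⟨h1, hab.trans_lt h2, h3⟩
  · rw [Finset.disjoint_left]
    intro s h1 h2
    rw [Finset.mem_filter] at h1 h2
    linarith [h1.2.2, h2.2.1]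

lemma tendsto_sum_Ioc {m : ℕ → ℝ → ℝ} {a b A B : ℝ} (hab : a ≤ b)
    (ha : Tendsto (fun n => ∑ s ∈ (𝕋.part n).filter (fun s => s ≤ a), m n s) atTop (𝓝 A))
    (hb : Tendsto (fun n => ∑ s ∈ (𝕋.part n).filter (fun s => s ≤ b), m n s) atTop (𝓝 B)) :
    Tendsto (fun n => ∑ s ∈ (𝕋.part n).filter (fun s => a < s ∧ s ≤ b), m n s) atTop
      (𝓝 (B - A)) := by
  refine (hb.sub ha).congr fun n => ?_
  rw [sub_eq_iff_eq_add', ← Finset.sum_union]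
  · congr 1
    ext s
    simp only [Finset.mem_filter, Finset.mem_union]
    constructor
    · rintro ⟨h1, h3⟩
      rcases le_or_gt s a with h | h
      · exact Or.inl ⟨h1, h⟩
      · exact Or.inr ⟨h1, h, h3⟩
    · rintro (⟨h1, h2⟩ | ⟨h1, h2, h3⟩)
      · exact ⟨h1, h2.trans hab⟩
      · exact ⟨h1, h3⟩
  · rw [Finset.disjoint_left]
    intro s h1 h2
    rw [Finset.mem_filter] at h1 h2
    linarith [h1.2, h2.2.1]

lemma abs_sum_Icc_sub_le {n : ℕ} (f : ℝ → ℝ) {a b ε : ℝ} (hε : 0 ≤ ε)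
    (h : ∀ s ∈ 𝕋.part n, a ≤ s → s ≤ b → |f s| ≤ ε) :
    |∑ s ∈ (𝕋.part n).filter (fun s => a ≤ s ∧ s ≤ b), f s
      - ∑ s ∈ (𝕋.part n).filter (fun s => a < s ∧ s ≤ b), f s| ≤ ε := by
  have hsub : (𝕋.part n).filter (fun s => a < s ∧ s ≤ b)
      ⊆ (𝕋.part n).filter (fun s => a ≤ s ∧ s ≤ b) :=
    Finset.monotone_filter_right _ fun s _ hs => ⟨hs.1.le, hs.2⟩
  rw [← Finset.sum_sdiff hsub, add_sub_cancel_right]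
  have hsub' : (𝕋.part n).filter (fun s => a ≤ s ∧ s ≤ b)
      \ (𝕋.part n).filter (fun s => a < s ∧ s ≤ b) ⊆ {a} := by
    intro s hs
    simp only [Finset.mem_sdiff, Finset.mem_filter, not_and, not_le] at hs
    rw [Finset.mem_singleton]
    by_contra hne
    have := hs.2 hs.1.1 (lt_of_le_of_ne hs.1.2.1 (Ne.symm hne))
    linarith [hs.1.2.2]
  rcases Finset.subset_singleton_iff.1 hsub' with h0 | h0
  · rw [h0, Finset.sum_empty, abs_zero]; exact hε
  · rw [h0, Finset.sum_singleton]
    have : a ∈ (𝕋.part n).filter (fun s => a ≤ s ∧ s ≤ b)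
      \ (𝕋.part n).filter (fun s => a < s ∧ s ≤ b) := by rw [h0]; simp
    have := Finset.mem_filter.1 (Finset.mem_sdiff.1 this).1
    exact h a this.1 this.2.1 this.2.2

lemma tendsto_sum_Icc_iff {m : ℕ → ℝ → ℝ} {a b A : ℝ} (hm : 𝕋.NullTerms a b m) :
    Tendsto (fun n => ∑ s ∈ (𝕋.part n).filter (fun s => a ≤ s ∧ s ≤ b), m n s) atTop (𝓝 A) ↔
    Tendsto (fun n => ∑ s ∈ (𝕋.part n).filter (fun s => a < s ∧ s ≤ b), m n s) atTop (𝓝 A) := by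
  have key : Tendsto (fun n => ∑ s ∈ (𝕋.part n).filter (fun s => a ≤ s ∧ s ≤ b), m n s
      - ∑ s ∈ (𝕋.part n).filter (fun s => a < s ∧ s ≤ b), m n s) atTop (𝓝 0) := by
    rw [Metric.tendsto_nhds]
    intro ε hε
    filter_upwards [hm (ε / 2) (by positivity)] with n hn
    rw [Real.dist_eq, sub_zero]
    exact (abs_sum_Icc_sub_le _ (by positivity) hn).trans_lt (by linarith)
  constructor
  · intro h
    simpa using h.sub key
  · intro h
    simpa using h.add key

/-- Sums over the partition intervals contained in `[a,b]` have the same limit. -/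
lemma tendsto_sum_inner {m : ℕ → ℝ → ℝ} {a b A : ℝ} (hm : 𝕋.NullTerms a b m)
    (h : Tendsto (fun n => ∑ s ∈ (𝕋.part n).filter (fun s => a ≤ s ∧ s ≤ b), m n s) atTop (𝓝 A)) :
    Tendsto (fun n => ∑ s ∈ (𝕋.part n).filter (fun s => a ≤ s ∧ succOf T (𝕋.part n) s ≤ b), m n s)
      atTop (𝓝 A) := by
  have key : Tendsto (fun n => ∑ s ∈ (𝕋.part n).filter (fun s => a ≤ s ∧ s ≤ b), m n s
      - ∑ s ∈ (𝕋.part n).filter (fun s => a ≤ s ∧ succOf T (𝕋.part n) s ≤ b), m n s)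
      atTop (𝓝 0) := by
    rw [Metric.tendsto_nhds]
    intro ε hε
    filter_upwards [hm (ε / 2) (by positivity)] with n hn
    rw [Real.dist_eq, sub_zero]
    have h1 := abs_sum_filter_le_sub_le (𝕋.top_mem n) 𝕋.le_of_mem (r := a) (t := b)
      (fun s => if a ≤ s ∧ s ≤ b then m n s else 0) (ε := ε / 2) (by positivity) (by
        intro s hs
        split_ifs with h
        · exact hn s hs h.1 h.2
        · rw [abs_zero]; positivity)
    refine lt_of_eq_of_lt ?_ (h1.trans_lt (half_lt_self hε))
    congr 2
    · refine Finset.sum_congr rfl fun s hs => (if_pos ?_).symm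
      exact (Finset.mem_filter.1 hs).2
    · refine Finset.sum_congr rfl fun s hs => (if_pos ?_).symm
      rw [Finset.mem_filter] at hs
      exact ⟨hs.2.1, (le_succOf (𝕋.top_mem n) (𝕋.le_of_mem s hs.1)).trans hs.2.2⟩
  simpa using h.sub key

end PartitionSeq

end PartitionLimits

section WeightedLimits

variable {T : ℝ} {𝕋 : PartitionSeq T} {r u : ℝ}

namespace PartitionSeq

/-- Weak convergence of the discrete measures with masses `m n s` to the measure with
density `c`, tested against continuous weights on subintervals. -/
lemma tendsto_sum_mul {m : ℕ → ℝ → ℝ} {M c g : ℝ → ℝ} {K : ℝ}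
    (hM : ∀ t ∈ Icc r u,
      Tendsto (fun n => ∑ s ∈ (𝕋.part n).filter (fun s => s ≤ t), m n s) atTop (𝓝 (M t)))
    (hc : ContinuousOn c (Icc r u))
    (hMc : ∀ a ∈ Icc r u, ∀ b ∈ Icc r u, a ≤ b → M b - M a = ∫ x in a..b, c x)
    (hK : ∀ᶠ n in atTop,
      ∑ s ∈ (𝕋.part n).filter (fun s => r < s ∧ s ≤ u), |m n s| ≤ K)
    (hg : ContinuousOn g (Icc r u)) {t : ℝ} (ht : t ∈ Icc r u) :
    Tendsto (fun n => ∑ s ∈ (𝕋.part n).filter (fun s => r < s ∧ s ≤ t), g s * m n s) atTop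
      (𝓝 (∫ x in r..t, g x * c x)) := by
  obtain ⟨C, hC⟩ := isCompact_Icc.exists_bound_of_continuousOn hc
  have hII : ∀ f : ℝ → ℝ, ContinuousOn f (Icc r u) → ∀ a ∈ Icc r u, ∀ b ∈ Icc r u, a ≤ b →
      IntervalIntegrable f MeasureTheory.volume a b := fun f hf a ha b hb hab =>
    (hf.mono (by rw [uIcc_of_le hab]; exact Icc_subset_Icc ha.1 hb.2)).intervalIntegrable
  -- cell by cell estimate
  have claim : ∀ ε > 0, ∀ δ > 0, (∀ x ∈ Icc r u, ∀ y ∈ Icc r u, dist x y ≤ δ → dist (g x) (g y) ≤ ε)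
      → ∀ k : ℕ, ∀ a ∈ Icc r u, ∀ b ∈ Icc r u, a ≤ b → b ≤ a + k * δ → ∀ η > 0, ∀ᶠ n in atTop,
        |∑ s ∈ (𝕋.part n).filter (fun s => a < s ∧ s ≤ b), g s * m n s - ∫ x in a..b, g x * c x|
          ≤ ε * ∑ s ∈ (𝕋.part n).filter (fun s => a < s ∧ s ≤ b), |m n s|
            + ε * |C| * (b - a) + η := by
    intro ε hε δ hδ huc k
    induction k with
    | zero =>
      intro a ha b hb hab hba η hη
      have : a = b := le_antisymm hab (by simpa using hba)
      subst this
      refine Eventually.of_forall fun n => ?_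
      rw [Finset.filter_false_of_mem (fun s _ h => by linarith [h.1, h.2])]
      simp [hη.le]
    | succ k ih =>
      have cell : ∀ a ∈ Icc r u, ∀ b ∈ Icc r u, a ≤ b → b ≤ a + δ → ∀ η > 0, ∀ᶠ n in atTop,
          |∑ s ∈ (𝕋.part n).filter (fun s => a < s ∧ s ≤ b), g s * m n s
            - ∫ x in a..b, g x * c x|
          ≤ ε * ∑ s ∈ (𝕋.part n).filter (fun s => a < s ∧ s ≤ b), |m n s|
            + ε * |C| * (b - a) + η := by
        intro a ha b hb hab hba η hη
        have h1 := (tendsto_sum_Ioc hab (hM a ha) (hM b hb)).const_mul (g a)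
        rw [hMc a ha b hb hab] at h1
        filter_upwards [Metric.tendsto_nhds.1 h1 η hη] with n hn
        rw [Real.dist_eq] at hn
        have e1 : |∑ s ∈ (𝕋.part n).filter (fun s => a < s ∧ s ≤ b), g s * m n s
            - g a * ∑ s ∈ (𝕋.part n).filter (fun s => a < s ∧ s ≤ b), m n s|
            ≤ ε * ∑ s ∈ (𝕋.part n).filter (fun s => a < s ∧ s ≤ b), |m n s| := by
          rw [Finset.mul_sum, ← Finset.sum_sub_distrib, Finset.mul_sum]
          refine (abs_sum_le_sum_abs _ _).trans (Finset.sum_le_sum fun s hs => ?_)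
          obtain ⟨-, h2, h3⟩ := Finset.mem_filter.1 hs
          rw [← sub_mul, abs_mul]
          refine mul_le_mul_of_nonneg_right ?_ (abs_nonneg _)
          refine huc s ⟨ha.1.trans h2.le, h3.trans hb.2⟩ a ha ?_
          rw [Real.dist_eq, abs_of_nonneg (by linarith)]
          linarith
        have e2 : |∫ x in a..b, (g a - g x) * c x| ≤ ε * |C| * (b - a) := by
          have := intervalIntegral.norm_integral_le_of_norm_le_const (E := ℝ) (a := a) (b := b)
            (f := fun x => (g a - g x) * c x) (C := ε * |C|) (by
              intro x hx
              rw [uIoc_of_le hab] at hx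
              have hx' : x ∈ Icc r u := ⟨ha.1.trans hx.1.le, hx.2.trans hb.2⟩
              rw [norm_mul]
              refine mul_le_mul ?_ ((hC x hx').trans (le_abs_self C)) (norm_nonneg _) hε.le
              rw [← dist_eq_norm]
              refine huc a ha x hx' ?_
              rw [Real.dist_eq, abs_sub_comm, abs_of_nonneg (by linarith [hx.1])]
              linarith [hx.2])
          rwa [abs_of_nonneg (by linarith : 0 ≤ b - a)] at this
        have e3 : g a * ∫ x in a..b, c x = (∫ x in a..b, g x * c x)
            + ∫ x in a..b, (g a - g x) * c x := by
          rw [← intervalIntegral.integral_const_mul, ← intervalIntegral.integral_add]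
          · refine intervalIntegral.integral_congr fun x _ => ?_
            ring
          · exact hII _ (hg.mul hc) a ha b hb hab
          · exact hII _ ((continuousOn_const.sub hg).mul hc) a ha b hb hab
        rw [e3] at hn
        rw [abs_le] at *
        rw [abs_lt] at hn
        constructor <;> linarith [e1.1, e1.2, e2.1, e2.2, hn.1, hn.2]
      intro a ha b hb hab hba η hη
      rcases le_or_gt b (a + δ) with hd | hd
      · exact cell a ha b hb hab hd η hη
      · have hc' : a + δ ∈ Icc r u := ⟨by linarith [ha.1], by linarith [hb.2]⟩
        have hac : a ≤ a + δ := by linarith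
        push_cast at hba
        filter_upwards [cell a ha _ hc' hac le_rfl (η / 2) (by positivity),
          ih _ hc' b hb hd.le (by linarith) (η / 2) (by positivity)] with n h1 h2
        rw [sum_Ioc_eq _ hac hd.le, sum_Ioc_eq _ hac hd.le,
          ← intervalIntegral.integral_add_adjacent_intervals (f := fun x => g x * c x)
            (hII _ (hg.mul hc) a ha _ hc' hac) (hII _ (hg.mul hc) _ hc' b hb hd.le)]
        rw [abs_le] at *
        constructor <;> nlinarith [h1.1, h1.2, h2.1, h2.2]
  have hru : r ≤ u := ht.1.trans ht.2
  have hr : r ∈ Icc r u := ⟨le_rfl, hru⟩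
  rw [Metric.tendsto_nhds]
  intro ε hε
  set B : ℝ := |K| + |C| * (t - r) + 1 with hB
  have hBpos : 0 < B := by
    have := mul_nonneg (abs_nonneg C) (sub_nonneg.2 ht.1)
    have := abs_nonneg K
    linarith
  obtain ⟨δ, hδ, huc⟩ := Metric.uniformContinuousOn_iff_le.1
    (isCompact_Icc.uniformContinuousOn_of_continuous hg) (ε / 2 / B) (by positivity)
  obtain ⟨k, hk⟩ := exists_nat_ge ((t - r) / δ)
  rw [div_le_iff₀ hδ] at hk
  filter_upwards [claim (ε / 2 / B) (by positivity) δ hδ huc k r hr t ht ht.1 (by linarith)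
    (ε / 4) (by positivity), hK] with n h1 h2
  rw [Real.dist_eq]
  have h3 : ∑ s ∈ (𝕋.part n).filter (fun s => r < s ∧ s ≤ t), |m n s| ≤ |K| := by
    refine le_trans (Finset.sum_le_sum_of_subset_of_nonneg ?_ fun _ _ _ => abs_nonneg _)
      (h2.trans (le_abs_self K))
    exact Finset.monotone_filter_right _ fun s _ hs => ⟨hs.1, hs.2.trans ht.2⟩
  have h4 : ε / 2 / B * B = ε / 2 := by field_simp
  have h5 : 0 < ε / 2 / B := by positivity
  nlinarith

end PartitionSeq

end WeightedLimits

section Gradients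

variable {d : ℕ} {r u : ℝ} {D : Set (Fin d → ℝ)}

/-- The linear functional with the given coordinates. -/
def coordFun (c : Fin d → ℝ) : (Fin d → ℝ) →L[ℝ] ℝ :=
  ∑ i, c i • ContinuousLinearMap.proj i

lemma coordFun_apply (c h : Fin d → ℝ) : coordFun c h = ∑ i, c i * h i := by
  simp [coordFun]

lemma coordFun_single (c : Fin d → ℝ) (i : Fin d) : coordFun c (Pi.single i 1) = c i := by
  simp [coordFun_apply, Pi.single_apply]

lemma eq_coordFun (L : (Fin d → ℝ) →L[ℝ] ℝ) : L = coordFun fun i => L (Pi.single i 1) := by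
  ext h
  conv_lhs => rw [pi_eq_sum_univ' h]
  simp [coordFun_apply, mul_comm]

lemma continuous_coordFun : Continuous (coordFun : (Fin d → ℝ) → (Fin d → ℝ) →L[ℝ] ℝ) := by
  unfold coordFun
  fun_prop

/-- Space gradients extend from the open time interval to the closed one. -/
lemma hasFDerivAt_of_mem_Icc {F : ℝ × (Fin d → ℝ) → ℝ} {G : Fin d → ℝ × (Fin d → ℝ) → ℝ}
    (hru : r < u) (hD : IsOpen D) (hF : ContinuousOn F (Icc r u ×ˢ D))
    (hG : ∀ i, ContinuousOn (G i) (Icc r u ×ˢ D))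
    (h : ∀ t ∈ Ioo r u, ∀ x ∈ D, HasFDerivAt (fun y => F (t, y)) (coordFun fun i => G i (t, x)) x)
    {t : ℝ} (ht : t ∈ Icc r u) {x : Fin d → ℝ} (hx : x ∈ D) :
    HasFDerivAt (fun y => F (t, y)) (coordFun fun i => G i (t, x)) x := by
  rw [← closure_Ioo hru.ne, mem_closure_iff_seq_limit] at ht
  obtain ⟨τ, hτ, hlim⟩ := ht
  have ht : t ∈ Icc r u := isClosed_Icc.mem_of_tendsto hlim
    (Eventually.of_forall fun n => Ioo_subset_Icc_self (hτ n))
  have hG' : ContinuousOn (fun p => coordFun fun i => G i p) (Icc r u ×ˢ D) :=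
    continuous_coordFun.comp_continuousOn (continuousOn_pi.2 hG)
  have hlim' : Tendsto τ atTop (𝓝[Icc r u] t) :=
    tendsto_nhdsWithin_iff.2 ⟨hlim, Eventually.of_forall fun n => Ioo_subset_Icc_self (hτ n)⟩
  refine hasFDerivAt_of_tendstoLocallyUniformlyOn (l := atTop) (s := D)
    (f := fun n y => F (τ n, y)) (f' := fun n y => coordFun fun i => G i (τ n, y))
    (g' := fun y => coordFun fun i => G i (t, y)) hD ?_ (fun n y hy => h _ (hτ n) y hy) ?_ hx
  · rw [Metric.tendstoLocallyUniformlyOn_iff]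
    intro ε hε y hy
    have h1 := Metric.tendsto_nhds.1 (hG' (t, y) ⟨ht, hy⟩) (ε / 2) (by positivity)
    rw [nhdsWithin_prod_eq] at h1
    obtain ⟨U, hU, V, hV, hUV⟩ := Filter.mem_prod_iff.1 h1
    refine ⟨V, hV, ?_⟩
    filter_upwards [hlim' hU] with n hn z hz
    have h2 := hUV (show (t, z) ∈ U ×ˢ V from ⟨mem_of_mem_nhdsWithin ht hU, hz⟩)
    have h3 := hUV (show (τ n, z) ∈ U ×ˢ V from ⟨hn, hz⟩)
    change dist _ _ < _ at h2 h3
    refine (dist_triangle_right _ _ _).trans_lt (lt_of_lt_of_eq (add_lt_add h2 h3) (by ring))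
  · intro y hy
    have h1 := hF (t, y) ⟨ht, hy⟩
    refine Tendsto.comp h1 (tendsto_nhdsWithin_iff.2 ⟨?_, ?_⟩)
    · exact (hlim.prodMk_nhds tendsto_const_nhds)
    · exact Eventually.of_forall fun n => ⟨Ioo_subset_Icc_self (hτ n), hy⟩

/-- `v` has time derivative `gt`, gradient `gx` and Hessian `gxx`, all continuous, on the closed
time interval `[r,u]`. -/
structure HasGradients (r u : ℝ) (D : Set (Fin d → ℝ)) (v gt : ℝ × (Fin d → ℝ) → ℝ)
    (gx : Fin d → ℝ × (Fin d → ℝ) → ℝ) (gxx : Fin d → Fin d → ℝ × (Fin d → ℝ) → ℝ) : Prop where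
  cont : ContinuousOn v (Icc r u ×ˢ D)
  cont_t : ContinuousOn gt (Icc r u ×ˢ D)
  cont_x : ∀ i, ContinuousOn (gx i) (Icc r u ×ˢ D)
  cont_xx : ∀ i j, ContinuousOn (gxx i j) (Icc r u ×ˢ D)
  hasDerivWithinAt : ∀ t ∈ Icc r u, ∀ x ∈ D,
    HasDerivWithinAt (fun τ => v (τ, x)) (gt (t, x)) (Icc r u) t
  hasFDerivAt : ∀ t ∈ Icc r u, ∀ x ∈ D,
    HasFDerivAt (fun y => v (t, y)) (coordFun fun i => gx i (t, x)) x
  hasFDerivAt_grad : ∀ j, ∀ t ∈ Icc r u, ∀ x ∈ D,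
    HasFDerivAt (fun y => gx j (t, y)) (coordFun fun i => gxx i j (t, x)) x

lemma HasGradients.pd1_eq {v gt : ℝ × (Fin d → ℝ) → ℝ} {gx : Fin d → ℝ × (Fin d → ℝ) → ℝ}
    {gxx : Fin d → Fin d → ℝ × (Fin d → ℝ) → ℝ} (h : HasGradients r u D v gt gx gxx)
    {t : ℝ} (ht : t ∈ Icc r u) {x : Fin d → ℝ} (hx : x ∈ D) (i : Fin d) :
    pd1 (fun y => v (t, y)) i x = gx i (t, x) := by
  rw [pd1, (h.hasFDerivAt t ht x hx).fderiv, coordFun_single]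

lemma HasGradients.pd2_eq {v gt : ℝ × (Fin d → ℝ) → ℝ} {gx : Fin d → ℝ × (Fin d → ℝ) → ℝ}
    {gxx : Fin d → Fin d → ℝ × (Fin d → ℝ) → ℝ} (h : HasGradients r u D v gt gx gxx)
    (hD : IsOpen D) {t : ℝ} (ht : t ∈ Icc r u) {x : Fin d → ℝ} (hx : x ∈ D) (i j : Fin d) :
    pd2 (fun y => v (t, y)) i j x = gxx i j (t, x) := by
  have h1 : HasFDerivAt (fun y => pd1 (fun y => v (t, y)) j y)
      (coordFun fun i => gxx i j (t, x)) x :=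
    (h.hasFDerivAt_grad j t ht x hx).congr_of_eventuallyEq
      (eventually_of_mem (hD.mem_nhds hx) fun y hy => h.pd1_eq ht hy j)
  rw [pd2, h1.fderiv, coordFun_single]

lemma HasGradients.tderiv_eq {v : ℝ → (Fin d → ℝ) → ℝ} {gt : ℝ × (Fin d → ℝ) → ℝ}
    {gx : Fin d → ℝ × (Fin d → ℝ) → ℝ}
    {gxx : Fin d → Fin d → ℝ × (Fin d → ℝ) → ℝ}
    (h : HasGradients r u D (fun p => v p.1 p.2) gt gx gxx)
    (hru : r < u) {t : ℝ} (ht : t ∈ Icc r u) {x : Fin d → ℝ} (hx : x ∈ D) :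
    tderiv (Icc r u) v t x = gt (t, x) :=
  (h.hasDerivWithinAt t ht x hx).derivWithin (uniqueDiffOn_Icc hru t ht)

lemma IsC12.exists_hasGradients {v : ℝ → (Fin d → ℝ) → ℝ} (h : IsC12 (Icc r u) D v)
    (hru : r < u) (hD : IsOpen D) :
    ∃ gt gx gxx, HasGradients r u D (fun p => v p.1 p.2) gt gx gxx := by
  obtain ⟨gt, gx, gxx, ht, hx, hxx, hg⟩ := h.derivs_extend
  have hdiff := h.diff
  have hdiff2 := h.diff2
  rw [interior_Icc] at hg hdiff hdiff2
  have hF1 : ∀ t ∈ Ioo r u, ∀ x ∈ D, HasFDerivAt (v t) (coordFun fun i => gx i (t, x)) x := by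
    intro t ht x hx
    have h1 : DifferentiableAt ℝ (v t) x := by
      have h2 : DifferentiableAt ℝ (fun y : Fin d → ℝ => (t, y)) x := by fun_prop
      exact (hdiff t ht x hx).comp x h2
    have h3 := h1.hasFDerivAt
    rw [eq_coordFun (fderiv ℝ (v t) x)] at h3
    convert h3 using 3 with i
    exact (hg t ht x hx).2.1 i
  have hF2 : ∀ j, ∀ t ∈ Ioo r u, ∀ x ∈ D,
      HasFDerivAt (fun y => gx j (t, y)) (coordFun fun i => gxx i j (t, x)) x := by
    intro j t ht x hx
    have h3 := (hdiff2 t ht x hx j).hasFDerivAt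
    rw [eq_coordFun (fderiv ℝ (pd1 (v t) j) x)] at h3
    have h4 : HasFDerivAt (pd1 (v t) j) (coordFun fun i => gxx i j (t, x)) x := by
      convert h3 using 3 with i
      exact (hg t ht x hx).2.2 i j
    exact h4.congr_of_eventuallyEq
      (eventually_of_mem (hD.mem_nhds hx) fun y hy => (hg t ht y hy).2.1 j)
  refine ⟨gt, gx, gxx, h.cont, ht, hx, hxx, ?_, fun t ht x hx' => ?_, fun j t ht x hx' => ?_⟩
  · intro t htI x hxD
    have hslice : ContinuousOn (fun τ => gt (τ, x)) (Icc r u) :=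
      ht.comp (by fun_prop) fun τ hτ => ⟨hτ, hxD⟩
    have hvslice : ContinuousOn (fun τ => v τ x) (Icc r u) :=
      h.cont.comp (f := fun τ => (τ, x)) (by fun_prop) fun τ hτ => ⟨hτ, hxD⟩
    have hdv : ∀ τ ∈ Ioo r u, HasDerivAt (fun τ => v τ x) (gt (τ, x)) τ := by
      intro τ hτ
      have h2 : DifferentiableAt ℝ (fun σ : ℝ => (σ, x)) τ := by fun_prop
      have h1 : DifferentiableAt ℝ (fun σ => v σ x) τ :=
        DifferentiableAt.comp (g := fun p : ℝ × (Fin d → ℝ) => v p.1 p.2) τ (hdiff τ hτ x hxD) h2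
      rw [(hg τ hτ x hxD).1]
      exact h1.hasDerivAt
    have hdo : DifferentiableOn ℝ (fun τ => v τ x) (Ioo r u) := fun τ hτ =>
      (hdv τ hτ).differentiableAt.differentiableWithinAt
    have hder : ∀ s, s ⊆ Ioo r u → Tendsto (fun τ => gt (τ, x)) (𝓝[s] t) (𝓝 (gt (t, x))) :=
      fun s hs => (hslice t htI).mono_left (nhdsWithin_mono _ (hs.trans Ioo_subset_Icc_self))
    rcases eq_or_lt_of_le htI.1 with hrt | hrt
    · subst hrt
      refine (hasDerivWithinAt_Ici_of_tendsto_deriv hdo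
        ((hvslice r htI).mono Ioo_subset_Icc_self) (Ioo_mem_nhdsGT hru) ?_).mono
        Icc_subset_Ici_self
      rw [← nhdsWithin_Ioo_eq_nhdsGT hru]
      refine (hder _ subset_rfl).congr' ?_
      filter_upwards [self_mem_nhdsWithin] with τ hτ using (hdv τ hτ).deriv.symm
    · rcases eq_or_lt_of_le htI.2 with htu | htu
      · subst htu
        refine (hasDerivWithinAt_Iic_of_tendsto_deriv hdo
          ((hvslice t htI).mono Ioo_subset_Icc_self) (Ioo_mem_nhdsLT hru) ?_).mono
          Icc_subset_Iic_self
        rw [← nhdsWithin_Ioo_eq_nhdsLT hru]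
        refine (hder _ subset_rfl).congr' ?_
        filter_upwards [self_mem_nhdsWithin] with τ hτ using (hdv τ hτ).deriv.symm
      · exact (hdv t ⟨hrt, htu⟩).hasDerivWithinAt
  · exact hasFDerivAt_of_mem_Icc (F := fun p => v p.1 p.2) hru hD h.cont hx hF1 ht hx'
  · exact hasFDerivAt_of_mem_Icc hru hD (hx j) (fun i => hxx i j) (hF2 j) ht hx'

end Gradients

section Taylor

variable {d : ℕ} {r u T : ℝ} {D : Set (Fin d → ℝ)} {S : ℝ → Fin d → ℝ}

/-- Second order Taylor estimate on a convex set on which the Hessian oscillates little. -/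
lemma abs_taylor_two_le {B : Set (Fin d → ℝ)} (hB : Convex ℝ B) {F : (Fin d → ℝ) → ℝ}
    {G : Fin d → (Fin d → ℝ) → ℝ} {H : Fin d → Fin d → (Fin d → ℝ) → ℝ} {ε : ℝ} {x z : Fin d → ℝ}
    (hx : x ∈ B) (hz : z ∈ B)
    (hF : ∀ y ∈ B, HasFDerivAt F (coordFun fun i => G i y) y)
    (hG : ∀ j, ∀ y ∈ B, HasFDerivAt (G j) (coordFun fun i => H i j y) y)
    (hH : ∀ i j, ∀ y ∈ B, |H i j y - H i j x| ≤ ε) :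
    |F z - F x - ∑ i, G i x * (z i - x i)
        - 1 / 2 * ∑ i, ∑ j, H i j x * ((z i - x i) * (z j - x j))|
      ≤ ε * ∑ i, ∑ j, |(z i - x i) * (z j - x j)| := by
  set h : Fin d → ℝ := z - x with hh
  set Q : ℝ := ∑ i, ∑ j, H i j x * (h i * h j) with hQ
  set N : ℝ := ∑ i, ∑ j, |h i * h j| with hN
  have hmem : ∀ θ ∈ Icc (0 : ℝ) 1, x + θ • h ∈ B := fun θ hθ => hB.add_smul_sub_mem hx hz hθ
  have hline : ∀ θ : ℝ, HasDerivAt (fun θ : ℝ => x + θ • h) h θ := fun θ => by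
    simpa using ((hasDerivAt_id θ).smul_const h).const_add x
  have hψ' : ∀ θ ∈ Icc (0 : ℝ) 1, HasDerivWithinAt
      (fun θ => ∑ j, (G j (x + θ • h) - G j x) * h j - θ * Q)
      (∑ j, (∑ i, H i j (x + θ • h) * h i) * h j - Q) (Icc 0 1) θ := by
    intro θ hθ
    refine HasDerivAt.hasDerivWithinAt (HasDerivAt.sub (HasDerivAt.fun_sum fun j _ => ?_) ?_)
    · have h1 := ((hG j _ (hmem θ hθ)).comp_hasDerivAt θ (hline θ))
      rw [coordFun_apply] at h1
      exact (h1.sub_const _).mul_const _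
    · simpa using (hasDerivAt_id θ).mul_const Q
  have hψb : ∀ θ ∈ Icc (0 : ℝ) 1, ‖∑ j, (∑ i, H i j (x + θ • h) * h i) * h j - Q‖ ≤ ε * N := by
    intro θ hθ
    have e : ∑ j, (∑ i, H i j (x + θ • h) * h i) * h j - Q
        = ∑ i, ∑ j, (H i j (x + θ • h) - H i j x) * (h i * h j) := by
      simp only [Finset.sum_mul, hQ]
      rw [Finset.sum_comm]
      simp only [← Finset.sum_sub_distrib]
      exact Finset.sum_congr rfl fun i _ => Finset.sum_congr rfl fun j _ => by ring
    rw [e, hN, Finset.mul_sum]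
    refine (norm_sum_le _ _).trans (Finset.sum_le_sum fun i _ => ?_)
    rw [Finset.mul_sum]
    refine (norm_sum_le _ _).trans (Finset.sum_le_sum fun j _ => ?_)
    rw [norm_mul, Real.norm_eq_abs, Real.norm_eq_abs]
    exact mul_le_mul_of_nonneg_right (hH i j _ (hmem θ hθ)) (abs_nonneg _)
  have hN0 : 0 ≤ ε * N := (norm_nonneg _).trans (hψb 0 ⟨le_rfl, zero_le_one⟩)
  have hψ : ∀ θ ∈ Icc (0 : ℝ) 1, ‖∑ j, (G j (x + θ • h) - G j x) * h j - θ * Q‖ ≤ ε * N := by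
    intro θ hθ
    have h1 := Convex.norm_image_sub_le_of_norm_hasDerivWithin_le hψ' hψb (convex_Icc 0 1)
      (left_mem_Icc.2 zero_le_one) hθ
    simp only [zero_smul, add_zero, sub_self, zero_mul, Finset.sum_const_zero, sub_zero] at h1
    refine h1.trans (mul_le_of_le_one_right hN0 ?_)
    rw [Real.norm_eq_abs, abs_of_nonneg hθ.1]
    exact hθ.2
  have hφ' : ∀ θ ∈ Icc (0 : ℝ) 1, HasDerivWithinAt
      (fun θ => F (x + θ • h) - θ * (∑ j, G j x * h j) - 1 / 2 * θ ^ 2 * Q)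
      (∑ j, (G j (x + θ • h) - G j x) * h j - θ * Q) (Icc 0 1) θ := by
    intro θ hθ
    have h1 := ((hF _ (hmem θ hθ)).comp_hasDerivAt θ (hline θ))
    rw [coordFun_apply] at h1
    have h2 := ((hasDerivAt_id θ).mul_const (∑ j, G j x * h j))
    have h3 := (((hasDerivAt_id θ).pow 2).const_mul (1 / 2)).mul_const Q
    have h4 := ((h1.sub h2).sub h3).hasDerivWithinAt (s := Icc 0 1)
    refine h4.congr_deriv ?_
    simp only [sub_mul, Finset.sum_sub_distrib, id]
    ring
  have h1 := Convex.norm_image_sub_le_of_norm_hasDerivWithin_le hφ' hψ (convex_Icc 0 1)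
      (left_mem_Icc.2 zero_le_one) (right_mem_Icc.2 zero_le_one)
  have hzx : x + (1 : ℝ) • h = z := by rw [hh]; simp
  rw [hzx] at h1
  simp only [zero_smul, add_zero, zero_mul, sub_zero, one_mul, one_pow, norm_one, mul_one,
    Real.norm_eq_abs, ne_eq, OfNat.ofNat_ne_zero, not_false_eq_true, zero_pow, mul_zero] at h1
  have hcoord : ∀ i, z i - x i = h i := fun _ => rfl
  simp only [hcoord]
  rw [← hQ, ← hN]
  convert h1 using 2
  ring

/-- The point of `[r,u]` closest to `t`. -/
def clamp (r u t : ℝ) : ℝ := max r (min u t)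

lemma clamp_mem (hru : r ≤ u) (t : ℝ) : clamp r u t ∈ Icc r u :=
  ⟨le_max_left _ _, max_le hru (min_le_left _ _)⟩

lemma clamp_of_mem {t : ℝ} (ht : t ∈ Icc r u) : clamp r u t = t := by
  rw [clamp, min_eq_right ht.2, max_eq_right ht.1]

lemma continuous_clamp : Continuous (clamp r u) := by
  unfold clamp
  fun_prop

lemma clamp_mono : Monotone (clamp r u) := fun _ _ h => max_le_max le_rfl (min_le_min le_rfl h)

/-- The value of `g` along the path `S`, with time clamped to `[r,u]`. -/
def along (r u : ℝ) (S : ℝ → Fin d → ℝ) (g : ℝ × (Fin d → ℝ) → ℝ) (t : ℝ) : ℝ :=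
  g (clamp r u t, S t)

lemma along_of_mem (g : ℝ × (Fin d → ℝ) → ℝ) {t : ℝ} (ht : t ∈ Icc r u) :
    along r u S g t = g (t, S t) := by
  rw [along, clamp_of_mem ht]

lemma continuousOn_along (hru : r ≤ u) {g : ℝ × (Fin d → ℝ) → ℝ}
    (hg : ContinuousOn g (Icc r u ×ˢ D)) (hS : ContinuousOn S (Icc 0 T))
    (hSD : ∀ t ∈ Icc 0 T, S t ∈ D) : ContinuousOn (along r u S g) (Icc 0 T) :=
  hg.comp (continuous_clamp.continuousOn.prodMk hS) fun t ht => ⟨clamp_mem hru t, hSD t ht⟩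

/-- A neighbourhood of the path stays in `D`. -/
lemma exists_mem_of_dist_lt (hD : IsOpen D) (hS : ContinuousOn S (Icc 0 T))
    (hSD : ∀ t ∈ Icc 0 T, S t ∈ D) :
    ∃ δ > 0, ∀ t ∈ Icc 0 T, ∀ y, dist y (S t) < δ → y ∈ D := by
  obtain ⟨δ, hδ, h⟩ := (isCompact_Icc.image_of_continuousOn hS).exists_thickening_subset_open hD
    (image_subset_iff.2 hSD)
  exact ⟨δ, hδ, fun t ht y hy => h (Metric.mem_thickening_iff.2 ⟨_, mem_image_of_mem S ht, hy⟩)⟩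

/-- Uniform continuity of `g` near the graph of the path. -/
lemma exists_abs_sub_along_lt (hru : r ≤ u) (hD : IsOpen D) {g : ℝ × (Fin d → ℝ) → ℝ}
    (hg : ContinuousOn g (Icc r u ×ˢ D)) (hS : ContinuousOn S (Icc 0 T))
    (hSD : ∀ t ∈ Icc 0 T, S t ∈ D) {ε : ℝ} (hε : 0 < ε) :
    ∃ δ > 0, ∀ t ∈ Icc 0 T, ∀ τ ∈ Icc r u, ∀ y, |τ - clamp r u t| < δ → dist y (S t) < δ →
      |g (τ, y) - along r u S g t| < ε := by
  have hK : IsCompact ((fun t => (clamp r u t, S t)) '' Icc 0 T) :=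
    isCompact_Icc.image_of_continuousOn (continuous_clamp.continuousOn.prodMk hS)
  have h1 := hK.uniformContinuousAt_of_continuousAt (fun p => g (clamp r u p.1, p.2)) (by
    rintro _ ⟨t, ht, rfl⟩
    have h2 : ContinuousOn (fun p : ℝ × (Fin d → ℝ) => g (clamp r u p.1, p.2)) (univ ×ˢ D) :=
      hg.comp ((continuous_clamp.comp continuous_fst).prodMk continuous_snd).continuousOn
        fun p hp => ⟨clamp_mem hru _, hp.2⟩
    exact h2.continuousAt ((isOpen_univ.prod hD).mem_nhds ⟨mem_univ _, hSD t ht⟩))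
    (Metric.dist_mem_uniformity hε)
  obtain ⟨δ, hδ, h⟩ := Metric.mem_uniformity_dist.1 h1
  refine ⟨δ, hδ, fun t ht τ hτ y h2 h3 => ?_⟩
  have h4 := @h (clamp r u t, S t) (τ, y) (by
    rw [dist_comm, Prod.dist_eq]
    exact max_lt h2 h3) (mem_image_of_mem _ ht)
  change dist _ _ < _ at h4
  simp only [clamp_of_mem hτ, clamp_of_mem (clamp_mem hru t)] at h4
  rw [dist_comm] at h4
  exact h4

end Taylor

section Ito

variable {T : ℝ} {𝕋 : PartitionSeq T} {d : ℕ} {r u : ℝ} {D : Set (Fin d → ℝ)}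
variable {α : ℝ → (Fin d → ℝ) → Fin d → Fin d → ℝ} {S : ℝ → Fin d → ℝ}

/-- Continuous `D`-valued paths with covariation density `α(t,S(t))`. -/
structure IsModelPath (𝕋 : PartitionSeq T) (D : Set (Fin d → ℝ))
    (α : ℝ → (Fin d → ℝ) → Fin d → Fin d → ℝ) (S : ℝ → Fin d → ℝ) : Prop where
  cont : ContinuousOn S (Icc 0 T)
  mem : ∀ t ∈ Icc 0 T, S t ∈ D
  cov : ∀ i j, ∀ t ∈ Icc 0 T, Tendsto (fun n => covSum T 𝕋 S i j t n) atTop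
    (𝓝 (∫ s in (0 : ℝ)..t, α s (S s) i j))

/-- Products of increments of the components of `S`. -/
def covIncr (𝕋 : PartitionSeq T) (S : ℝ → Fin d → ℝ) (i j : Fin d) (n : ℕ) (s : ℝ) : ℝ :=
  𝕋.incr (fun t => S t i) n s * 𝕋.incr (fun t => S t j) n s

namespace IsModelPath

lemma continuousOn_coord (h : IsModelPath 𝕋 D α S) (i : Fin d) :
    ContinuousOn (fun t => S t i) (Icc 0 T) := (continuousOn_pi.1 h.cont) i

lemma nullTerms_covIncr (h : IsModelPath 𝕋 D α S) (i j : Fin d) :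
    𝕋.NullTerms r u (covIncr 𝕋 S i j) :=
  (PartitionSeq.nullTerms_incr (h.continuousOn_coord i)).mul
    (PartitionSeq.nullTerms_incr (h.continuousOn_coord j))

lemma exists_sum_abs_covIncr_le (hT : 0 < T) (h : IsModelPath 𝕋 D α S) (i j : Fin d) :
    ∃ K, ∀ᶠ n in atTop, ∑ s ∈ 𝕋.part n, |covIncr 𝕋 S i j n s| ≤ K := by
  have key : ∀ k, ∃ K, ∀ᶠ n in atTop, ∑ s ∈ 𝕋.part n, covIncr 𝕋 S k k n s ≤ K := by
    intro k
    refine ⟨(∫ s in (0 : ℝ)..T, α s (S s) k k) + 1, ?_⟩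
    filter_upwards [(h.cov k k T ⟨hT.le, le_rfl⟩).eventually_le_const (lt_add_one _)] with n hn
    refine le_trans (le_of_eq ?_) hn
    rw [covSum, Finset.filter_true_of_mem 𝕋.le_of_mem]
    rfl
  obtain ⟨K, hK⟩ := key i
  obtain ⟨K', hK'⟩ := key j
  refine ⟨K + K', ?_⟩
  filter_upwards [hK, hK'] with n h1 h2
  refine le_trans ?_ (add_le_add h1 h2)
  rw [← Finset.sum_add_distrib]
  refine Finset.sum_le_sum fun s _ => ?_
  simp only [covIncr]
  set x := 𝕋.incr (fun t => S t i) n s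
  set y := 𝕋.incr (fun t => S t j) n s
  rw [abs_le]
  constructor <;> nlinarith [sq_nonneg (x + y), sq_nonneg (x - y), mul_self_nonneg x,
    mul_self_nonneg y]

lemma continuousOn_density (h : IsModelPath 𝕋 D α S) {i j : Fin d}
    (hα : ContinuousOn (fun p : ℝ × (Fin d → ℝ) => α p.1 p.2 i j) (Icc 0 T ×ˢ D)) :
    ContinuousOn (fun s => α s (S s) i j) (Icc 0 T) :=
  hα.comp (continuousOn_id.prodMk h.cont) fun t ht => ⟨ht, h.mem t ht⟩

lemma integral_density_sub (h : IsModelPath 𝕋 D α S) {i j : Fin d}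
    (hα : ContinuousOn (fun p : ℝ × (Fin d → ℝ) => α p.1 p.2 i j) (Icc 0 T ×ˢ D))
    {a b : ℝ} (ha : a ∈ Icc 0 T) (hb : b ∈ Icc 0 T) :
    (∫ s in (0 : ℝ)..b, α s (S s) i j) - ∫ s in (0 : ℝ)..a, α s (S s) i j
      = ∫ s in a..b, α s (S s) i j := by
  have h0 : (0 : ℝ) ∈ Icc 0 T := ⟨le_rfl, ha.1.trans ha.2⟩
  have hII : ∀ c ∈ Icc 0 T,
      IntervalIntegrable (fun s => α s (S s) i j) MeasureTheory.volume 0 c := fun c hc =>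
    ((h.continuousOn_density hα).mono (Set.uIcc_subset_Icc h0 hc)).intervalIntegrable
  exact intervalIntegral.integral_interval_sub_left (hII b hb) (hII a ha)

lemma tendsto_sum_mul_covIncr (hT : 0 < T) (hr : 0 ≤ r) (hu : u ≤ T) (h : IsModelPath 𝕋 D α S)
    {i j : Fin d} (hα : ContinuousOn (fun p : ℝ × (Fin d → ℝ) => α p.1 p.2 i j) (Icc 0 T ×ˢ D))
    {g : ℝ → ℝ} (hg : ContinuousOn g (Icc r u)) {t : ℝ} (ht : t ∈ Icc r u) :
    Tendsto (fun n => ∑ s ∈ (𝕋.part n).filter (fun s => r ≤ s ∧ s ≤ t),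
      g s * covIncr 𝕋 S i j n s) atTop (𝓝 (∫ s in r..t, g s * α s (S s) i j)) := by
  have hsub : Icc r u ⊆ Icc 0 T := Icc_subset_Icc hr hu
  rw [PartitionSeq.tendsto_sum_Icc_iff
    (((h.nullTerms_covIncr i j).mul_left hg).mono le_rfl ht.2)]
  obtain ⟨K, hK⟩ := h.exists_sum_abs_covIncr_le hT i j
  refine PartitionSeq.tendsto_sum_mul (K := K) (fun t ht => h.cov i j t (hsub ht))
    ((h.continuousOn_density hα).mono hsub)
    (fun a ha b hb _ => h.integral_density_sub hα (hsub ha) (hsub hb)) ?_ hg ht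
  filter_upwards [hK] with n hn
  exact (Finset.sum_le_sum_of_subset_of_nonneg (Finset.filter_subset _ _)
    fun _ _ _ => abs_nonneg _).trans hn

end IsModelPath

/-- Increments of the clamped time. -/
def timeIncr (𝕋 : PartitionSeq T) (r u : ℝ) (n : ℕ) (s : ℝ) : ℝ := 𝕋.incr (clamp r u) n s

lemma timeIncr_nonneg {n : ℕ} {s : ℝ} (hs : s ∈ 𝕋.part n) : 0 ≤ timeIncr 𝕋 r u n s :=
  sub_nonneg.2 (clamp_mono (le_succOf (𝕋.top_mem n) (𝕋.le_of_mem s hs)))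

lemma exists_sum_abs_timeIncr_le (𝕋 : PartitionSeq T) (hT : 0 < T) (r u : ℝ) :
    ∃ K, ∀ᶠ n in atTop, ∑ s ∈ 𝕋.part n, |timeIncr 𝕋 r u n s| ≤ K := by
  have h1 := PartitionSeq.tendsto_sum_incr (𝕋 := 𝕋)
    (continuous_clamp (r := r) (u := u)).continuousOn (right_mem_Icc.2 hT.le)
  refine ⟨clamp r u T - clamp r u 0 + 1, ?_⟩
  filter_upwards [h1.eventually_le_const (lt_add_one _)] with n hn
  refine le_trans (le_of_eq ?_) hn
  rw [Finset.filter_true_of_mem 𝕋.le_of_mem]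
  exact Finset.sum_congr rfl fun s hs => abs_of_nonneg (timeIncr_nonneg hs)

lemma tendsto_sum_mul_timeIncr (hT : 0 < T) (hr : 0 ≤ r) (hu : u ≤ T)
    {g : ℝ → ℝ} (hg : ContinuousOn g (Icc r u)) {t : ℝ} (ht : t ∈ Icc r u) :
    Tendsto (fun n => ∑ s ∈ (𝕋.part n).filter (fun s => r ≤ s ∧ s ≤ t),
      g s * timeIncr 𝕋 r u n s) atTop (𝓝 (∫ s in r..t, g s)) := by
  have hsub : Icc r u ⊆ Icc 0 T := Icc_subset_Icc hr hu
  have hnull : 𝕋.NullTerms r u (timeIncr 𝕋 r u) :=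
    PartitionSeq.nullTerms_incr continuous_clamp.continuousOn
  rw [PartitionSeq.tendsto_sum_Icc_iff ((hnull.mul_left hg).mono le_rfl ht.2)]
  obtain ⟨K, hK⟩ := exists_sum_abs_timeIncr_le 𝕋 hT r u
  have h1 := PartitionSeq.tendsto_sum_mul (𝕋 := 𝕋) (c := fun _ => 1) (K := K)
    (fun t ht => PartitionSeq.tendsto_sum_incr
      (continuous_clamp (r := r) (u := u)).continuousOn (hsub ht)) continuousOn_const
    (fun a ha b hb _ => by simp [clamp_of_mem ha, clamp_of_mem hb]) (by
      filter_upwards [hK] with n hn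
      exact (Finset.sum_le_sum_of_subset_of_nonneg (Finset.filter_subset _ _)
        fun _ _ _ => abs_nonneg _).trans hn) hg ht
  simpa [timeIncr] using h1

variable {v gt : ℝ × (Fin d → ℝ) → ℝ} {gx : Fin d → ℝ × (Fin d → ℝ) → ℝ}
    {gxx : Fin d → Fin d → ℝ × (Fin d → ℝ) → ℝ}

/-- Remainder in the second order expansion of `v` along `S` over a partition interval. -/
def itoRemainder (𝕋 : PartitionSeq T) (r u : ℝ) (S : ℝ → Fin d → ℝ) (v gt : ℝ × (Fin d → ℝ) → ℝ)
    (gx : Fin d → ℝ × (Fin d → ℝ) → ℝ) (gxx : Fin d → Fin d → ℝ × (Fin d → ℝ) → ℝ)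
    (n : ℕ) (s : ℝ) : ℝ :=
  𝕋.incr (along r u S v) n s - ∑ k, along r u S (gx k) s * 𝕋.incr (fun t => S t k) n s
    - along r u S gt s * timeIncr 𝕋 r u n s
    - 1 / 2 * ∑ i, ∑ j, along r u S (gxx i j) s * covIncr 𝕋 S i j n s

lemma IsModelPath.eventually_abs_itoRemainder_le (hru : r ≤ u) (hD : IsOpen D)
    (h : IsModelPath 𝕋 D α S) (hv : HasGradients r u D v gt gx gxx) {ε : ℝ} (hε : 0 < ε) :
    ∀ᶠ n in atTop, ∀ s ∈ 𝕋.part n, |itoRemainder 𝕋 r u S v gt gx gxx n s|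
      ≤ ε * (timeIncr 𝕋 r u n s + ∑ i, ∑ j, |covIncr 𝕋 S i j n s|) := by
  obtain ⟨δ0, hδ0, hmem⟩ := exists_mem_of_dist_lt hD h.cont h.mem
  obtain ⟨δ1, hδ1, ht⟩ := exists_abs_sub_along_lt hru hD hv.cont_t h.cont h.mem hε
  choose δ2 hδ2 hxx using fun i j =>
    exists_abs_sub_along_lt hru hD (hv.cont_xx i j) h.cont h.mem hε
  obtain ⟨δ, hδ, hle⟩ : ∃ δ > 0, δ < δ0 ∧ δ < δ1 ∧ ∀ i j, δ < δ2 i j := by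
    have h1 : ∀ᶠ δ in 𝓝[>] (0 : ℝ), δ < δ0 ∧ δ < δ1 ∧ ∀ i j, δ < δ2 i j :=
      nhdsWithin_le_nhds ((eventually_lt_nhds hδ0).and ((eventually_lt_nhds hδ1).and
        (eventually_all.2 fun i => eventually_all.2 fun j => eventually_lt_nhds (hδ2 i j))))
    obtain ⟨δ, h2, h3⟩ := (h1.and self_mem_nhdsWithin).exists
    exact ⟨δ, h3, h2⟩
  have hS := eventually_all.2 fun k =>
    PartitionSeq.eventually_abs_incr_le (𝕋 := 𝕋) (h.continuousOn_coord k) hδ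
  filter_upwards [hS, PartitionSeq.eventually_abs_incr_le (𝕋 := 𝕋)
    (continuous_clamp (r := r) (u := u)).continuousOn hδ] with n hn hcl s hs
  set s' := succOf T (𝕋.part n) s with hs'
  have hsI := 𝕋.subset_Icc n hs
  have hs'I : s' ∈ Icc 0 T := 𝕋.subset_Icc n (succOf_mem (𝕋.top_mem n) s)
  set c := clamp r u s with hc
  set c' := clamp r u s' with hc'
  have hcI : c ∈ Icc r u := clamp_mem hru s
  have hc'I : c' ∈ Icc r u := clamp_mem hru s'
  have hcc' : c ≤ c' := clamp_mono (le_succOf (𝕋.top_mem n) (𝕋.le_of_mem s hs))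
  have hdist : dist (S s') (S s) ≤ δ := (dist_pi_le_iff hδ.le).2 fun k => hn k s hs
  have hcd : c' - c ≤ δ := (le_abs_self _).trans (hcl s hs)
  -- expansion in space at the earlier time
  have hspace := abs_taylor_two_le (convex_ball (S s) δ0 |>.inter
      (convex_closedBall (S s) δ)) (F := fun y => v (c, y)) (G := fun i y => gx i (c, y))
    (H := fun i j y => gxx i j (c, y)) (ε := ε) (x := S s) (z := S s')
    ⟨Metric.mem_ball_self hδ0, Metric.mem_closedBall_self hδ.le⟩
    ⟨hdist.trans_lt hle.1, hdist⟩
    (fun y hy => hv.hasFDerivAt c hcI y (hmem s hsI y hy.1))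
    (fun j y hy => hv.hasFDerivAt_grad j c hcI y (hmem s hsI y hy.1))
    (fun i j y hy => (hxx i j s hsI c hcI y (by simpa [hc] using hδ2 i j)
      (lt_of_le_of_lt hy.2 (hle.2.2 i j))).le)
  -- expansion in time at the later point
  have htime : |v (c', S s') - v (c, S s') - gt (c, S s) * (c' - c)| ≤ ε * (c' - c) := by
    have h1 : ∀ τ ∈ Icc c c', HasDerivWithinAt (fun τ => v (τ, S s') - gt (c, S s) * τ)
        (gt (τ, S s') - gt (c, S s)) (Icc c c') τ := by
      intro τ hτ
      have h2 := (hv.hasDerivWithinAt τ (Icc_subset_Icc hcI.1 hc'I.2 hτ) (S s')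
        (h.mem s' hs'I)).mono (Icc_subset_Icc hcI.1 hc'I.2)
      refine (h2.fun_sub ((hasDerivWithinAt_id τ _).const_mul (gt (c, S s)))).congr_deriv ?_
      rw [mul_one]
    have h3 := Convex.norm_image_sub_le_of_norm_hasDerivWithin_le h1 (C := ε) (fun τ hτ => by
      refine (ht s hsI τ (Icc_subset_Icc hcI.1 hc'I.2 hτ) (S s') ?_
        (hdist.trans_lt hle.2.1)).le
      rw [← hc, abs_of_nonneg (by linarith [hτ.1])]
      linarith [hτ.2, hle.2.1]) (convex_Icc c c') (left_mem_Icc.2 hcc') (right_mem_Icc.2 hcc')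
    rw [Real.norm_eq_abs, Real.norm_eq_abs, abs_of_nonneg (by linarith : 0 ≤ c' - c)] at h3
    convert h3 using 2
    ring
  have e : itoRemainder 𝕋 r u S v gt gx gxx n s
      = (v (c', S s') - v (c, S s') - gt (c, S s) * (c' - c))
        + (v (c, S s') - v (c, S s) - ∑ i, gx i (c, S s) * (S s' i - S s i)
        - 1 / 2 * ∑ i, ∑ j, gxx i j (c, S s) * ((S s' i - S s i) * (S s' j - S s j))) := by
    simp only [itoRemainder, PartitionSeq.incr, along, timeIncr, covIncr, ← hs', ← hc, ← hc']
    ring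
  rw [e]
  refine (abs_add_le _ _).trans ((add_le_add htime hspace).trans (le_of_eq ?_))
  rw [mul_add]
  rfl

lemma IsModelPath.tendsto_sum_itoRemainder (hT : 0 < T) (hru : r ≤ u) (hD : IsOpen D)
    (h : IsModelPath 𝕋 D α S) (hv : HasGradients r u D v gt gx gxx) (a b : ℝ) :
    Tendsto (fun n => ∑ s ∈ (𝕋.part n).filter (fun s => a ≤ s ∧ s ≤ b),
      itoRemainder 𝕋 r u S v gt gx gxx n s) atTop (𝓝 0) := by
  obtain ⟨K, hK⟩ := exists_sum_abs_timeIncr_le 𝕋 hT r u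
  choose K' hK' using fun i j => h.exists_sum_abs_covIncr_le hT i j
  rw [Metric.tendsto_nhds]
  intro ε hε
  set B : ℝ := |K| + ∑ i, ∑ j, |K' i j| + 1 with hB
  have hB0 : 0 < B := by positivity
  filter_upwards [hK, eventually_all.2 fun i => eventually_all.2 fun j => hK' i j,
    h.eventually_abs_itoRemainder_le hru hD hv (ε := ε / B) (by positivity)] with n h1 h2 h3
  rw [Real.dist_eq, sub_zero]
  calc |∑ s ∈ (𝕋.part n).filter (fun s => a ≤ s ∧ s ≤ b), itoRemainder 𝕋 r u S v gt gx gxx n s|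
      ≤ ∑ s ∈ (𝕋.part n).filter (fun s => a ≤ s ∧ s ≤ b),
        |itoRemainder 𝕋 r u S v gt gx gxx n s| := abs_sum_le_sum_abs _ _
    _ ≤ ∑ s ∈ 𝕋.part n, |itoRemainder 𝕋 r u S v gt gx gxx n s| :=
        Finset.sum_le_sum_of_subset_of_nonneg (Finset.filter_subset _ _)
          fun _ _ _ => abs_nonneg _
    _ ≤ ∑ s ∈ 𝕋.part n, ε / B * (|timeIncr 𝕋 r u n s| + ∑ i, ∑ j, |covIncr 𝕋 S i j n s|) := by
        refine Finset.sum_le_sum fun s hs => ?_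
        rw [abs_of_nonneg (timeIncr_nonneg hs)]
        exact h3 s hs
    _ = ε / B * (∑ s ∈ 𝕋.part n, |timeIncr 𝕋 r u n s|
          + ∑ i, ∑ j, ∑ s ∈ 𝕋.part n, |covIncr 𝕋 S i j n s|) := by
        rw [← Finset.mul_sum, Finset.sum_add_distrib, Finset.sum_comm]
        congr 2
        exact Finset.sum_congr rfl fun i _ => Finset.sum_comm
    _ ≤ ε / B * (|K| + ∑ i, ∑ j, |K' i j|) := by
        refine mul_le_mul_of_nonneg_left ?_ (by positivity)
        refine add_le_add (h1.trans (le_abs_self _)) ?_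
        exact Finset.sum_le_sum fun i _ => Finset.sum_le_sum fun j _ =>
          (h2 i j).trans (le_abs_self _)
    _ < ε / B * B := by
        refine mul_lt_mul_of_pos_left ?_ (by positivity)
        rw [hB]
        linarith
    _ = ε := by field_simp

/-- The generator term `∂v/∂t + ½ Σ a_ij ∂²v/∂x_i∂x_j`. -/
def generatorTerm (α : ℝ → (Fin d → ℝ) → Fin d → Fin d → ℝ) (gt : ℝ × (Fin d → ℝ) → ℝ)
    (gxx : Fin d → Fin d → ℝ × (Fin d → ℝ) → ℝ) (p : ℝ × (Fin d → ℝ)) : ℝ :=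
  gt p + 1 / 2 * ∑ i, ∑ j, α p.1 p.2 i j * gxx i j p

lemma continuousOn_generatorTerm (hr : 0 ≤ r) (hu : u ≤ T)
    (hα : ∀ i j, ContinuousOn (fun p : ℝ × (Fin d → ℝ) => α p.1 p.2 i j) (Icc 0 T ×ˢ D))
    (hv : HasGradients r u D v gt gx gxx) :
    ContinuousOn (generatorTerm α gt gxx) (Icc r u ×ˢ D) := by
  refine hv.cont_t.add (continuousOn_const.mul (continuousOn_finsetSum _ fun i _ =>
    continuousOn_finsetSum _ fun j _ => ((hα i j).mono ?_).mul (hv.cont_xx i j)))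
  exact prod_mono (Icc_subset_Icc hr hu) subset_rfl

/-- Föllmer's pathwise Itô formula. -/
theorem IsModelPath.hasFollmerIntegral_grad (hT : 0 < T) (hr : 0 ≤ r) (hu : u ≤ T)
    (hD : IsOpen D) (h : IsModelPath 𝕋 D α S)
    (hα : ∀ i j, ContinuousOn (fun p : ℝ × (Fin d → ℝ) => α p.1 p.2 i j) (Icc 0 T ×ˢ D))
    (hv : HasGradients r u D v gt gx gxx) {t : ℝ} (ht : t ∈ Icc r u) :
    HasFollmerIntegral T 𝕋 (fun s k => along r u S (gx k) s) S r t
      (v (t, S t) - v (r, S r) - ∫ s in r..t, generatorTerm α gt gxx (s, S s)) := by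
  have hru : r ≤ u := ht.1.trans ht.2
  have hsub : Icc r u ⊆ Icc 0 T := Icc_subset_Icc hr hu
  have hr' : r ∈ Icc r u := ⟨le_rfl, hru⟩
  have hco : ∀ g : ℝ × (Fin d → ℝ) → ℝ, ContinuousOn g (Icc r u ×ˢ D) →
      ContinuousOn (along r u S g) (Icc r u) := fun g hg =>
    (continuousOn_along hru hg h.cont h.mem).mono hsub
  have hcv := continuousOn_along hru hv.cont h.cont h.mem
  have h1 : Tendsto (fun n => ∑ s ∈ (𝕋.part n).filter (fun s => r ≤ s ∧ s ≤ t),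
      𝕋.incr (along r u S v) n s) atTop (𝓝 (v (t, S t) - v (r, S r))) := by
    rw [PartitionSeq.tendsto_sum_Icc_iff (PartitionSeq.nullTerms_incr hcv)]
    have := PartitionSeq.tendsto_sum_Ioc (𝕋 := 𝕋) ht.1
      (PartitionSeq.tendsto_sum_incr hcv (hsub hr')) (PartitionSeq.tendsto_sum_incr hcv (hsub ht))
    rwa [sub_sub_sub_cancel_right, along_of_mem _ ht, along_of_mem _ hr'] at this
  have h2 := tendsto_sum_mul_timeIncr (𝕋 := 𝕋) hT hr hu (hco _ hv.cont_t) ht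
  have h3 := tendsto_finsetSum Finset.univ fun i _ => tendsto_finsetSum Finset.univ fun j _ =>
    h.tendsto_sum_mul_covIncr hT hr hu (hα i j) (hco _ (hv.cont_xx i j)) ht
  have h4 := h.tendsto_sum_itoRemainder hT hru hD hv r t
  have h5 := ((h1.sub h2).sub (h3.const_mul (1 / 2))).sub h4
  have hint : ∫ s in r..t, generatorTerm α gt gxx (s, S s)
      = (∫ s in r..t, along r u S gt s)
        + 1 / 2 * ∑ i, ∑ j, ∫ s in r..t, along r u S (gxx i j) s * α s (S s) i j := by
    have hsub' : uIcc r t ⊆ Icc r u := by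
      rw [uIcc_of_le ht.1]
      exact Icc_subset_Icc_right ht.2
    have hI2 : ∀ i j, IntervalIntegrable (fun s => along r u S (gxx i j) s * α s (S s) i j)
        MeasureTheory.volume r t := fun i j =>
      (((hco _ (hv.cont_xx i j)).mul ((h.continuousOn_density (hα i j)).mono hsub)).mono
        hsub').intervalIntegrable
    have hI1 : IntervalIntegrable (along r u S gt) MeasureTheory.volume r t :=
      ((hco _ hv.cont_t).mono hsub').intervalIntegrable
    have hI3 : ∀ i, IntervalIntegrable (fun s => ∑ j, along r u S (gxx i j) s * α s (S s) i j)
        MeasureTheory.volume r t := fun i => by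
      simpa only [Finset.sum_fn] using IntervalIntegrable.sum Finset.univ fun j _ => hI2 i j
    have hI4 : IntervalIntegrable
        (fun s => ∑ i, ∑ j, along r u S (gxx i j) s * α s (S s) i j)
        MeasureTheory.volume r t := by
      simpa only [Finset.sum_fn] using IntervalIntegrable.sum Finset.univ fun i _ => hI3 i
    simp only [← intervalIntegral.integral_finsetSum fun j _ => hI2 _ j]
    rw [← intervalIntegral.integral_finsetSum fun i _ => hI3 i,
      ← intervalIntegral.integral_const_mul,
      ← intervalIntegral.integral_add hI1 (hI4.const_mul _)]
    refine intervalIntegral.integral_congr fun s hs => ?_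
    simp only [along_of_mem _ (hsub' hs), generatorTerm]
    simp only [mul_comm]
  rw [hint, HasFollmerIntegral]
  rw [sub_zero, sub_sub] at h5
  refine h5.congr fun n => ?_
  have e : ∑ i, ∑ j, ∑ s ∈ (𝕋.part n).filter (fun s => r ≤ s ∧ s ≤ t),
        along r u S (gxx i j) s * covIncr 𝕋 S i j n s
      = ∑ s ∈ (𝕋.part n).filter (fun s => r ≤ s ∧ s ≤ t),
        ∑ i, ∑ j, along r u S (gxx i j) s * covIncr 𝕋 S i j n s := by
    simp only [Finset.sum_comm (s := (𝕋.part n).filter _)]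
  rw [e, Finset.mul_sum, ← Finset.sum_sub_distrib, ← Finset.sum_sub_distrib,
    ← Finset.sum_sub_distrib]
  refine Finset.sum_congr rfl fun s _ => ?_
  simp only [itoRemainder, PartitionSeq.incr]
  ring

end Ito

section Identification

namespace PartitionSeq

variable {T : ℝ} {𝕋 : PartitionSeq T}

lemma incr_eq_zero {F : ℝ → ℝ} {n : ℕ} {s : ℝ} (h : succOf T (𝕋.part n) s = s) :
    𝕋.incr F n s = 0 := by
  rw [incr, h, sub_self]

/-- Increments over the partition intervals contained in `[a,b]` telescope. -/
lemma exists_sum_inner_incr_eq {n : ℕ} {δ a b : ℝ}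
    (h : ∀ s ∈ 𝕋.part n, succOf T (𝕋.part n) s - s < δ) (ha : 0 ≤ a) (hb : b ≤ T)
    (hab : a + δ ≤ b) :
    ∃ x y, a ≤ x ∧ x ≤ y ∧ y ≤ b ∧ x < a + δ ∧ b - δ < y ∧ ∀ F : ℝ → ℝ,
      ∑ s ∈ (𝕋.part n).filter (fun s => a ≤ s ∧ succOf T (𝕋.part n) s ≤ b), 𝕋.incr F n s
        = F y - F x := by
  obtain ⟨x, hx, y, hy, h1, h2, h3, h4, h5, h6⟩ := 𝕋.exists_filter_eq h ha hb hab
  exact ⟨x, y, h1, h2, h3, h4, h5, fun F =>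
    (h6 _ fun s hs => incr_eq_zero hs).trans (𝕋.telescope_succ F hx hy h2)⟩

lemma eventually_sum_inner_incr_le {F : ℝ → ℝ} {a b : ℝ} (ha : 0 ≤ a) (hab : a < b) (hb : b ≤ T)
    (hF : MonotoneOn F (Icc a b)) :
    ∀ᶠ n in atTop,
      ∑ s ∈ (𝕋.part n).filter (fun s => a ≤ s ∧ succOf T (𝕋.part n) s ≤ b), 𝕋.incr F n s
        ≤ F b - F a := by
  filter_upwards [𝕋.eventually_mesh (sub_pos.2 hab)] with n hn
  obtain ⟨x, y, h1, h2, h3, -, -, h6⟩ := exists_sum_inner_incr_eq hn ha hb (by linarith)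
  rw [h6]
  have := hF ⟨h1.trans h2, h3⟩ (right_mem_Icc.2 hab.le) h3
  have := hF (left_mem_Icc.2 hab.le) ⟨h1, h2.trans h3⟩ h1
  linarith

/-- Limits of sums over `[r,t]` determine limits of sums over subintervals. -/
lemma tendsto_sum_inner_of_forall {m : ℕ → ℝ → ℝ} {M : ℝ → ℝ} {r u : ℝ}
    (hm : 𝕋.NullTerms r u m)
    (h : ∀ t ∈ Icc r u, Tendsto (fun n => ∑ s ∈ (𝕋.part n).filter (fun s => r ≤ s ∧ s ≤ t), m n s)
      atTop (𝓝 (M t))) {a b : ℝ} (ha : a ∈ Icc r u) (hb : b ∈ Icc r u) (hab : a ≤ b) :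
    Tendsto (fun n => ∑ s ∈ (𝕋.part n).filter (fun s => a ≤ s ∧ succOf T (𝕋.part n) s ≤ b), m n s)
      atTop (𝓝 (M b - M a)) := by
  have hm' := hm.mono ha.1 hb.2
  refine tendsto_sum_inner hm' ((tendsto_sum_Icc_iff hm').2 ?_)
  have h1 := (tendsto_sum_Icc_iff (hm.mono le_rfl ha.2)).1 (h a ha)
  have h2 := (tendsto_sum_Icc_iff (hm.mono le_rfl hb.2)).1 (h b hb)
  refine (h2.sub h1).congr fun n => ?_
  rw [sum_Ioc_eq _ ha.1 hab, add_sub_cancel_left]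

end PartitionSeq

variable {T : ℝ} {𝕋 : PartitionSeq T} {d : ℕ} {p q : ℝ} {D : Set (Fin d → ℝ)}
variable {α : ℝ → (Fin d → ℝ) → Fin d → Fin d → ℝ} {S : ℝ → Fin d → ℝ}

/-- The increment of `∫ ζ·dS` over a partition interval. -/
def integralIncr (𝕋 : PartitionSeq T) (ζ S : ℝ → Fin d → ℝ) (n : ℕ) (s : ℝ) : ℝ :=
  ∑ k, ζ s k * 𝕋.incr (fun t => S t k) n s

lemma IsModelPath.nullTerms_integralIncr (h : IsModelPath 𝕋 D α S) {ζ : ℝ → Fin d → ℝ}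
    (hζ : ∀ k, ContinuousOn (fun t => ζ t k) (Icc p q)) :
    𝕋.NullTerms p q (integralIncr 𝕋 ζ S) :=
  PartitionSeq.NullTerms.sum Finset.univ fun k _ =>
    (PartitionSeq.nullTerms_incr (h.continuousOn_coord k)).mul_left (hζ k)

/-- The squared increments of `∫ ζ·dS` sum to `∫ ζᵀαζ`. -/
lemma IsModelPath.tendsto_sum_integralIncr_sq (hT : 0 < T) (hp : 0 ≤ p) (hpq : p ≤ q) (hq : q ≤ T)
    (h : IsModelPath 𝕋 D α S)
    (hα : ∀ i j, ContinuousOn (fun p : ℝ × (Fin d → ℝ) => α p.1 p.2 i j) (Icc 0 T ×ˢ D))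
    {ζ : ℝ → Fin d → ℝ} (hζ : ∀ k, ContinuousOn (fun t => ζ t k) (Icc p q)) :
    Tendsto (fun n => ∑ s ∈ (𝕋.part n).filter (fun s => p ≤ s ∧ succOf T (𝕋.part n) s ≤ q),
      integralIncr 𝕋 ζ S n s ^ 2) atTop
      (𝓝 (∫ s in p..q, ∑ i, ∑ j, α s (S s) i j * ζ s i * ζ s j)) := by
  have hsub : Icc p q ⊆ Icc 0 T := Icc_subset_Icc hp hq
  have h1 : ∀ i j, Tendsto (fun n => ∑ s ∈ (𝕋.part n).filter
      (fun s => p ≤ s ∧ succOf T (𝕋.part n) s ≤ q), (ζ s i * ζ s j) * covIncr 𝕋 S i j n s) atTop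
      (𝓝 (∫ s in p..q, ζ s i * ζ s j * α s (S s) i j)) := fun i j =>
    PartitionSeq.tendsto_sum_inner ((h.nullTerms_covIncr i j).mul_left ((hζ i).mul (hζ j)))
      (h.tendsto_sum_mul_covIncr hT hp hq (hα i j) ((hζ i).mul (hζ j)) (right_mem_Icc.2 hpq))
  have h2 := tendsto_finsetSum Finset.univ fun i _ =>
    tendsto_finsetSum Finset.univ fun j _ => h1 i j
  have hI2 : ∀ i j, IntervalIntegrable (fun s => ζ s i * ζ s j * α s (S s) i j)
      MeasureTheory.volume p q := fun i j =>
    ContinuousOn.intervalIntegrable (by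
      rw [uIcc_of_le hpq]
      exact ((hζ i).mul (hζ j)).mul ((h.continuousOn_density (hα i j)).mono hsub))
  have hI3 : ∀ i, IntervalIntegrable (fun s => ∑ j, ζ s i * ζ s j * α s (S s) i j)
      MeasureTheory.volume p q := fun i => by
    simpa only [Finset.sum_fn] using IntervalIntegrable.sum Finset.univ fun j _ => hI2 i j
  have e : ∫ s in p..q, ∑ i, ∑ j, α s (S s) i j * ζ s i * ζ s j
      = ∑ i, ∑ j, ∫ s in p..q, ζ s i * ζ s j * α s (S s) i j := by
    simp only [← intervalIntegral.integral_finsetSum fun j _ => hI2 _ j]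
    rw [← intervalIntegral.integral_finsetSum fun i _ => hI3 i]
    refine intervalIntegral.integral_congr fun s _ => ?_
    exact Finset.sum_congr rfl fun i _ => Finset.sum_congr rfl fun j _ => by ring
  rw [e]
  refine h2.congr fun n => ?_
  refine (Finset.sum_congr rfl fun i _ => Finset.sum_comm).trans (Finset.sum_comm.trans ?_)
  refine Finset.sum_congr rfl fun s _ => ?_
  rw [pow_two, integralIncr, Finset.sum_mul_sum]
  refine Finset.sum_congr rfl fun i _ => Finset.sum_congr rfl fun j _ => ?_
  rw [covIncr]
  ring

/-- An integrand whose integral is Lipschitz and agrees, up to quadratic variation and bounded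
variation terms, with the increments of a continuous function must vanish. -/
theorem IsModelPath.eq_zero_of_abs_incr_sub_le (hT : 0 < T) (hp : 0 ≤ p) (hpq : p < q) (hq : q ≤ T)
    (h : IsModelPath 𝕋 D α S)
    (hα : ∀ i j, ContinuousOn (fun p : ℝ × (Fin d → ℝ) => α p.1 p.2 i j) (Icc 0 T ×ˢ D))
    (hpd : ∀ t ∈ Icc 0 T, ∀ x ∈ D, ∀ y : Fin d → ℝ, y ≠ 0 → 0 < ∑ i, ∑ j, α t x i j * y i * y j)
    {ζ : ℝ → Fin d → ℝ} (hζ : ∀ k, ContinuousOn (fun t => ζ t k) (Icc p q))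
    {Φ W L : ℝ → ℝ} {C K : ℝ} (hΦ : ContinuousOn Φ (Icc p q)) (hW : MonotoneOn W (Icc p q))
    (hbound : ∀ᶠ n in atTop, ∀ s ∈ 𝕋.part n, p ≤ s → succOf T (𝕋.part n) s ≤ q →
      |𝕋.incr Φ n s - integralIncr 𝕋 ζ S n s| ≤ 𝕋.incr W n s + C * ∑ i, covIncr 𝕋 S i i n s)
    (hL : ∀ a ∈ Icc p q, ∀ b ∈ Icc p q, a ≤ b →
      Tendsto (fun n => ∑ s ∈ (𝕋.part n).filter (fun s => a ≤ s ∧ succOf T (𝕋.part n) s ≤ b),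
        integralIncr 𝕋 ζ S n s) atTop (𝓝 (L b - L a)))
    (hLK : ∀ a ∈ Icc p q, ∀ b ∈ Icc p q, a ≤ b → |L b - L a| ≤ K * (b - a)) :
    ∀ t ∈ Icc p q, ζ t = 0 := by
  have hsub : Icc p q ⊆ Icc 0 T := Icc_subset_Icc hp hq
  set V : ℝ → ℝ := fun t => ∑ i, ∫ s in (0 : ℝ)..t, α s (S s) i i with hV
  have hVlim : ∀ a ∈ Icc p q, ∀ b ∈ Icc p q, a ≤ b →
      Tendsto (fun n => C * ∑ s ∈ (𝕋.part n).filter (fun s => a ≤ s ∧ succOf T (𝕋.part n) s ≤ b),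
        ∑ i, covIncr 𝕋 S i i n s) atTop (𝓝 (C * (V b - V a))) := by
    intro a ha b hb hab
    refine Tendsto.const_mul _ ?_
    simp only [hV, ← Finset.sum_sub_distrib]
    simp only [Finset.sum_comm (s := (𝕋.part _).filter _)]
    refine tendsto_finsetSum _ fun i _ => ?_
    refine PartitionSeq.tendsto_sum_inner (h.nullTerms_covIncr i i)
      ((PartitionSeq.tendsto_sum_Icc_iff (h.nullTerms_covIncr i i)).2 ?_)
    exact PartitionSeq.tendsto_sum_Ioc hab (h.cov i i a (hsub ha)) (h.cov i i b (hsub hb))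
  set M : ℝ → ℝ := fun t => K * t + W t + C * V t with hM
  have hstep : ∀ a ∈ Icc p q, ∀ b ∈ Icc p q, a ≤ b → |Φ b - Φ a| ≤ M b - M a := by
    intro a ha b hb hab
    rcases hab.eq_or_lt with rfl | hab'
    · simp
    refine le_of_forall_pos_le_add fun ε hε => ?_
    obtain ⟨δ, hδ, hδΦ⟩ := Metric.uniformContinuousOn_iff_le.1
      (isCompact_Icc.uniformContinuousOn_of_continuous hΦ) (ε / 4) (by positivity)
    have hδ' : 0 < min δ (b - a) := lt_min hδ (sub_pos.2 hab')
    have h1 := (hL a ha b hb hab).abs.eventually_le_const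
      (show |L b - L a| < |L b - L a| + ε / 4 by linarith)
    have h2 := (hVlim a ha b hb hab).eventually_le_const
      (show C * (V b - V a) < C * (V b - V a) + ε / 4 by linarith)
    obtain ⟨n, h1, h2, h3, h4, h5⟩ := (h1.and (h2.and ((𝕋.eventually_mesh hδ').and
      (hbound.and (PartitionSeq.eventually_sum_inner_incr_le (hp.trans ha.1) hab' (hb.2.trans hq)
        (hW.mono (Icc_subset_Icc ha.1 hb.2))))))).exists
    obtain ⟨x, y, hx, hxy, hy, hx', hy', htel⟩ := PartitionSeq.exists_sum_inner_incr_eq h3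
      (hp.trans ha.1) (hb.2.trans hq) (by linarith [min_le_right δ (b - a)])
    have hxΦ : |Φ x - Φ a| ≤ ε / 4 := hδΦ x ⟨ha.1.trans hx, hxy.trans (hy.trans hb.2)⟩ a ha (by
      rw [Real.dist_eq, abs_of_nonneg (by linarith)]
      linarith [min_le_left δ (b - a)])
    have hyΦ : |Φ b - Φ y| ≤ ε / 4 := hδΦ b hb y ⟨ha.1.trans (hx.trans hxy), hy.trans hb.2⟩ (by
      rw [Real.dist_eq, abs_of_nonneg (by linarith)]
      linarith [min_le_left δ (b - a)])
    have h6 : |Φ y - Φ x - ∑ s ∈ (𝕋.part n).filter (fun s => a ≤ s ∧ succOf T (𝕋.part n) s ≤ b),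
        integralIncr 𝕋 ζ S n s| ≤ (W b - W a) + (C * (V b - V a) + ε / 4) := by
      rw [← htel Φ, ← Finset.sum_sub_distrib]
      refine (abs_sum_le_sum_abs _ _).trans (le_trans ?_ (add_le_add h5 h2))
      rw [Finset.mul_sum, ← Finset.sum_add_distrib]
      refine Finset.sum_le_sum fun s hs => ?_
      rw [Finset.mem_filter] at hs
      exact h4 s hs.1 (ha.1.trans hs.2.1) (hs.2.2.trans hb.2)
    have h7 := hLK a ha b hb hab
    simp only [hM]
    have e : Φ b - Φ a = (Φ b - Φ y) + ((Φ y - Φ x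
        - ∑ s ∈ (𝕋.part n).filter (fun s => a ≤ s ∧ succOf T (𝕋.part n) s ≤ b),
          integralIncr 𝕋 ζ S n s)
        + ∑ s ∈ (𝕋.part n).filter (fun s => a ≤ s ∧ succOf T (𝕋.part n) s ≤ b),
          integralIncr 𝕋 ζ S n s) + (Φ x - Φ a) := by ring
    rw [e]
    refine (abs_add_three _ _ _).trans ?_
    have := abs_add_le (Φ y - Φ x
        - ∑ s ∈ (𝕋.part n).filter (fun s => a ≤ s ∧ succOf T (𝕋.part n) s ≤ b),
          integralIncr 𝕋 ζ S n s) (∑ s ∈ (𝕋.part n).filter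
          (fun s => a ≤ s ∧ succOf T (𝕋.part n) s ≤ b), integralIncr 𝕋 ζ S n s)
    linarith
  have hMmono : MonotoneOn M (Icc p q) := fun a ha b hb hab =>
    sub_nonneg.1 ((abs_nonneg _).trans (hstep a ha b hb hab))
  have hpI : p ∈ Icc p q := left_mem_Icc.2 hpq.le
  have hqI : q ∈ Icc p q := right_mem_Icc.2 hpq.le
  have hzero : Tendsto (fun n => ∑ s ∈ (𝕋.part n).filter
      (fun s => p ≤ s ∧ succOf T (𝕋.part n) s ≤ q), integralIncr 𝕋 ζ S n s ^ 2) atTop (𝓝 0) := by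
    rw [Metric.tendsto_nhds]
    intro ε hε
    set B : ℝ := |(M q - M p) + ((W q - W p) + (C * (V q - V p) + 1))| + 1 with hB
    have hB0 : 0 < B := by positivity
    filter_upwards [h.nullTerms_integralIncr hζ (ε / (2 * B)) (by positivity), hbound,
      PartitionSeq.eventually_sum_inner_incr_le hp hpq hq hW,
      PartitionSeq.eventually_sum_inner_incr_le hp hpq hq hMmono,
      (hVlim p hpI q hqI hpq.le).eventually_le_const (lt_add_one _)] with n h1 h2 h3 h4 h5
    rw [Real.dist_eq, sub_zero, abs_of_nonneg (Finset.sum_nonneg fun _ _ => sq_nonneg _)]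
    calc ∑ s ∈ (𝕋.part n).filter (fun s => p ≤ s ∧ succOf T (𝕋.part n) s ≤ q),
          integralIncr 𝕋 ζ S n s ^ 2
        ≤ ∑ s ∈ (𝕋.part n).filter (fun s => p ≤ s ∧ succOf T (𝕋.part n) s ≤ q),
          ε / (2 * B) * (𝕋.incr M n s + (𝕋.incr W n s + C * ∑ i, covIncr 𝕋 S i i n s)) := by
          refine Finset.sum_le_sum fun s hs => ?_
          rw [Finset.mem_filter] at hs
          have hs' := le_succOf (𝕋.top_mem n) (𝕋.le_of_mem s hs.1)
          have h6 := h2 s hs.1 hs.2.1 hs.2.2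
          have h7 := hstep s ⟨hs.2.1, hs'.trans hs.2.2⟩ _ ⟨hs.2.1.trans hs', hs.2.2⟩ hs'
          have h8 := h1 s hs.1 hs.2.1 (hs'.trans hs.2.2)
          rw [← sq_abs, pow_two]
          refine mul_le_mul h8 ?_ (abs_nonneg _) (by positivity)
          have h9 := abs_sub_abs_le_abs_sub (integralIncr 𝕋 ζ S n s) (𝕋.incr Φ n s)
          rw [abs_sub_comm] at h9
          have h10 : |𝕋.incr Φ n s| ≤ 𝕋.incr M n s := h7
          linarith
      _ ≤ ε / (2 * B) * ((M q - M p) + ((W q - W p) + (C * (V q - V p) + 1))) := by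
          rw [← Finset.mul_sum, Finset.sum_add_distrib, Finset.sum_add_distrib, ← Finset.mul_sum]
          exact mul_le_mul_of_nonneg_left (add_le_add h4 (add_le_add h3 h5)) (by positivity)
      _ ≤ ε / (2 * B) * B := by
          refine mul_le_mul_of_nonneg_left ?_ (by positivity)
          rw [hB]
          linarith [le_abs_self ((M q - M p) + ((W q - W p) + (C * (V q - V p) + 1)))]
      _ < ε := by
          rw [div_mul_eq_mul_div, div_lt_iff₀ (by positivity)]
          nlinarith [mul_pos hε hB0]
  have hint := tendsto_nhds_unique hzero (h.tendsto_sum_integralIncr_sq hT hp hpq.le hq hα hζ)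
  have hnonneg : ∀ t ∈ Icc p q, ζ t ≠ 0 → 0 < ∑ i, ∑ j, α t (S t) i j * ζ t i * ζ t j :=
    fun t ht hne => hpd t (hsub ht) _ (h.mem t (hsub ht)) _ hne
  by_contra! hne
  obtain ⟨t, ht, hne⟩ := hne
  refine absurd hint (ne_of_lt (intervalIntegral.integral_pos hpq ?_ (fun s hs => ?_)
    ⟨t, ht, hnonneg t ht hne⟩))
  · exact continuousOn_finsetSum _ fun i _ => continuousOn_finsetSum _ fun j _ =>
      (((h.continuousOn_density (hα i j)).mono hsub).mul (hζ i)).mul (hζ j)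
  · by_cases hz : ζ s = 0
    · simp [hz]
    · exact (hnonneg s (Ioc_subset_Icc_self hs) hz).le

end Identification

section Admissible

lemma exists_abs_taylor_one_le {E : Type*} [NormedAddCommGroup E]
    [NormedSpace ℝ E] {f : E → ℝ} {x : E} (hf : ContDiffAt ℝ 2 f x) :
    ∃ c : ℝ, ∃ ρ > 0, ∀ h : E, ‖h‖ ≤ ρ → |f (x + h) - f x - fderiv ℝ f x h| ≤ c * ‖h‖ ^ 2 := by
  obtain ⟨c, hc⟩ := ((hf.fderiv_right (m := 1) (by norm_num)).differentiableAt
    (by norm_num)).isBigO_sub.bound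
  obtain ⟨ρ, hρ, hball⟩ := Metric.eventually_nhds_iff.1
    (hc.and ((hf.eventually (by simp)).mono fun y hy => hy.differentiableAt (by norm_num)))
  refine ⟨|c|, ρ / 2, by positivity, fun h hh => ?_⟩
  have hmem : ∀ y ∈ Metric.closedBall x ‖h‖, dist y x < ρ := fun y hy =>
    (Metric.mem_closedBall.1 hy).trans_lt (by linarith)
  have h1 := Convex.norm_image_sub_le_of_norm_hasFDerivWithin_le' (f := f) (f' := fderiv ℝ f)
    (φ := fderiv ℝ f x) (C := |c| * ‖h‖) (s := Metric.closedBall x ‖h‖) (x := x) (y := x + h)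
    (fun y hy => (hball (hmem y hy)).2.hasFDerivAt.hasFDerivWithinAt)
    (fun y hy => (hball (hmem y hy)).1.trans (by
      refine (mul_le_mul_of_nonneg_right (le_abs_self c) (norm_nonneg _)).trans ?_
      rw [← dist_eq_norm]
      exact mul_le_mul_of_nonneg_left hy (abs_nonneg c)))
    (convex_closedBall _ _) (Metric.mem_closedBall_self (norm_nonneg h)) (by simp)
  rw [add_sub_cancel_left] at h1
  refine h1.trans (le_of_eq ?_)
  ring

/-- Baire's theorem on a compact interval. -/
lemma exists_Icc_subset_of_isClosed {E : ℕ → Set ℝ} {p q : ℝ} (hpq : p < q)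
    (hE : ∀ j, IsClosed (Icc p q ∩ E j)) (hcover : ∀ t ∈ Icc p q, ∃ j, t ∈ E j) :
    ∃ j, ∃ p' q', p ≤ p' ∧ p' < q' ∧ q' ≤ q ∧ Icc p' q' ⊆ E j := by
  have : Nonempty (Icc p q) := ⟨⟨p, left_mem_Icc.2 hpq.le⟩⟩
  have : CompleteSpace (Icc p q) := isClosed_Icc.completeSpace_coe
  obtain ⟨j, x, hx⟩ := nonempty_interior_of_iUnion_of_closed
    (f := fun j => ((↑) : Icc p q → ℝ) ⁻¹' (Icc p q ∩ E j))
    (fun j => (hE j).preimage continuous_subtype_val) (by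
      refine eq_univ_of_forall fun t => mem_iUnion.2 ?_
      obtain ⟨j, hj⟩ := hcover t t.2
      exact ⟨j, t.2, hj⟩)
  obtain ⟨ε, hε, hball⟩ := Metric.mem_nhds_iff.1 (mem_interior_iff_mem_nhds.1 hx)
  refine ⟨j, max p (x - ε / 2), min q (x + ε / 2), le_max_left _ _, ?_, min_le_left _ _,
    fun t ht => ?_⟩
  · have := x.2.1
    have := x.2.2
    refine max_lt (lt_min hpq ?_) (lt_min ?_ ?_) <;> linarith
  · have htI : t ∈ Icc p q := ⟨(le_max_left _ _).trans ht.1, ht.2.trans (min_le_left _ _)⟩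
    have h1 : x - ε / 2 ≤ t := (le_max_right _ _).trans ht.1
    have h2 : t ≤ x + ε / 2 := ht.2.trans (min_le_right _ _)
    have h3 : (⟨t, htI⟩ : Icc p q) ∈ Metric.ball x ε := by
      rw [Metric.mem_ball, Subtype.dist_eq, Real.dist_eq, abs_lt]
      constructor <;> simp only <;> linarith
    exact (hball h3).2

variable {d : ℕ} {r u : ℝ} {S ξ : ℝ → Fin d → ℝ}

lemma exists_monotoneOn_of_boundedVariationOn {m : ℕ} {A : ℝ → Fin m → ℝ} {I : Set ℝ}
    (hA : ∀ i, BoundedVariationOn (fun t => A t i) I) :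
    ∃ W : ℝ → ℝ, MonotoneOn W I ∧ ∀ s ∈ I, ∀ t ∈ I, s ≤ t → ‖A t - A s‖ ≤ W t - W s := by
  choose P Q hP hQ hPQ using fun i =>
    (hA i).locallyBoundedVariationOn.exists_monotoneOn_sub_monotoneOn
  have hmono : ∀ i, ∀ s ∈ I, ∀ t ∈ I, s ≤ t → P i s + Q i s ≤ P i t + Q i t :=
    fun i s hs t ht hst => add_le_add (hP i hs ht hst) (hQ i hs ht hst)
  refine ⟨fun t => ∑ i, (P i t + Q i t), fun s hs t ht hst =>
    Finset.sum_le_sum fun i _ => hmono i s hs t ht hst, fun s hs t ht hst => ?_⟩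
  rw [← Finset.sum_sub_distrib, pi_norm_le_iff_of_nonneg
    (Finset.sum_nonneg fun i _ => sub_nonneg.2 (hmono i s hs t ht hst))]
  intro i
  refine le_trans ?_ (Finset.single_le_sum
    (fun i _ => sub_nonneg.2 (hmono i s hs t ht hst)) (Finset.mem_univ i))
  have h1 := congrFun (hPQ i) s
  have h2 := congrFun (hPQ i) t
  have h3 := hP i hs ht hst
  have h4 := hQ i hs ht hst
  simp only [Pi.sub_apply] at h1 h2
  rw [Pi.sub_apply, Real.norm_eq_abs, h1, h2, abs_le]
  constructor <;> linarith

/-- Along a basic admissible integrand `ξ = ∇ₓf(A,S)`, the increments of `f(A,S)` agree with those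
of `∫ ξ·dS` up to bounded variation and quadratic terms, locally on a dense set of times. -/
theorem IsBasicAdmissible.exists_expansion (hS : ContinuousOn S (Icc r u))
    (h : IsBasicAdmissible d r u S ξ) :
    (∀ k, ContinuousOn (fun t => ξ t k) (Icc r u)) ∧
    ∃ Φ W : ℝ → ℝ, ContinuousOn Φ (Icc r u) ∧ MonotoneOn W (Icc r u) ∧
      ∀ p q, r ≤ p → p < q → q ≤ u → ∃ p' q', p ≤ p' ∧ p' < q' ∧ q' ≤ q ∧ ∃ C : ℝ, ∃ δ > 0,
        0 ≤ C ∧ ∀ s ∈ Icc p' q', ∀ t ∈ Icc p' q', s ≤ t → t - s < δ →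
          |Φ t - Φ s - ∑ k, ξ s k * (S t k - S s k)|
            ≤ W t - W s + C * ∑ i, (S t i - S s i) * (S t i - S s i) := by
  obtain ⟨m, A, O, f, hA, hAbv, hO, hmem, hf1, hf2, hξ⟩ := h
  have hgraph : ContinuousOn (fun t => (A t, S t)) (Icc r u) := hA.prodMk hS
  have hfcont : ContinuousOn f O := hf1.continuousOn
  have hfd : ContinuousOn (fderiv ℝ f) O := hf1.continuousOn_fderiv_of_isOpen hO le_rfl
  have hdiff : ∀ z ∈ O, DifferentiableAt ℝ f z := fun z hz =>
    (hf1.contDiffAt (hO.mem_nhds hz)).differentiableAt (by norm_num)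
  have hξ' : ∀ t ∈ Icc r u, ∀ k,
      ξ t k = fderiv ℝ f (A t, S t) ((0 : Fin m → ℝ), Pi.single k 1) := by
    intro t ht k
    have h1 : HasFDerivAt (fun x => f (A t, x)) _ (S t) :=
      (hdiff _ (hmem t ht)).hasFDerivAt.comp (S t) (hasFDerivAt_prodMk_right (A t) (S t))
    rw [hξ t ht k, h1.fderiv]
    rfl
  have hξc : ∀ k, ContinuousOn (fun t => ξ t k) (Icc r u) := fun k =>
    ((hfd.comp hgraph hmem).clm_apply continuousOn_const).congr fun t ht => hξ' t ht k
  refine ⟨hξc, ?_⟩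
  have hKc : IsCompact ((fun t => (A t, S t)) '' Icc r u) :=
    isCompact_Icc.image_of_continuousOn hgraph
  obtain ⟨δ0, hδ0, hsub⟩ := hKc.exists_cthickening_subset_open hO (image_subset_iff.2 hmem)
  obtain ⟨C, hC⟩ := (hKc.cthickening (r := δ0)).exists_bound_of_continuousOn (hfd.mono hsub)
  have hnear : ∀ t ∈ Icc r u, Metric.closedBall (A t, S t) δ0
      ⊆ Metric.cthickening δ0 ((fun t => (A t, S t)) '' Icc r u) := fun t ht z hz =>
    Metric.mem_cthickening_of_dist_le _ _ _ _ (mem_image_of_mem _ ht) hz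
  obtain ⟨V, hV, hAV⟩ := exists_monotoneOn_of_boundedVariationOn hAbv
  have hC' : ∀ z ∈ Metric.cthickening δ0 ((fun t => (A t, S t)) '' Icc r u),
      ‖fderiv ℝ f z‖ ≤ |C| := fun z hz => (hC z hz).trans (le_abs_self C)
  refine ⟨fun t => f (A t, S t), fun t => |C| * V t, hfcont.comp hgraph hmem,
    fun s hs t ht hst => mul_le_mul_of_nonneg_left (hV hs ht hst) (abs_nonneg C), ?_⟩
  intro p q hp hpq hq
  have hpqI : Icc p q ⊆ Icc r u := Icc_subset_Icc hp hq
  -- the sets where the first order expansion in space is controlled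
  set E : ℕ → Set ℝ := fun j => {t | ∀ y : Fin d → ℝ, ‖y‖ ≤ δ0 / (j + 1) →
    |f (A t, S t + y) - f (A t, S t) - ∑ k, ξ t k * y k| ≤ j * ‖y‖ ^ 2} with hE
  have hle : ∀ j : ℕ, δ0 / (j + 1) ≤ δ0 := fun j =>
    div_le_self hδ0.le (by linarith [(Nat.cast_nonneg j : (0 : ℝ) ≤ j)])
  have hO' : ∀ t ∈ Icc r u, ∀ y : Fin d → ℝ, ‖y‖ ≤ δ0 → (A t, S t + y) ∈ O := fun t ht y hy =>
    hsub (hnear t ht (by simpa [Prod.dist_eq, hδ0.le] using hy))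
  have hclosed : ∀ j, IsClosed (Icc p q ∩ E j) := by
    intro j
    have e : Icc p q ∩ E j = Icc p q ∩ ⋂ (y : Fin d → ℝ) (_ : ‖y‖ ≤ δ0 / (j + 1)),
        (Icc p q ∩ (fun t => |f (A t, S t + y) - f (A t, S t) - ∑ k, ξ t k * y k|) ⁻¹'
          Iic (j * ‖y‖ ^ 2)) := by
      ext t
      simp only [mem_inter_iff, mem_iInter]
      exact ⟨fun ⟨h1, h2⟩ => ⟨h1, fun y hy => ⟨h1, h2 y hy⟩⟩,
        fun ⟨h1, h2⟩ => ⟨h1, fun y hy => (h2 y hy).2⟩⟩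
    rw [e]
    refine isClosed_Icc.inter (isClosed_iInter fun y => isClosed_iInter fun hy => ?_)
    refine ContinuousOn.preimage_isClosed_of_isClosed ?_ isClosed_Icc isClosed_Iic
    refine (ContinuousOn.sub (ContinuousOn.sub ?_ ?_) ?_).abs
    · exact hfcont.comp ((hA.prodMk (hS.add continuousOn_const)).mono hpqI) fun t ht =>
        hO' t (hpqI ht) y (hy.trans (hle j))
    · exact (hfcont.comp hgraph hmem).mono hpqI
    · exact continuousOn_finsetSum _ fun k _ => ((hξc k).mono hpqI).mul continuousOn_const
  have hcover : ∀ t ∈ Icc p q, ∃ j, t ∈ E j := by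
    intro t ht
    have htI := hpqI ht
    have h1 : ContDiffAt ℝ 2 (fun x => f (A t, x)) (S t) :=
      (hf2 (A t)).contDiffAt ((hO.preimage (Continuous.prodMk_right (A t))).mem_nhds (hmem t htI))
    obtain ⟨c, ρ, hρ, hcρ⟩ := exists_abs_taylor_one_le h1
    obtain ⟨j, hj⟩ := exists_nat_ge (max c (δ0 / ρ))
    refine ⟨j, fun y hy => ?_⟩
    have hyρ : ‖y‖ ≤ ρ := by
      refine hy.trans ?_
      rw [div_le_iff₀ (by positivity)]
      have := (div_le_iff₀ hρ).1 ((le_max_right _ _).trans hj)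
      nlinarith
    have h2 : fderiv ℝ (fun x => f (A t, x)) (S t) y = ∑ k, ξ t k * y k := by
      rw [eq_coordFun (fderiv ℝ (fun x => f (A t, x)) (S t)), coordFun_apply]
      exact Finset.sum_congr rfl fun k _ => by rw [hξ t htI k]
    rw [← h2]
    exact (hcρ y hyρ).trans (mul_le_mul_of_nonneg_right ((le_max_left _ _).trans hj) (sq_nonneg _))
  obtain ⟨j, p', q', hp', hpq', hq', hsubE⟩ := exists_Icc_subset_of_isClosed hpq hclosed hcover
  have hI : Icc p' q' ⊆ Icc r u := (Icc_subset_Icc hp' hq').trans hpqI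
  obtain ⟨δ, hδ, hunif⟩ := Metric.uniformContinuousOn_iff_le.1
    (isCompact_Icc.uniformContinuousOn_of_continuous hgraph) (δ0 / (j + 1)) (by positivity)
  refine ⟨p', q', hp', hpq', hq', j, δ, hδ, Nat.cast_nonneg j, fun s hs t ht hst htδ => ?_⟩
  have hdist : dist (A t, S t) (A s, S s) ≤ δ0 / (j + 1) := hunif t (hI ht) s (hI hs) (by
    rw [Real.dist_eq, abs_of_nonneg (by linarith)]
    exact htδ.le)
  rw [Prod.dist_eq, max_le_iff] at hdist
  have h1 : |f (A s, S t) - f (A s, S s) - ∑ k, ξ s k * (S t k - S s k)|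
      ≤ j * ∑ i, (S t i - S s i) * (S t i - S s i) := by
    have h2 := hsubE hs (S t - S s) (by rw [← dist_eq_norm]; exact hdist.2)
    rw [add_sub_cancel] at h2
    refine h2.trans (mul_le_mul_of_nonneg_left ?_ (Nat.cast_nonneg j))
    have h3 : ∀ i, 0 ≤ (S t i - S s i) * (S t i - S s i) := fun i => mul_self_nonneg _
    have h4 : ‖S t - S s‖ ≤ √(∑ i, (S t i - S s i) * (S t i - S s i)) := by
      rw [pi_norm_le_iff_of_nonneg (Real.sqrt_nonneg _)]
      intro i
      refine Real.le_sqrt_of_sq_le ?_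
      rw [Real.norm_eq_abs, sq_abs, pow_two]
      exact Finset.single_le_sum (fun i _ => h3 i) (Finset.mem_univ i)
    refine (pow_le_pow_left₀ (norm_nonneg _) h4 2).trans ?_
    rw [Real.sq_sqrt (Finset.sum_nonneg fun i _ => h3 i)]
  have h5 : |f (A t, S t) - f (A s, S t)| ≤ |C| * ‖A t - A s‖ := by
    have h6 := Convex.norm_image_sub_le_of_norm_hasFDerivWithin_le (f := f) (f' := fderiv ℝ f)
      (C := |C|) (s := Metric.closedBall (A s, S s) δ0) (x := (A s, S t)) (y := (A t, S t))
      (fun z hz => (hdiff z (hsub (hnear s (hI hs) hz))).hasFDerivAt.hasFDerivWithinAt)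
      (fun z hz => hC' z (hnear s (hI hs) hz)) (convex_closedBall _ _)
      (by simpa [Prod.dist_eq, hδ0.le] using hdist.2.trans (hle j))
      (by
        rw [Metric.mem_closedBall, Prod.dist_eq]
        exact max_le (hdist.1.trans (hle j)) (hdist.2.trans (hle j)))
    simpa [Prod.norm_def] using h6
  have h7 := mul_le_mul_of_nonneg_left (hAV s (hI hs) t (hI ht) hst) (abs_nonneg C)
  have e : f (A t, S t) - f (A s, S s) - ∑ k, ξ s k * (S t k - S s k)
      = (f (A t, S t) - f (A s, S t))
        + (f (A s, S t) - f (A s, S s) - ∑ k, ξ s k * (S t k - S s k)) := by ring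
  rw [e]
  refine (abs_add_le _ _).trans (add_le_add (h5.trans (h7.trans (le_of_eq ?_))) h1)
  ring

end Admissible

section GradientIdentification

variable {T : ℝ} {𝕋 : PartitionSeq T} {d : ℕ} {r u : ℝ} {D : Set (Fin d → ℝ)}
variable {α : ℝ → (Fin d → ℝ) → Fin d → Fin d → ℝ} {S : ℝ → Fin d → ℝ}
variable {v gt : ℝ × (Fin d → ℝ) → ℝ} {gx : Fin d → ℝ × (Fin d → ℝ) → ℝ}
    {gxx : Fin d → Fin d → ℝ × (Fin d → ℝ) → ℝ}

lemma sum_abs_covIncr_le (n : ℕ) (s : ℝ) :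
    ∑ i, ∑ j, |covIncr 𝕋 S i j n s| ≤ d * ∑ i, covIncr 𝕋 S i i n s := by
  have h1 : ∀ i j, |covIncr 𝕋 S i j n s|
      ≤ 1 / 2 * (covIncr 𝕋 S i i n s + covIncr 𝕋 S j j n s) := by
    intro i j
    simp only [covIncr]
    set x := 𝕋.incr (fun t => S t i) n s
    set y := 𝕋.incr (fun t => S t j) n s
    rw [abs_le]
    constructor <;> nlinarith [sq_nonneg (x + y), sq_nonneg (x - y)]
  refine (Finset.sum_le_sum fun i _ => Finset.sum_le_sum fun j _ => h1 i j).trans (le_of_eq ?_)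
  simp only [← Finset.mul_sum, Finset.sum_add_distrib, Finset.sum_const, Finset.card_univ,
    Fintype.card_fin, nsmul_eq_mul]
  ring

lemma covIncr_self_nonneg (i : Fin d) (n : ℕ) (s : ℝ) : 0 ≤ covIncr 𝕋 S i i n s :=
  mul_self_nonneg _

/-- First order expansion of `v` along `S`. -/
lemma IsModelPath.exists_abs_incr_along_sub_le (hru : r ≤ u) (hD : IsOpen D)
    (h : IsModelPath 𝕋 D α S) (hv : HasGradients r u D v gt gx gxx) :
    ∃ B ≥ 0, ∀ᶠ n in atTop, ∀ s ∈ 𝕋.part n,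
      |𝕋.incr (along r u S v) n s - integralIncr 𝕋 (fun t k => along r u S (gx k) t) S n s|
        ≤ B * timeIncr 𝕋 r u n s + B * ∑ i, covIncr 𝕋 S i i n s := by
  obtain ⟨B, hB⟩ := isCompact_Icc.exists_bound_of_continuousOn
    (continuousOn_along hru hv.cont_t h.cont h.mem)
  choose B' hB' using fun i j => isCompact_Icc.exists_bound_of_continuousOn
    (continuousOn_along hru (hv.cont_xx i j) h.cont h.mem)
  set K : ℝ := 1 + |B| + ∑ i, ∑ j, |B' i j| with hK
  have hK0 : 0 ≤ K := by positivity
  have hK' : ∀ i j, |B' i j| ≤ ∑ i, ∑ j, |B' i j| := fun i j =>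
    (Finset.single_le_sum (f := fun j => |B' i j|) (fun _ _ => abs_nonneg _)
      (Finset.mem_univ j)).trans (Finset.single_le_sum (f := fun i => ∑ j, |B' i j|)
        (fun _ _ => Finset.sum_nonneg fun _ _ => abs_nonneg _) (Finset.mem_univ i))
  refine ⟨K * (d + 1), by positivity, ?_⟩
  filter_upwards [h.eventually_abs_itoRemainder_le hru hD hv one_pos] with n hn s hs
  have hsI := 𝕋.subset_Icc n hs
  have ht := timeIncr_nonneg (r := r) (u := u) hs
  have hc : 0 ≤ ∑ i, covIncr 𝕋 S i i n s := Finset.sum_nonneg fun i _ => covIncr_self_nonneg i n s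
  have hdd := sum_abs_covIncr_le (𝕋 := 𝕋) (S := S) n s
  set Q := ∑ i, ∑ j, |covIncr 𝕋 S i j n s| with hQ
  have hQ0 : 0 ≤ Q := Finset.sum_nonneg fun _ _ => Finset.sum_nonneg fun _ _ => abs_nonneg _
  have h1 : |along r u S gt s * timeIncr 𝕋 r u n s| ≤ |B| * timeIncr 𝕋 r u n s := by
    rw [abs_mul, abs_of_nonneg ht]
    exact mul_le_mul_of_nonneg_right ((hB s hsI).trans (le_abs_self _)) ht
  have h2 : |1 / 2 * ∑ i, ∑ j, along r u S (gxx i j) s * covIncr 𝕋 S i j n s|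
      ≤ (∑ i, ∑ j, |B' i j|) * Q := by
    rw [abs_mul]
    refine (mul_le_of_le_one_left (abs_nonneg _) (by norm_num [abs_of_pos])).trans ?_
    rw [hQ, Finset.mul_sum]
    refine (abs_sum_le_sum_abs _ _).trans (Finset.sum_le_sum fun i _ => ?_)
    rw [Finset.mul_sum]
    refine (abs_sum_le_sum_abs _ _).trans (Finset.sum_le_sum fun j _ => ?_)
    rw [abs_mul]
    exact mul_le_mul_of_nonneg_right (((hB' i j s hsI).trans (le_abs_self _)).trans (hK' i j))
      (abs_nonneg _)
  have h3 := hn s hs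
  have e : 𝕋.incr (along r u S v) n s - integralIncr 𝕋 (fun t k => along r u S (gx k) t) S n s
      = itoRemainder 𝕋 r u S v gt gx gxx n s + along r u S gt s * timeIncr 𝕋 r u n s
        + 1 / 2 * ∑ i, ∑ j, along r u S (gxx i j) s * covIncr 𝕋 S i j n s := by
    rw [itoRemainder, integralIncr]
    ring
  rw [e]
  refine (abs_add_three _ _ _).trans ?_
  have hB1 : 0 ≤ |B| := abs_nonneg B
  have hB2 : 0 ≤ ∑ i, ∑ j, |B' i j| :=
    Finset.sum_nonneg fun _ _ => Finset.sum_nonneg fun _ _ => abs_nonneg _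
  have h4 : |itoRemainder 𝕋 r u S v gt gx gxx n s| + |along r u S gt s * timeIncr 𝕋 r u n s|
      + |1 / 2 * ∑ i, ∑ j, along r u S (gxx i j) s * covIncr 𝕋 S i j n s|
      ≤ K * timeIncr 𝕋 r u n s + K * Q := by
    rw [hK]
    nlinarith [mul_nonneg hB1 hQ0, mul_nonneg hB2 ht]
  refine h4.trans ?_
  have h5 : Q ≤ (d + 1) * ∑ i, covIncr 𝕋 S i i n s := by linarith
  have h6 := mul_le_mul_of_nonneg_left h5 hK0
  have h7 : 0 ≤ K * (d * timeIncr 𝕋 r u n s) := by positivity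
  linarith

/-- The integrand in an admissible representation of `v(t,S(t))` is the gradient of `v`. -/
theorem IsModelPath.eq_grad_of_hasFollmerIntegral (hT : 0 < T) (hr : 0 ≤ r) (hru : r < u)
    (hu : u ≤ T) (hD : IsOpen D) (h : IsModelPath 𝕋 D α S)
    (hα : ∀ i j, ContinuousOn (fun p : ℝ × (Fin d → ℝ) => α p.1 p.2 i j) (Icc 0 T ×ˢ D))
    (hpd : ∀ t ∈ Icc 0 T, ∀ x ∈ D, ∀ y : Fin d → ℝ, y ≠ 0 → 0 < ∑ i, ∑ j, α t x i j * y i * y j)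
    (hv : HasGradients r u D v gt gx gxx) {ξ : ℝ → Fin d → ℝ}
    (hadm : IsBasicAdmissible d r u S ξ)
    (hξ : ∀ t ∈ Icc r u, HasFollmerIntegral T 𝕋 ξ S r t (v (t, S t) - v (r, S r))) :
    ∀ t ∈ Icc r u, ∀ k, ξ t k = gx k (t, S t) := by
  have hsub : Icc r u ⊆ Icc 0 T := Icc_subset_Icc hr hu
  obtain ⟨hξc, Φ, W, hΦ, hW, hexp⟩ := hadm.exists_expansion (h.cont.mono hsub)
  set ζ : ℝ → Fin d → ℝ := fun t k => ξ t k - along r u S (gx k) t with hζ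
  have hζc : ∀ k, ContinuousOn (fun t => ζ t k) (Icc r u) := fun k => (hξc k).sub
    ((continuousOn_along hru.le (hv.cont_x k) h.cont h.mem).mono hsub)
  have hsplit : ∀ n s, integralIncr 𝕋 ζ S n s
      = (∑ k, ξ s k * 𝕋.incr (fun t => S t k) n s)
        - integralIncr 𝕋 (fun t k => along r u S (gx k) t) S n s := fun n s => by
    simp only [integralIncr, hζ, sub_mul, Finset.sum_sub_distrib]
  set H : ℝ → ℝ := fun s => generatorTerm α gt gxx (s, S s) with hH
  have hHc : ContinuousOn H (Icc r u) := (continuousOn_generatorTerm hr hu hα hv).comp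
    (continuousOn_id.prodMk (h.cont.mono hsub)) fun t ht => ⟨ht, h.mem t (hsub ht)⟩
  have hHI : ∀ a ∈ Icc r u, ∀ b ∈ Icc r u, IntervalIntegrable H MeasureTheory.volume a b :=
    fun a ha b hb => (hHc.mono (uIcc_subset_Icc ha hb)).intervalIntegrable
  obtain ⟨K, hK⟩ := isCompact_Icc.exists_bound_of_continuousOn hHc
  have hrI : r ∈ Icc r u := left_mem_Icc.2 hru.le
  have hlim : ∀ t ∈ Icc r u, Tendsto (fun n => ∑ s ∈ (𝕋.part n).filter (fun s => r ≤ s ∧ s ≤ t),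
      integralIncr 𝕋 ζ S n s) atTop (𝓝 (∫ s in r..t, H s)) := by
    intro t ht
    have h1 := (hξ t ht).sub (h.hasFollmerIntegral_grad hT hr hu hD hα hv ht)
    rw [sub_sub_cancel] at h1
    refine h1.congr fun n => ?_
    rw [← Finset.sum_sub_distrib]
    exact Finset.sum_congr rfl fun s _ => (hsplit n s).symm
  have hzero : ∀ t ∈ Icc r u, ζ t = 0 := by
    by_contra! hne
    obtain ⟨t0, ht0, hne⟩ := hne
    have hζc' : ContinuousOn ζ (Icc r u) := continuousOn_pi.2 hζc
    obtain ⟨ε, hε, hball⟩ := Metric.mem_nhdsWithin_iff.1 ((hζc' t0 ht0).eventually_ne hne)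
    have hpq : max r (t0 - ε / 2) < min u (t0 + ε / 2) := by
      refine max_lt (lt_min hru ?_) (lt_min ?_ ?_) <;> linarith [ht0.1, ht0.2]
    obtain ⟨p, q, hp, hpq', hq, C, δ, hδ, -, hbd⟩ :=
      hexp _ _ (le_max_left _ _) hpq (min_le_left _ _)
    have hrp : r ≤ p := (le_max_left _ _).trans hp
    have hqu : q ≤ u := hq.trans (min_le_left _ _)
    have hI : Icc p q ⊆ Icc r u := Icc_subset_Icc hrp hqu
    obtain ⟨B, hB0, hB⟩ := h.exists_abs_incr_along_sub_le hru.le hD hv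
    refine hball ⟨?_, hI (left_mem_Icc.2 hpq'.le)⟩ (h.eq_zero_of_abs_incr_sub_le hT (hr.trans hrp)
      hpq' (hqu.trans hu) hα hpd (Φ := fun t => Φ t - along r u S v t)
      (W := fun t => W t + B * clamp r u t) (L := fun t => ∫ s in r..t, H s) (C := C + B) (K := K)
      (fun k => (hζc k).mono hI) ?_ ?_ ?_ ?_ ?_ p (left_mem_Icc.2 hpq'.le))
    · have h1 : t0 - ε / 2 ≤ p := (le_max_right _ _).trans hp
      have h2 : q ≤ t0 + ε / 2 := hq.trans (min_le_right _ _)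
      rw [Metric.mem_ball, Real.dist_eq, abs_lt]
      constructor <;> linarith
    · exact (hΦ.mono hI).sub
        ((continuousOn_along hru.le hv.cont h.cont h.mem).mono (hI.trans hsub))
    · exact (hW.mono hI).add fun s _ t _ hst => mul_le_mul_of_nonneg_left (clamp_mono hst) hB0
    · filter_upwards [hB, 𝕋.eventually_mesh hδ] with n hn hmesh s hs hps hsq
      have hs' := le_succOf (𝕋.top_mem n) (𝕋.le_of_mem s hs)
      have h1 := hbd s ⟨hps, hs'.trans hsq⟩ _ ⟨hps.trans hs', hsq⟩ hs' (hmesh s hs)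
      have h2 := hn s hs
      have e : 𝕋.incr (fun t => Φ t - along r u S v t) n s - integralIncr 𝕋 ζ S n s
          = (𝕋.incr Φ n s - ∑ k, ξ s k * 𝕋.incr (fun t => S t k) n s)
            - (𝕋.incr (along r u S v) n s
              - integralIncr 𝕋 (fun t k => along r u S (gx k) t) S n s) := by
        rw [hsplit]
        simp only [PartitionSeq.incr]
        ring
      rw [e]
      refine (abs_sub _ _).trans ((add_le_add h1 h2).trans (le_of_eq ?_))
      simp only [PartitionSeq.incr, timeIncr, covIncr]
      ring
    · exact fun a ha b hb hab => PartitionSeq.tendsto_sum_inner_of_forall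
        (h.nullTerms_integralIncr hζc) hlim (hI ha) (hI hb) hab
    · intro a ha b hb hab
      rw [intervalIntegral.integral_interval_sub_left (hHI r hrI b (hI hb)) (hHI r hrI a (hI ha))]
      have h1 := intervalIntegral.norm_integral_le_of_norm_le_const (E := ℝ) (f := H) (C := K)
        (a := a) (b := b) fun s hs => by
          rw [uIoc_of_le hab] at hs
          exact hK s (hI ⟨ha.1.trans hs.1.le, hs.2.trans hb.2⟩)
      rwa [Real.norm_eq_abs, abs_of_nonneg (sub_nonneg.2 hab)] at h1
  intro t ht k
  have h1 := congrFun (hzero t ht) k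
  simp only [hζ, Pi.zero_apply, along_of_mem _ ht] at h1
  linarith

end GradientIdentification

section Admissible

variable {d : ℕ} {r u : ℝ} {D : Set (Fin d → ℝ)} {S : ℝ → Fin d → ℝ}
  {v gt : ℝ × (Fin d → ℝ) → ℝ} {gx : Fin d → ℝ × (Fin d → ℝ) → ℝ}
  {gxx : Fin d → Fin d → ℝ × (Fin d → ℝ) → ℝ}

lemma contDiffOn_add_one_of_hasFDerivAt {E F : Type*} [NormedAddCommGroup E] [NormedSpace ℝ E]
    [NormedAddCommGroup F] [NormedSpace ℝ F] {f : E → F} {f' : E → E →L[ℝ] F} {s : Set E} {n : ℕ}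
    (hs : IsOpen s) (hf : ∀ x ∈ s, HasFDerivAt f (f' x) x) (hf' : ContDiffOn ℝ n f' s) :
    ContDiffOn ℝ (n + 1) f s := by
  rw [contDiffOn_succ_iff_fderiv_of_isOpen hs]
  refine ⟨fun x hx => (hf x hx).differentiableAt.differentiableWithinAt, by simp,
    hf'.congr fun x hx => (hf x hx).fderiv⟩

/-- Continuous partial derivatives imply continuous differentiability. -/
lemma contDiffOn_one_of_partial {E₁ E₂ : Type*} [NormedAddCommGroup E₁] [NormedSpace ℝ E₁]
    [NormedAddCommGroup E₂] [NormedSpace ℝ E₂] {f : E₁ × E₂ → ℝ} {f₁ : E₁ × E₂ → E₁ →L[ℝ] ℝ}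
    {f₂ : E₁ × E₂ → E₂ →L[ℝ] ℝ} {O : Set (E₁ × E₂)} (hO : IsOpen O)
    (h₁ : ∀ z ∈ O, HasFDerivAt (fun b => f (b, z.2)) (f₁ z) z.1)
    (h₂ : ∀ z ∈ O, HasFDerivAt (fun x => f (z.1, x)) (f₂ z) z.2)
    (c₁ : ContinuousOn f₁ O) (c₂ : ContinuousOn f₂ O) : ContDiffOn ℝ 1 f O := by
  have hd : ∀ z ∈ O, HasFDerivAt f ((f₁ z).coprod (f₂ z)) z := fun z hz =>
    (hasStrictFDerivAt_uncurry_coprod (f := fun b x => f (b, x)) (f₁ := fun b x => f₁ (b, x))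
      (f₂ := fun b x => f₂ (b, x)) (eventually_of_mem (hO.mem_nhds hz) h₁)
      (eventually_of_mem (hO.mem_nhds hz) h₂) (c₁.continuousAt (hO.mem_nhds hz))
      (c₂.continuousAt (hO.mem_nhds hz))).hasFDerivAt
  have hc : ContinuousOn (fun z => (f₁ z).coprod (f₂ z)) O := by
    have : ContinuousOn (fun z => (f₁ z).comp (ContinuousLinearMap.fst ℝ E₁ E₂)
        + (f₂ z).comp (ContinuousLinearMap.snd ℝ E₁ E₂)) O :=
      (c₁.clm_comp continuousOn_const).add (c₂.clm_comp continuousOn_const)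
    exact this.congr fun z _ => by ext <;> simp
  simpa using contDiffOn_add_one_of_hasFDerivAt (n := 0) hO hd (contDiffOn_zero.2 hc)

lemma contDiff_coordFun {n : WithTop ℕ∞} :
    ContDiff ℝ n (coordFun : (Fin d → ℝ) → (Fin d → ℝ) →L[ℝ] ℝ) := by
  unfold coordFun
  fun_prop

lemma HasGradients.contDiffOn_slice (h : HasGradients r u D v gt gx gxx) (hD : IsOpen D) {t : ℝ}
    (ht : t ∈ Icc r u) : ContDiffOn ℝ 2 (fun x => v (t, x)) D := by
  have hslice : ∀ {g : ℝ × (Fin d → ℝ) → ℝ}, ContinuousOn g (Icc r u ×ˢ D) →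
      ContinuousOn (fun x => g (t, x)) D := fun hg =>
    hg.comp (by fun_prop) fun x hx => ⟨ht, hx⟩
  have h1 : ∀ j, ContDiffOn ℝ 1 (fun x => gx j (t, x)) D := by
    intro j
    refine contDiffOn_add_one_of_hasFDerivAt (n := 0) hD (h.hasFDerivAt_grad j t ht) ?_
    exact contDiffOn_zero.2 (continuous_coordFun.comp_continuousOn
      (continuousOn_pi.2 fun i => hslice (h.cont_xx i j)))
  have h2 := contDiffOn_add_one_of_hasFDerivAt (n := 1) hD (h.hasFDerivAt t ht)
    (contDiff_coordFun.comp_contDiffOn (contDiffOn_pi.2 fun i => by exact_mod_cast h1 i))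
  norm_num at h2
  exact h2

/-- Smooth surjection of the line onto `[r,u]`. -/
def clock (r u b : ℝ) : ℝ := r + (u - r) * ((1 - Real.cos b) / 2)

/-- Continuous increasing right inverse of `clock` on `[r,u]`. -/
def clockInv (r u t : ℝ) : ℝ := Real.arccos (1 - 2 * (t - r) / (u - r))

lemma clock_mem_Icc (hru : r < u) (b : ℝ) : clock r u b ∈ Icc r u := by
  have h1 := Real.cos_le_one b
  have h2 := Real.neg_one_le_cos b
  have h3 : 0 < u - r := sub_pos.2 hru
  constructor <;> unfold clock <;> nlinarith

lemma hasDerivAt_clock (b : ℝ) :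
    HasDerivAt (clock r u) ((u - r) * (Real.sin b / 2)) b := by
  unfold clock
  have := ((((Real.hasDerivAt_cos b).const_sub 1).div_const 2).const_mul (u - r)).const_add r
  simpa using this

lemma continuous_clock : Continuous (clock r u) := by
  unfold clock
  fun_prop

lemma clock_clockInv (hru : r < u) {t : ℝ} (ht : t ∈ Icc r u) :
    clock r u (clockInv r u t) = t := by
  have h3 : 0 < u - r := sub_pos.2 hru
  have h4 : 0 ≤ (t - r) / (u - r) := div_nonneg (sub_nonneg.2 ht.1) h3.le
  have h5 : (t - r) / (u - r) ≤ 1 := (div_le_one h3).2 (by linarith [ht.2])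
  rw [clock, clockInv, mul_div_assoc, Real.cos_arccos (by linarith) (by linarith)]
  field_simp
  ring

lemma monotone_clockInv (hru : r < u) : Monotone (clockInv r u) := by
  intro s t hst
  have h3 : 0 < u - r := sub_pos.2 hru
  refine Real.antitone_arccos ?_
  gcongr

lemma continuous_clockInv : Continuous (clockInv r u) := by
  unfold clockInv
  fun_prop

lemma HasGradients.contDiffOn_clock (h : HasGradients r u D v gt gx gxx) (hru : r < u)
    (hD : IsOpen D) :
    ContDiffOn ℝ 1 (fun z : (Fin 1 → ℝ) × (Fin d → ℝ) => v (clock r u (z.1 0), z.2))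
      (univ ×ˢ D) := by
  have hO : IsOpen ((univ : Set (Fin 1 → ℝ)) ×ˢ D) := isOpen_univ.prod hD
  have hmaps : ContinuousOn (fun z : (Fin 1 → ℝ) × (Fin d → ℝ) => (clock r u (z.1 0), z.2))
      (univ ×ˢ D) :=
    ((continuous_clock.comp (by fun_prop : Continuous fun z : (Fin 1 → ℝ) × (Fin d → ℝ) =>
      z.1 0)).prodMk continuous_snd).continuousOn
  have hcomp : ∀ {g : ℝ × (Fin d → ℝ) → ℝ}, ContinuousOn g (Icc r u ×ˢ D) → ContinuousOn
      (fun z : (Fin 1 → ℝ) × (Fin d → ℝ) => g (clock r u (z.1 0), z.2)) (univ ×ˢ D) := fun hg =>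
    hg.comp hmaps fun z hz => ⟨clock_mem_Icc hru _, hz.2⟩
  refine contDiffOn_one_of_partial
    (f₁ := fun z : (Fin 1 → ℝ) × (Fin d → ℝ) =>
      (gt (clock r u (z.1 0), z.2) * ((u - r) * (Real.sin (z.1 0) / 2))) •
      ContinuousLinearMap.proj (R := ℝ) (φ := fun _ : Fin 1 => ℝ) 0)
    (f₂ := fun z : (Fin 1 → ℝ) × (Fin d → ℝ) => coordFun fun i => gx i (clock r u (z.1 0), z.2))
    hO (fun z hz => ?_)
    (fun z hz => h.hasFDerivAt _ (clock_mem_Icc hru (z.1 0)) z.2 hz.2) ?_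
    (continuous_coordFun.comp_continuousOn (continuousOn_pi.2 fun i => hcomp (h.cont_x i)))
  · have h1 : HasDerivAt (fun b => v (clock r u b, z.2))
        (gt (clock r u (z.1 0), z.2) * ((u - r) * (Real.sin (z.1 0) / 2))) (z.1 0) :=
      (h.hasDerivWithinAt _ (clock_mem_Icc hru (z.1 0)) z.2 hz.2).comp_hasDerivAt (z.1 0)
        (hasDerivAt_clock (r := r) (u := u) (z.1 0))
        (Eventually.of_forall fun b => clock_mem_Icc hru b)
    have h2 : HasFDerivAt (fun b : Fin 1 → ℝ => b 0)
        (ContinuousLinearMap.proj (R := ℝ) (φ := fun _ : Fin 1 => ℝ) 0) z.1 :=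
      hasFDerivAt_apply 0 z.1
    exact h1.comp_hasFDerivAt z.1 h2
  · refine ContinuousOn.smul ((hcomp h.cont_t).mul ?_) continuousOn_const
    fun_prop

/-- The gradient of a `C^{1,2}` function along a continuous path is basic admissible. -/
theorem HasGradients.isBasicAdmissible (h : HasGradients r u D v gt gx gxx) (hru : r < u)
    (hD : IsOpen D) (hS : ∀ t ∈ Icc r u, S t ∈ D) :
    IsBasicAdmissible d r u S fun t k => gx k (t, S t) := by
  refine ⟨1, fun t _ => clockInv r u t, univ ×ˢ D, fun z => v (clock r u (z.1 0), z.2),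
    continuousOn_pi.2 fun _ => continuous_clockInv.continuousOn, fun _ => ?_,
    isOpen_univ.prod hD, fun t ht => ⟨mem_univ _, hS t ht⟩, h.contDiffOn_clock hru hD,
    fun b => ?_, fun t ht k => ?_⟩
  · have h1 : LocallyBoundedVariationOn (clockInv r u) (Icc r u) :=
      ((monotone_clockInv hru).monotoneOn _).locallyBoundedVariationOn
    have h2 := h1 r u ⟨le_rfl, hru.le⟩ ⟨hru.le, le_rfl⟩
    rwa [inter_self] at h2
  · have := h.contDiffOn_slice hD (clock_mem_Icc hru (b 0))
    simpa using this
  · simp only [clock_clockInv hru ht]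
    rw [(h.hasFDerivAt t ht _ (hS t ht)).fderiv, coordFun_single]

end Admissible

section Equivalence

variable {T : ℝ} {𝕋 : PartitionSeq T} {d : ℕ} {r u : ℝ} {D : Set (Fin d → ℝ)}
variable {α : ℝ → (Fin d → ℝ) → Fin d → Fin d → ℝ} {S : ℝ → Fin d → ℝ}
variable {v gt : ℝ × (Fin d → ℝ) → ℝ} {gx : Fin d → ℝ × (Fin d → ℝ) → ℝ}
    {gxx : Fin d → Fin d → ℝ × (Fin d → ℝ) → ℝ}

lemma HasFollmerIntegral.congr {ξ ξ' : ℝ → Fin d → ℝ} {t I : ℝ} (hu : t ≤ u)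
    (h : HasFollmerIntegral T 𝕋 ξ S r t I) (hξ : ∀ s ∈ Icc r u, ∀ k, ξ s k = ξ' s k) :
    HasFollmerIntegral T 𝕋 ξ' S r t I := by
  refine Tendsto.congr (fun n => Finset.sum_congr rfl fun s hs => Finset.sum_congr rfl
    fun k _ => ?_) h
  rw [Finset.mem_filter] at hs
  simp only [hξ s ⟨hs.2.1, hs.2.2.trans hu⟩ k]

/-- Solutions of the parabolic equation are replicated by their gradients. -/
lemma IsModelPath.hasFollmerIntegral_of_generatorTerm_eq_zero (hT : 0 < T) (hr : 0 ≤ r)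
    (hu : u ≤ T) (hD : IsOpen D) (h : IsModelPath 𝕋 D α S)
    (hα : ∀ i j, ContinuousOn (fun p : ℝ × (Fin d → ℝ) => α p.1 p.2 i j) (Icc 0 T ×ˢ D))
    (hv : HasGradients r u D v gt gx gxx)
    (h0 : ∀ t ∈ Icc r u, ∀ x ∈ D, generatorTerm α gt gxx (t, x) = 0) {t : ℝ}
    (ht : t ∈ Icc r u) :
    HasFollmerIntegral T 𝕋 (fun s k => gx k (s, S s)) S r t (v (t, S t) - v (r, S r)) := by
  have h1 := h.hasFollmerIntegral_grad hT hr hu hD hα hv ht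
  have h2 : ∫ s in r..t, generatorTerm α gt gxx (s, S s) = 0 := by
    rw [intervalIntegral.integral_congr (g := fun _ => 0), intervalIntegral.integral_zero]
    intro s hs
    rw [uIcc_of_le ht.1] at hs
    have hs' : s ∈ Icc r u := ⟨hs.1, hs.2.trans ht.2⟩
    exact h0 s hs' _ (h.mem s (Icc_subset_Icc hr hu hs'))
  rw [h2, sub_zero] at h1
  exact h1.congr ht.2 fun s hs k => along_of_mem _ hs

/-- If `v` is replicated along `S`, the parabolic equation holds along `S`. -/
lemma IsModelPath.generatorTerm_eq_zero_of_hasFollmerIntegral (hT : 0 < T) (hr : 0 ≤ r)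
    (hru : r < u) (hu : u ≤ T) (hD : IsOpen D) (h : IsModelPath 𝕋 D α S)
    (hα : ∀ i j, ContinuousOn (fun p : ℝ × (Fin d → ℝ) => α p.1 p.2 i j) (Icc 0 T ×ˢ D))
    (hpd : ∀ t ∈ Icc 0 T, ∀ x ∈ D, ∀ y : Fin d → ℝ, y ≠ 0 → 0 < ∑ i, ∑ j, α t x i j * y i * y j)
    (hv : HasGradients r u D v gt gx gxx) {ξ : ℝ → Fin d → ℝ}
    (hadm : IsBasicAdmissible d r u S ξ)
    (hξ : ∀ t ∈ Icc r u, HasFollmerIntegral T 𝕋 ξ S r t (v (t, S t) - v (r, S r))) :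
    ∀ t ∈ Icc r u, generatorTerm α gt gxx (t, S t) = 0 := by
  have hsub : Icc r u ⊆ Icc 0 T := Icc_subset_Icc hr hu
  have hgrad := h.eq_grad_of_hasFollmerIntegral hT hr hru hu hD hα hpd hv hadm hξ
  have hc : ContinuousOn (fun s => generatorTerm α gt gxx (s, S s)) (Icc r u) :=
    (continuousOn_generatorTerm hr hu hα hv).comp
      (continuousOn_id.prodMk (h.cont.mono hsub)) fun s hs => ⟨hs, h.mem s (hsub hs)⟩
  have hint : ∀ t ∈ Icc r u, ∫ s in r..t, generatorTerm α gt gxx (s, S s) = 0 := by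
    intro t ht
    have h1 := h.hasFollmerIntegral_grad hT hr hu hD hα hv ht
    have h2 := (hξ t ht).congr ht.2 fun s hs k =>
      (hgrad s hs k).trans (along_of_mem (gx k) hs).symm
    have h3 := tendsto_nhds_unique h1 h2
    linarith
  have hderiv : ∀ t ∈ Icc r u, HasDerivWithinAt
      (fun t => ∫ s in r..t, generatorTerm α gt gxx (s, S s))
      (generatorTerm α gt gxx (t, S t)) (Icc r u) t := by
    intro t ht
    have : Fact (t ∈ Icc r u) := ⟨ht⟩
    exact intervalIntegral.integral_hasDerivWithinAt_right
      ((hc.mono (by rw [uIcc_of_le ht.1]; exact Icc_subset_Icc_right ht.2)).intervalIntegrable)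
      (hc.stronglyMeasurableAtFilter_nhdsWithin measurableSet_Icc t) (hc t ht)
  intro t ht
  have h4 : HasDerivWithinAt (fun t => ∫ s in r..t, generatorTerm α gt gxx (s, S s)) 0
      (Icc r u) t :=
    (hasDerivWithinAt_const t (Icc r u) (0 : ℝ)).congr hint (hint t ht)
  exact (uniqueDiffOn_Icc hru t ht).eq_deriv _ (hderiv t ht) h4

/-- If `v` is replicated along all model paths, it solves the parabolic equation. -/
lemma generatorTerm_eq_zero_of_forall_isModelPath (hr : 0 ≤ r) (hu : u ≤ T) (hD : IsOpen D)
    (hα : ∀ i j, ContinuousOn (fun p : ℝ × (Fin d → ℝ) => α p.1 p.2 i j) (Icc 0 T ×ˢ D))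
    (hsymm : ∀ t ∈ Icc 0 T, ∀ x ∈ D, ∀ i j, α t x i j = α t x j i)
    (hpd : ∀ t ∈ Icc 0 T, ∀ x ∈ D, ∀ y : Fin d → ℝ, y ≠ 0 → 0 < ∑ i, ∑ j, α t x i j * y i * y j)
    (hv : HasGradients r u D v gt gx gxx)
    (h0 : ∀ S, IsModelPath 𝕋 D α S → ∀ t ∈ Icc r u, generatorTerm α gt gxx (t, S t) = 0) :
    ∀ t ∈ Icc r u, ∀ x ∈ D, generatorTerm α gt gxx (t, x) = 0 := by
  intro t ht x hx
  obtain ⟨ε, hε, hball⟩ := Metric.isOpen_iff.1 hD x hx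
  have hpath : ∀ n : ℕ, ∃ y ∈ Metric.closedBall x (ε / (n + 2)), y ∈ D ∧
      generatorTerm α gt gxx (t, y) = 0 := by
    intro n
    have hρ : 0 < ε / (n + 2) := by positivity
    have hsubD : Metric.closedBall x (ε / (n + 2)) ⊆ D := by
      refine (Metric.closedBall_subset_ball ?_).trans hball
      rw [div_lt_iff₀ (by positivity)]
      nlinarith [(Nat.cast_nonneg n : (0 : ℝ) ≤ n)]
    obtain ⟨S, hSc, hSb, hScov⟩ := exists_path (𝕋 := 𝕋) (α := α) hρ
      (fun i j => (hα i j).mono (prod_mono subset_rfl hsubD))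
      (fun t ht x hx => hsymm t ht x (hsubD hx)) (fun t ht x hx y => by
        rcases eq_or_ne y 0 with rfl | hy
        · simp
        · exact (hpd t ht x (hsubD hx) y hy).le)
    exact ⟨S t, hSb t, hsubD (hSb t), h0 S ⟨hSc, fun s _ => hsubD (hSb s), hScov⟩ t ht⟩
  choose y hyb hyD hy0 using hpath
  have hlim : Tendsto y atTop (𝓝 x) := by
    rw [tendsto_iff_dist_tendsto_zero]
    refine squeeze_zero (fun n => dist_nonneg) (fun n => hyb n) ?_
    refine tendsto_const_nhds.div_atTop ?_
    exact tendsto_atTop_add_const_right _ _ tendsto_natCast_atTop_atTop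
  have h1 : Tendsto (fun n => generatorTerm α gt gxx (t, y n)) atTop
      (𝓝 (generatorTerm α gt gxx (t, x))) :=
    (continuousOn_generatorTerm hr hu hα hv (t, x) ⟨ht, hx⟩).tendsto.comp
      (tendsto_nhdsWithin_iff.2 ⟨tendsto_const_nhds.prodMk_nhds hlim,
        Eventually.of_forall fun n => ⟨ht, hyD n⟩⟩)
  simp only [hy0] at h1
  exact (tendsto_nhds_unique h1 tendsto_const_nhds)

/-- Replication by basic admissible integrands along all model paths is equivalent to the
parabolic equation, and the integrand is then the gradient. -/
theorem replication_iff_parabolic {v : ℝ → (Fin d → ℝ) → ℝ} (hT : 0 < T) (hr : 0 ≤ r)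
    (hru : r < u) (hu : u ≤ T) (hD : IsOpen D)
    (hα : ∀ i j, ContinuousOn (fun p : ℝ × (Fin d → ℝ) => α p.1 p.2 i j) (Icc 0 T ×ˢ D))
    (hsymm : ∀ t ∈ Icc 0 T, ∀ x ∈ D, ∀ i j, α t x i j = α t x j i)
    (hpd : ∀ t ∈ Icc 0 T, ∀ x ∈ D, ∀ y : Fin d → ℝ, y ≠ 0 → 0 < ∑ i, ∑ j, α t x i j * y i * y j)
    (hv : IsC12 (Icc r u) D v) :
    ((∀ S, IsModelPath 𝕋 D α S → ∃ ξ : ℝ → Fin d → ℝ, IsBasicAdmissible d r u S ξ ∧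
        ∀ t ∈ Icc r u, HasFollmerIntegral T 𝕋 ξ S r t (v t (S t) - v r (S r))) ↔
      ∀ t ∈ Icc r u, ∀ x ∈ D, tderiv (Icc r u) v t x
        + (1 / 2) * ∑ i, ∑ j, α t x i j * pd2 (v t) i j x = 0) ∧
    ∀ S, IsModelPath 𝕋 D α S → ∀ ξ : ℝ → Fin d → ℝ, IsBasicAdmissible d r u S ξ →
      (∀ t ∈ Icc r u, HasFollmerIntegral T 𝕋 ξ S r t (v t (S t) - v r (S r))) →
      ∀ t ∈ Icc r u, ∀ k, ξ t k = pd1 (v t) k (S t) := by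
  obtain ⟨gt, gx, gxx, hg⟩ := hv.exists_hasGradients hru hD
  have hsub : Icc r u ⊆ Icc 0 T := Icc_subset_Icc hr hu
  have hgen : ∀ t ∈ Icc r u, ∀ x ∈ D, tderiv (Icc r u) v t x
      + (1 / 2) * ∑ i, ∑ j, α t x i j * pd2 (v t) i j x = generatorTerm α gt gxx (t, x) := by
    intro t ht x hx
    rw [hg.tderiv_eq hru ht hx, generatorTerm]
    congr 2
    exact Finset.sum_congr rfl fun i _ => Finset.sum_congr rfl fun j _ => by
      rw [← hg.pd2_eq hD ht hx i j]
  refine ⟨⟨fun h t ht x hx => ?_, fun h S hS => ?_⟩, fun S hS ξ hadm hξ t ht k => ?_⟩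
  · rw [hgen t ht x hx]
    refine generatorTerm_eq_zero_of_forall_isModelPath (𝕋 := 𝕋) hr hu hD hα hsymm hpd hg
      (fun S hS => ?_) t ht x hx
    obtain ⟨ξ, hadm, hξ⟩ := h S hS
    exact hS.generatorTerm_eq_zero_of_hasFollmerIntegral hT hr hru hu hD hα hpd hg hadm hξ
  · refine ⟨fun t k => gx k (t, S t),
      hg.isBasicAdmissible hru hD fun t ht => hS.mem t (hsub ht), fun t ht => ?_⟩
    exact hS.hasFollmerIntegral_of_generatorTerm_eq_zero hT hr hu hD hα hg
      (fun t ht x hx => by rw [← hgen t ht x hx, h t ht x hx]) ht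
  · rw [hS.eq_grad_of_hasFollmerIntegral hT hr hru hu hD hα hpd hg hadm hξ t ht k]
    exact (hg.pd1_eq ht (hS.mem t (hsub ht)) k).symm

lemma isOpen_posOrth : IsOpen (posOrth d) := by
  have : posOrth d = ⋂ i, {x | 0 < x i} := by
    ext x
    simp [posOrth]
  rw [this]
  exact isOpen_iInter_of_finite fun i => isOpen_lt continuous_const (continuous_apply i)

lemma mem_SclassA_iff : S ∈ SclassA T 𝕋 α ↔ IsModelPath 𝕋 univ α S :=
  ⟨fun h => ⟨h.1, fun _ _ => mem_univ _, h.2⟩, fun h => ⟨h.cont, h.cov⟩⟩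

lemma mem_SclassAPos_iff : S ∈ SclassAPos T 𝕋 α ↔
    IsModelPath 𝕋 (posOrth d) (fun t x i j => α t x i j * x i * x j) S :=
  ⟨fun h => ⟨h.1, h.2.1, h.2.2⟩, fun h => ⟨h.cont, h.mem, h.cov⟩⟩

end Equivalence

/-- Proposition 2.4: `v(t,S(t))` is the value of a self-financing strategy with a basic
admissible integrand for every `S ∈ 𝒮_a` iff `v` solves `∂v/∂t + ℒv = 0`; in that case the
integrand is necessarily `∇ₓv(t,S(t))`.  The same holds for `𝒮_a^+`, `ℝ₊^d` and `ℒ⁺`. -/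
theorem stmt3 (T : ℝ) (hT : 0 < T) (𝕋 : PartitionSeq T) (d : ℕ)
    (a aP : ℝ → (Fin d → ℝ) → Fin d → Fin d → ℝ)
    (ha_cont : ∀ i j, ContinuousOn (fun p : ℝ × (Fin d → ℝ) => a p.1 p.2 i j)
      (Set.Icc 0 T ×ˢ (Set.univ : Set (Fin d → ℝ))))
    (ha_symm : ∀ t ∈ Set.Icc (0 : ℝ) T, ∀ x : Fin d → ℝ, ∀ i j, a t x i j = a t x j i)
    (ha_pd : ∀ t ∈ Set.Icc (0 : ℝ) T, ∀ x : Fin d → ℝ, ∀ y : Fin d → ℝ, y ≠ 0 →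
      0 < ∑ i, ∑ j, a t x i j * y i * y j)
    (haP_cont : ∀ i j, ContinuousOn (fun p : ℝ × (Fin d → ℝ) => aP p.1 p.2 i j)
      (Set.Icc 0 T ×ˢ posOrth d))
    (haP_symm : ∀ t ∈ Set.Icc (0 : ℝ) T, ∀ x ∈ posOrth d, ∀ i j, aP t x i j = aP t x j i)
    (haP_pd : ∀ t ∈ Set.Icc (0 : ℝ) T, ∀ x ∈ posOrth d, ∀ y : Fin d → ℝ, y ≠ 0 →
      0 < ∑ i, ∑ j, aP t x i j * y i * y j)
    (r u : ℝ) (hr : 0 ≤ r) (hru : r < u) (hu : u ≤ T)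
    (v : ℝ → (Fin d → ℝ) → ℝ) (hv : IsC12 (Set.Icc r u) (Set.univ : Set (Fin d → ℝ)) v)
    (vP : ℝ → (Fin d → ℝ) → ℝ) (hvP : IsC12 (Set.Icc r u) (posOrth d) vP) :
    -- the case of `𝒮_a`, `ℝ^d`, `ℒ`
    (((∀ S ∈ SclassA T 𝕋 a, ∃ ξ : ℝ → Fin d → ℝ,
        IsBasicAdmissible d r u S ξ ∧
        ∀ t ∈ Set.Icc r u, HasFollmerIntegral T 𝕋 ξ S r t (v t (S t) - v r (S r))) ↔
      (∀ t ∈ Set.Icc r u, ∀ x : Fin d → ℝ,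
        tderiv (Set.Icc r u) v t x
          + (1 / 2) * ∑ i, ∑ j, a t x i j * pd2 (v t) i j x = 0)) ∧
    ((∀ t ∈ Set.Icc r u, ∀ x : Fin d → ℝ,
        tderiv (Set.Icc r u) v t x
          + (1 / 2) * ∑ i, ∑ j, a t x i j * pd2 (v t) i j x = 0) →
      ∀ S ∈ SclassA T 𝕋 a, ∀ ξ : ℝ → Fin d → ℝ,
        IsBasicAdmissible d r u S ξ →
        (∀ t ∈ Set.Icc r u, HasFollmerIntegral T 𝕋 ξ S r t (v t (S t) - v r (S r))) →
        ∀ t ∈ Set.Icc r u, ∀ k : Fin d, ξ t k = pd1 (v t) k (S t)))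
    ∧
    -- the case of `𝒮_a^+`, `ℝ₊^d`, `ℒ⁺`
    (((∀ S ∈ SclassAPos T 𝕋 aP, ∃ ξ : ℝ → Fin d → ℝ,
        IsBasicAdmissible d r u S ξ ∧
        ∀ t ∈ Set.Icc r u, HasFollmerIntegral T 𝕋 ξ S r t (vP t (S t) - vP r (S r))) ↔
      (∀ t ∈ Set.Icc r u, ∀ x ∈ posOrth d,
        tderiv (Set.Icc r u) vP t x
          + (1 / 2) * ∑ i, ∑ j, aP t x i j * x i * x j * pd2 (vP t) i j x = 0)) ∧
    ((∀ t ∈ Set.Icc r u, ∀ x ∈ posOrth d,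
        tderiv (Set.Icc r u) vP t x
          + (1 / 2) * ∑ i, ∑ j, aP t x i j * x i * x j * pd2 (vP t) i j x = 0) →
      ∀ S ∈ SclassAPos T 𝕋 aP, ∀ ξ : ℝ → Fin d → ℝ,
        IsBasicAdmissible d r u S ξ →
        (∀ t ∈ Set.Icc r u, HasFollmerIntegral T 𝕋 ξ S r t (vP t (S t) - vP r (S r))) →
        ∀ t ∈ Set.Icc r u, ∀ k : Fin d, ξ t k = pd1 (vP t) k (S t))) := by
  have hP_cont : ∀ i j, ContinuousOn
      (fun p : ℝ × (Fin d → ℝ) => aP p.1 p.2 i j * p.2 i * p.2 j) (Icc 0 T ×ˢ posOrth d) :=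
    fun i j => ((haP_cont i j).mul (by fun_prop)).mul (by fun_prop)
  have hP_symm : ∀ t ∈ Icc 0 T, ∀ x ∈ posOrth d, ∀ i j,
      aP t x i j * x i * x j = aP t x j i * x j * x i := fun t ht x hx i j => by
    rw [haP_symm t ht x hx i j]
    ring
  have hP_pd : ∀ t ∈ Icc 0 T, ∀ x ∈ posOrth d, ∀ y : Fin d → ℝ, y ≠ 0 →
      0 < ∑ i, ∑ j, aP t x i j * x i * x j * y i * y j := by
    intro t ht x hx y hy
    have hxy : (fun i => x i * y i) ≠ 0 := fun h => hy <| funext fun i =>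
      (mul_eq_zero.1 (congrFun h i)).resolve_left (hx i).ne'
    refine (haP_pd t ht x hx _ hxy).trans_eq ?_
    exact Finset.sum_congr rfl fun i _ => Finset.sum_congr rfl fun j _ => by ring
  have h1 := replication_iff_parabolic (𝕋 := 𝕋) hT hr hru hu isOpen_univ ha_cont
    (fun t ht x _ => ha_symm t ht x) (fun t ht x _ => ha_pd t ht x) hv
  have h2 := replication_iff_parabolic (𝕋 := 𝕋) hT hr hru hu isOpen_posOrth hP_cont
    hP_symm hP_pd hvP
  simp only [← mem_SclassA_iff, mem_univ, forall_true_left] at h1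
  simp only [← mem_SclassAPos_iff] at h2
  exact ⟨⟨h1.1, fun _ => h1.2⟩, ⟨h2.1, fun _ => h2.2⟩⟩
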